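/- Let α = [a_0, a_1, a_2, …] be an algebraic irrational continued fraction whose partial quotients are all positive integers. If α is 1-palindromic, then α is a reduced quadratic irrational that is equivalent to its algebraic conjugate. -/

import Mathlib

/-- Value of a finite continued fraction `[a₀, a₁, …, a_i] = a₀ + 1/(a₁ + 1/(⋯ + 1/a_i))`. -/
noncomputable def cfVal : List ℕ → ℝ
  | [] => 0
  | [a] => (a : ℝ)
  | a :: b :: rest => (a : ℝ) + 1 / cfVal (b :: rest)

/-- `A` is an `m`-palindrome: `[A] = m·[Ã]`, where `Ã` is the reversal of `A`. -/
def IsMPal (m : ℕ) (A : List ℕ) : Prop := cfVal A = (m : ℝ) * cfVal A.reverse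

/-- The prefix `(a₀, …, a_i)` of an infinite sequence of partial quotients. -/
def cfPrefix (a : ℕ → ℕ) (i : ℕ) : List ℕ := (List.range (i + 1)).map a

/-- Continuant numerators, index-shifted: `contP a (k+1) = p_k`, `contP a 0 = p₋₁ = 1`. -/
def contP (a : ℕ → ℕ) : ℕ → ℤ
  | 0 => 1
  | 1 => (a 0 : ℤ)
  | (k+2) => (a (k+1) : ℤ) * contP a (k+1) + contP a k

/-- Continuant denominators, index-shifted: `contQ a (k+1) = q_k`, `contQ a 0 = q₋₁ = 0`. -/
def contQ (a : ℕ → ℕ) : ℕ → ℤ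
  | 0 => 0
  | 1 => 1
  | (k+2) => (a (k+1) : ℤ) * contQ a (k+1) + contQ a k

/-- Concatenation of `k` copies of the finite sequence `A`. -/
def listPow (A : List ℕ) (k : ℕ) : List ℕ := (List.replicate k A).flatten

/-- `x` is a quadratic irrational. -/
def IsQuadraticIrrational (x : ℝ) : Prop :=
  Irrational x ∧ ∃ a b c : ℤ, a ≠ 0 ∧ (a : ℝ) * x ^ 2 + (b : ℝ) * x + (c : ℝ) = 0

/-- `x` is a reduced quadratic irrational: `x > 1` and its algebraic (Galois) conjugate
lies strictly between `-1` and `0`. -/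
def IsReducedQuadIrr (x : ℝ) : Prop :=
  Irrational x ∧ 1 < x ∧
    ∃ a b c : ℤ, a ≠ 0 ∧ (a : ℝ) * x ^ 2 + (b : ℝ) * x + (c : ℝ) = 0 ∧
      ∀ y : ℝ, y ≠ x → (a : ℝ) * y ^ 2 + (b : ℝ) * y + (c : ℝ) = 0 → -1 < y ∧ y < 0

/-- `x` and `y` are equivalent: `x = (a + b·y)/(c + d·y)` for integers with `ad - bc = ±1`. -/
def RealEquiv (x y : ℝ) : Prop :=
  ∃ a b c d : ℤ, (a * d - b * c = 1 ∨ a * d - b * c = -1) ∧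
    ((c : ℝ) + (d : ℝ) * y ≠ 0) ∧ x = ((a : ℝ) + (b : ℝ) * y) / ((c : ℝ) + (d : ℝ) * y)

/-- Iterated application of a word of derivations. -/
def iterDeriv {A ι : Type*} [CommRing A] [Algebra ℚ A] (D : ι → Derivation ℚ A A)
    (w : List ι) (f : A) : A := w.foldr (fun i g => D i g) f

section Wronskian

variable {A ι : Type*} [CommRing A] [Algebra ℚ A] (D : ι → Derivation ℚ A A)

lemma iterDeriv_nil (f : A) : iterDeriv D [] f = f := rfl

lemma iterDeriv_cons (i : ι) (w : List ι) (f : A) :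
    iterDeriv D (i :: w) f = D i (iterDeriv D w f) := rfl

lemma iterDeriv_append (v w : List ι) (f : A) :
    iterDeriv D (v ++ w) f = iterDeriv D v (iterDeriv D w f) := by
  simp [iterDeriv]

/-- Generalised Wronskian criterion: a linearly independent family over the constants has a
nonvanishing Wronskian in which the `a`-th row has order at most `a`. -/
theorem exists_iterDeriv_det_ne_zero [IsDomain A]
    (hconst : ∀ N W : A, W ≠ 0 → (∀ i, W * D i N = N * D i W) → ∃ c : ℚ, N = c • W) :
    ∀ (k : ℕ) (f : Fin k → A), LinearIndependent ℚ f →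
      ∃ w : Fin k → List ι, (∀ a, (w a).length ≤ a) ∧
        (Matrix.of fun a b => iterDeriv D (w a) (f b)).det ≠ 0 := by
  intro k
  induction k with
  | zero => intro f _; exact ⟨fun _ => [], fun a => a.elim0, by simp⟩
  | succ k ih =>
    intro f hf
    obtain ⟨w, hw, hdet⟩ := ih (fun b => f b.castSucc)
      (hf.comp _ (Fin.castSucc_injective k))
    by_contra hcon
    push Not at hcon
    set N : Fin (k + 1) → A := fun j => (-1) ^ ((Fin.last k : ℕ) + (j : ℕ)) *
      (Matrix.of fun (a : Fin k) (b : Fin k) => iterDeriv D (w a) (f (j.succAbove b))).det with hN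
    have hrel : ∀ u : List ι, u.length ≤ k → ∑ j, N j * iterDeriv D u (f j) = 0 := by
      intro u hu
      have h1 := hcon (Fin.snoc (α := fun _ => List ι) w u) (by
        intro a
        refine Fin.lastCases ?_ (fun a => ?_) a
        · simpa using hu
        · simpa using hw a)
      rw [Matrix.det_succ_row _ (Fin.last k)] at h1
      rw [← h1]
      refine Finset.sum_congr rfl fun j _ => ?_
      simp only [hN, Matrix.of_apply, Fin.snoc_last, Fin.succAbove_last]
      rw [mul_right_comm]
      congr 2
      ext a b
      simp
    set W := N (Fin.last k) with hW
    have hW0 : W ≠ 0 := by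
      simp only [hW, hN, Fin.succAbove_last]
      refine mul_ne_zero (pow_ne_zero _ (by simp)) hdet
    have hrel' : ∀ (i : ι) (a : Fin k), ∑ j, D i (N j) * iterDeriv D (w a) (f j) = 0 := by
      intro i a
      have h1 := congrArg (D i) (hrel (w a) ((hw a).trans a.2.le))
      have h2 := hrel (i :: w a) (by simpa using (hw a).trans_lt a.2)
      simp only [iterDeriv_cons] at h2
      simp only [map_sum, Derivation.leibniz, map_zero, smul_eq_mul, Finset.sum_add_distrib] at h1
      rw [h2, zero_add] at h1
      rw [← h1]
      exact Finset.sum_congr rfl fun j _ => mul_comm _ _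
    have hprop : ∀ (b : Fin k) (i : ι), W * D i (N b.castSucc) = N b.castSucc * D i W := by
      intro b i
      have := Matrix.eq_zero_of_mulVec_eq_zero hdet
        (v := fun b : Fin k => W * D i (N b.castSucc) - N b.castSucc * D i W) (by
          ext a
          simp only [Matrix.mulVec, dotProduct, Matrix.of_apply, Pi.zero_apply]
          have h1 := hrel' i a
          have h2 := hrel (w a) ((hw a).trans a.2.le)
          rw [Fin.sum_univ_castSucc] at h1 h2
          have h3 : W * (∑ b : Fin k, D i (N b.castSucc) * iterDeriv D (w a) (f b.castSucc)) -
            D i W * ∑ b : Fin k, N b.castSucc * iterDeriv D (w a) (f b.castSucc) = 0 := by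
            linear_combination W * h1 - D i W * h2
          rw [← h3, Finset.mul_sum, Finset.mul_sum, ← Finset.sum_sub_distrib]
          exact Finset.sum_congr rfl fun b _ => by ring)
      exact sub_eq_zero.mp (congrFun this b)
    have hc : ∀ j : Fin (k + 1), ∃ c : ℚ, N j = c • W := by
      intro j
      refine Fin.lastCases ⟨1, by simp [hW]⟩ (fun b => ?_) j
      exact hconst _ _ hW0 (hprop b)
    choose c hc using hc
    have h0 := hrel [] (by simp)
    have h1 : W * ∑ j, c j • f j = 0 := by
      rw [← h0, Finset.mul_sum]
      refine Finset.sum_congr rfl fun j _ => ?_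
      rw [iterDeriv_nil, hc j]
      simp
    have h2 := Fintype.linearIndependent_iff.mp hf c ((mul_eq_zero.mp h1).resolve_left hW0)
      (Fin.last k)
    have h3 := hc (Fin.last k)
    rw [h2, zero_smul] at h3
    exact hW0 h3

end Wronskian

lemma MvPolynomial.exists_eq_smul_of_mul_pderiv_eq {n : ℕ} (N W : MvPolynomial (Fin n) ℚ)
    (hW : W ≠ 0) (h : ∀ i, W * pderiv i N = N * pderiv i W) : ∃ c : ℚ, N = c • W := by
  let o : MonomialOrder (Fin n) := MonomialOrder.lex
  set e := o.degree W
  have hlc : coeff e W ≠ 0 := (o.coeff_degree_ne_zero_iff).mpr hW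
  set c := coeff e N / coeff e W
  refine ⟨c, ?_⟩
  by_contra hne
  set G := N - c • W with hG
  have hG0 : G ≠ 0 := sub_ne_zero.mpr hne
  have hGe : coeff e G = 0 := by
    simp [hG, c, div_mul_cancel₀ _ hlc]
  have hrel : ∀ i, W * (X i * pderiv i G) = G * (X i * pderiv i W) := by
    intro i
    have : W * pderiv i G = G * pderiv i W := by
      simp only [hG, map_sub, Derivation.map_smul, mul_sub, sub_mul, h i]
      simp only [mul_smul_comm, smul_mul_assoc]
    rw [mul_left_comm, this, mul_left_comm]
  have hcoef : ∀ (i : Fin n) (F : MvPolynomial (Fin n) ℚ) (d : Fin n →₀ ℕ),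
      coeff d (X i * pderiv i F) = d i * coeff d F := by
    intro i F d
    rw [mul_comm, coeff_mul_X']
    split_ifs with hd
    · rw [coeff_pderiv, tsub_add_cancel_of_le]
      · have : 1 ≤ d i := Nat.one_le_iff_ne_zero.mpr (Finsupp.mem_support_iff.mp hd)
        rw [Finsupp.tsub_apply, Finsupp.single_eq_same, Nat.cast_sub this]
        push_cast
        ring
      · rw [Finsupp.single_le_iff]
        exact Nat.one_le_iff_ne_zero.mpr (Finsupp.mem_support_iff.mp hd)
    · rw [Finsupp.notMem_support_iff.mp hd]
      simp
  have hdeg : ∀ (i : Fin n) (F : MvPolynomial (Fin n) ℚ),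
      o.toSyn (o.degree (X i * pderiv i F)) ≤ o.toSyn (o.degree F) := by
    intro i F
    rw [MonomialOrder.degree_le_iff]
    intro d hd
    refine o.le_degree ?_
    rw [mem_support_iff, hcoef] at hd
    rw [mem_support_iff]
    exact right_ne_zero_of_mul hd
  have hGlc : coeff (o.degree G) G ≠ 0 := (o.coeff_degree_ne_zero_iff).mpr hG0
  have heq : o.degree G = e := by
    ext i
    have h1 := congrArg (coeff (e + o.degree G)) (hrel i)
    rw [o.coeff_mul_of_add_of_degree_le le_rfl (hdeg i G), add_comm,
      o.coeff_mul_of_add_of_degree_le le_rfl (hdeg i W), hcoef, hcoef] at h1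
    have h2 : ((o.degree G i : ℚ) - e i) * (coeff e W * coeff (o.degree G) G) = 0 := by
      linear_combination h1
    have h3 := (mul_eq_zero.mp h2).resolve_right (mul_ne_zero hlc hGlc)
    exact_mod_cast sub_eq_zero.mp h3
  rw [heq] at hGlc
  exact hGlc hGe

lemma Polynomial.exists_eq_smul_of_mul_derivative_eq (N W : Polynomial ℚ)
    (hW : W ≠ 0) (h : W * derivative N = N * derivative W) : ∃ c : ℚ, N = c • W := by
  set e := W.natDegree
  have hlc : W.coeff e ≠ 0 := leadingCoeff_ne_zero.mpr hW
  set c := N.coeff e / W.coeff e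
  refine ⟨c, ?_⟩
  by_contra hne
  set G := N - c • W with hG
  have hG0 : G ≠ 0 := sub_ne_zero.mpr hne
  have hGe : G.coeff e = 0 := by
    simp [hG, c, div_mul_cancel₀ _ hlc]
  have hrel : W * (X * derivative G) = G * (X * derivative W) := by
    have : W * derivative G = G * derivative W := by
      simp only [hG, map_sub, derivative_smul, mul_sub, sub_mul, h]
      simp
    rw [mul_left_comm, this, mul_left_comm]
  have hcoef : ∀ (F : Polynomial ℚ) (d : ℕ), (X * derivative F).coeff d = d * F.coeff d := by
    intro F d
    cases d with
    | zero => simp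
    | succ d => rw [coeff_X_mul, coeff_derivative]; push_cast; ring
  have hdeg : ∀ (F : Polynomial ℚ), (X * derivative F).natDegree ≤ F.natDegree := by
    intro F
    rw [natDegree_le_iff_coeff_eq_zero]
    intro d hd
    rw [hcoef, coeff_eq_zero_of_natDegree_lt hd, mul_zero]
  have hGlc : G.coeff G.natDegree ≠ 0 := leadingCoeff_ne_zero.mpr hG0
  have heq : G.natDegree = e := by
    have h1 := congrArg (fun p => coeff p (e + G.natDegree)) hrel
    rw [coeff_mul_add_eq_of_natDegree_le le_rfl (hdeg G), add_comm,
      coeff_mul_add_eq_of_natDegree_le le_rfl (hdeg W), hcoef, hcoef] at h1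
    have h2 : ((G.natDegree : ℚ) - e) * (W.coeff e * G.coeff G.natDegree) = 0 := by
      linear_combination h1
    have h3 := (mul_eq_zero.mp h2).resolve_right (mul_ne_zero hlc hGlc)
    exact_mod_cast sub_eq_zero.mp h3
  rw [heq] at hGlc
  exact hGlc hGe

section Majorant

open MvPolynomial

variable {σ : Type*}

/-- `P` dominates `p` coefficientwise. -/
def Majorized (p P : MvPolynomial σ ℝ) : Prop := ∀ e, |coeff e p| ≤ coeff e P

namespace Majorized

variable {p q P Q : MvPolynomial σ ℝ}

lemma coeff_nonneg (h : Majorized p P) (e : σ →₀ ℕ) : 0 ≤ coeff e P :=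
  (abs_nonneg _).trans (h e)

lemma zero : Majorized (0 : MvPolynomial σ ℝ) 0 := fun e => by simp

lemma one : Majorized (1 : MvPolynomial σ ℝ) 1 := fun e => by
  classical
  rw [coeff_one]
  split_ifs <;> simp

lemma X (i : σ) : Majorized (MvPolynomial.X i : MvPolynomial σ ℝ) (MvPolynomial.X i) := fun e => by
  classical
  rw [coeff_X]
  split_ifs <;> simp

lemma C {a b : ℝ} (h : |a| ≤ b) :
    Majorized (MvPolynomial.C a : MvPolynomial σ ℝ) (MvPolynomial.C b) := fun e => by
  classical
  rw [coeff_C, coeff_C]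
  split_ifs <;> simp [h]

lemma neg (h : Majorized p P) : Majorized (-p) P := fun e => by simpa using h e

lemma add (hp : Majorized p P) (hq : Majorized q Q) : Majorized (p + q) (P + Q) := fun e => by
  rw [coeff_add, coeff_add]
  exact (abs_add_le _ _).trans (add_le_add (hp e) (hq e))

lemma mul (hp : Majorized p P) (hq : Majorized q Q) : Majorized (p * q) (P * Q) := fun e => by
  classical
  rw [coeff_mul, coeff_mul]
  refine (Finset.abs_sum_le_sum_abs _ _).trans (Finset.sum_le_sum fun x _ => ?_)
  rw [abs_mul]
  exact mul_le_mul (hp _) (hq _) (abs_nonneg _) (hp.coeff_nonneg _)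

lemma pow (hp : Majorized p P) (n : ℕ) : Majorized (p ^ n) (P ^ n) := by
  induction n with
  | zero => simpa using one
  | succ n ih => rw [pow_succ, pow_succ]; exact ih.mul hp

lemma sum {ι : Type*} (s : Finset ι) {f F : ι → MvPolynomial σ ℝ}
    (h : ∀ i ∈ s, Majorized (f i) (F i)) : Majorized (∑ i ∈ s, f i) (∑ i ∈ s, F i) := by
  classical
  induction s using Finset.induction_on with
  | empty => simpa using zero
  | insert a s ha ih =>
    rw [Finset.sum_insert ha, Finset.sum_insert ha]
    exact (h a (by simp)).add (ih fun i hi => h i (by simp [hi]))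

lemma prod {ι : Type*} (s : Finset ι) {f F : ι → MvPolynomial σ ℝ}
    (h : ∀ i ∈ s, Majorized (f i) (F i)) : Majorized (∏ i ∈ s, f i) (∏ i ∈ s, F i) := by
  classical
  induction s using Finset.induction_on with
  | empty => simpa using one
  | insert a s ha ih =>
    rw [Finset.prod_insert ha, Finset.prod_insert ha]
    exact (h a (by simp)).mul (ih fun i hi => h i (by simp [hi]))

lemma det {k : ℕ} {M : Matrix (Fin k) (Fin k) (MvPolynomial σ ℝ)}
    (h : ∀ a b, Majorized (M a b) P) : Majorized M.det ((k.factorial : ℝ) • P ^ k) := by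
  rw [Matrix.det_apply]
  have h1 : Majorized (∑ τ : Equiv.Perm (Fin k), Equiv.Perm.sign τ • ∏ i, M (τ i) i)
      (∑ _τ : Equiv.Perm (Fin k), P ^ k) := by
    refine sum _ fun τ _ => ?_
    have h2 : Majorized (∏ i, M (τ i) i) (P ^ k) := by
      simpa using prod Finset.univ (f := fun i => M (τ i) i) (F := fun _ => P) fun i _ => h _ _
    rcases Int.units_eq_one_or (Equiv.Perm.sign τ) with hs | hs <;> rw [hs]
    · simpa using h2
    · simpa using h2.neg
  convert h1 using 1
  simp [Fintype.card_perm, Algebra.smul_def]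

lemma coeff_mul_prod_le (h : Majorized p P) {ρ : σ → ℝ} (hρ : ∀ i, 0 ≤ ρ i) (e : σ →₀ ℕ) :
    |coeff e p| * e.prod (fun i n => ρ i ^ n) ≤ eval ρ P := by
  have hnn : ∀ d : σ →₀ ℕ, 0 ≤ d.prod (fun i n => ρ i ^ n) := fun d =>
    Finset.prod_nonneg fun i _ => pow_nonneg (hρ i) _
  refine (mul_le_mul_of_nonneg_right (h e) (hnn e)).trans ?_
  rw [eval_eq]
  by_cases he : e ∈ P.support
  · exact Finset.single_le_sum (f := fun d => coeff d P * ∏ i ∈ d.support, ρ i ^ d i)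
      (fun d _ => mul_nonneg (h.coeff_nonneg d) (hnn d)) he
  · rw [notMem_support_iff.mp he, zero_mul]
    exact Finset.sum_nonneg fun d _ => mul_nonneg (h.coeff_nonneg d) (hnn d)

end Majorized

/-- The coefficients of `∏ (1 + X_h) ^ r_h`. -/
lemma MvPolynomial.coeff_prod_one_add_X_pow [Fintype σ] (r : σ → ℕ) (e : σ →₀ ℕ) :
    coeff e (∏ h, (1 + MvPolynomial.X h : MvPolynomial σ ℝ) ^ r h) =
      ∏ h, ((r h).choose (e h) : ℝ) := by
  classical
  have h1 : ∀ h : σ, (1 + MvPolynomial.X h : MvPolynomial σ ℝ) ^ r h =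
      ∑ k ∈ Finset.range (r h + 1), MvPolynomial.X h ^ k * MvPolynomial.C ((r h).choose k : ℝ) := by
    intro h
    rw [add_comm, add_pow]
    simp
  simp_rw [h1]
  rw [Finset.prod_univ_sum, coeff_sum]
  have h2 : ∀ x : σ → ℕ, coeff e (∏ h, (MvPolynomial.X h ^ x h *
      MvPolynomial.C ((r h).choose (x h) : ℝ) : MvPolynomial σ ℝ)) =
      if x = e then ∏ h, ((r h).choose (e h) : ℝ) else 0 := by
    intro x
    rw [Finset.prod_mul_distrib, ← map_prod, mul_comm, coeff_C_mul]
    have : ∏ h, (MvPolynomial.X h : MvPolynomial σ ℝ) ^ x h =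
        monomial (Finsupp.equivFunOnFinite.symm x) 1 := by
      rw [monomial_eq, Finsupp.prod_fintype _ _ (by simp)]
      simp
    rw [this, coeff_monomial]
    have hiff : Finsupp.equivFunOnFinite.symm x = e ↔ x = ⇑e := by
      rw [Equiv.symm_apply_eq]; rfl
    by_cases hx : x = ⇑e
    · rw [if_pos (hiff.mpr hx), if_pos hx, mul_one, hx]
    · rw [if_neg (fun h => hx (hiff.mp h)), if_neg hx, mul_zero]
  simp_rw [h2]
  rw [Finset.sum_ite_eq']
  split_ifs with he
  · rfl
  · simp only [Fintype.mem_piFinset, Finset.mem_range, not_forall, not_lt] at he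
    obtain ⟨h, hh⟩ := he
    symm
    refine Finset.prod_eq_zero (Finset.mem_univ h) ?_
    rw [Nat.choose_eq_zero_of_lt (by omega), Nat.cast_zero]

end Majorant

section HasseDerivative

open MvPolynomial

variable {σ : Type*} [Fintype σ]

/-- The multivariate Hasse derivative of order `i`. -/
noncomputable def MvPolynomial.hasse {R : Type*} [CommSemiring R] (i : σ → ℕ)
    (f : MvPolynomial σ R) : MvPolynomial σ R :=
  ∑ e ∈ f.support, monomial (e - Finsupp.equivFunOnFinite.symm i)
    ((∏ h, ((e h).choose (i h)) : ℕ) * coeff e f)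

lemma MvPolynomial.coeff_hasse {R : Type*} [CommSemiring R] (i : σ → ℕ) (f : MvPolynomial σ R)
    (d : σ →₀ ℕ) : coeff d (hasse i f) =
      (∏ h, ((d h + i h).choose (i h)) : ℕ) * coeff (d + Finsupp.equivFunOnFinite.symm i) f := by
  classical
  rw [hasse, coeff_sum]
  set I := Finsupp.equivFunOnFinite.symm i with hI
  have hIi : ∀ h, I h = i h := fun h => rfl
  simp_rw [coeff_monomial]
  rw [Finset.sum_eq_single (d + I)]
  · simp [hIi]
  · intro e _ hne
    split_ifs with hd
    · have : ∃ h, e h < i h := by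
        by_contra hcon
        push Not at hcon
        apply hne
        rw [← hd, tsub_add_cancel_of_le]
        exact fun h => hcon h
      obtain ⟨h, hh⟩ := this
      rw [Finset.prod_eq_zero (Finset.mem_univ h) (Nat.choose_eq_zero_of_lt hh)]
      simp
    · rfl
  · intro hne
    rw [notMem_support_iff.mp hne]
    simp

lemma MvPolynomial.coeff_iterDeriv_pderiv {n : ℕ} (w : List (Fin n)) (F : MvPolynomial (Fin n) ℚ)
    (d : Fin n →₀ ℕ) : coeff d (iterDeriv (fun i => pderiv i) w F) =
      (∏ h, ((d h + 1).ascFactorial (w.count h)) : ℕ) *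
        coeff (d + Finsupp.equivFunOnFinite.symm (fun h => w.count h)) F := by
  classical
  induction w generalizing d with
  | nil =>
    rw [iterDeriv_nil]
    have : (Finsupp.equivFunOnFinite.symm fun h : Fin n => ([] : List (Fin n)).count h) = 0 := by
      ext; simp
    rw [this]
    simp
  | cons i w ih =>
    rw [iterDeriv_cons, coeff_pderiv, ih]
    have h1 : d + Finsupp.single i 1 + Finsupp.equivFunOnFinite.symm (fun h => w.count h) =
        d + Finsupp.equivFunOnFinite.symm (fun h => (i :: w).count h) := by
      ext h
      simp only [Finsupp.coe_add, Pi.add_apply, Finsupp.equivFunOnFinite_symm_apply_apply,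
        List.count_cons, Finsupp.single_apply, beq_iff_eq]
      split_ifs <;> omega
    have h2 : (∏ h, (((d + Finsupp.single i 1 : Fin n →₀ ℕ) h + 1).ascFactorial (w.count h))) *
        (d i + 1) =
        ∏ h, ((d h + 1).ascFactorial ((i :: w).count h)) := by
      rw [← Finset.mul_prod_erase _ _ (Finset.mem_univ i),
        ← Finset.mul_prod_erase _ _ (Finset.mem_univ i), mul_right_comm]
      congr 1
      · simp only [Finsupp.coe_add, Pi.add_apply, Finsupp.single_eq_same, List.count_cons_self]
        rw [mul_comm, Nat.succ_ascFactorial, Nat.ascFactorial_succ]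
      · refine Finset.prod_congr rfl fun h hh => ?_
        have hne : i ≠ h := (Finset.ne_of_mem_erase hh).symm
        rw [List.count_cons_of_ne hne]
        simp [hne]
    rw [h1, ← h2]
    push_cast
    ring

lemma MvPolynomial.iterDeriv_pderiv_map {n : ℕ} (w : List (Fin n)) (f : MvPolynomial (Fin n) ℤ) :
    iterDeriv (fun i => pderiv i) w (map (Int.castRingHom ℚ) f) =
      ((∏ h, (w.count h).factorial : ℕ) : ℚ) •
        map (Int.castRingHom ℚ) (hasse (fun h => w.count h) f) := by
  ext d
  rw [coeff_iterDeriv_pderiv, coeff_smul, coeff_map, coeff_map, coeff_hasse]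
  simp only [Nat.ascFactorial_eq_factorial_mul_choose, Finset.prod_mul_distrib]
  simp [mul_assoc]

end HasseDerivative

section Index

open MvPolynomial

variable {σ : Type*} [Fintype σ]

/-- Every monomial of `F` has `w`-weight at least `t`. -/
def IndexGE (w : σ → ℝ) (t : ℝ) (F : MvPolynomial σ ℚ) : Prop :=
  ∀ e, coeff e F ≠ 0 → t ≤ ∑ h, (e h : ℝ) * w h

namespace IndexGE

variable {w : σ → ℝ} {s t : ℝ} {F G : MvPolynomial σ ℚ}

lemma mono (h : IndexGE w t F) (hst : s ≤ t) : IndexGE w s F := fun e he => hst.trans (h e he)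

lemma of_nonneg (hw : ∀ i, 0 ≤ w i) (F : MvPolynomial σ ℚ) : IndexGE w 0 F := fun _ _ =>
  Finset.sum_nonneg fun _ _ => mul_nonneg (Nat.cast_nonneg _) (hw _)

lemma mul (hF : IndexGE w s F) (hG : IndexGE w t G) : IndexGE w (s + t) (F * G) := by
  classical
  intro e he
  rw [coeff_mul] at he
  obtain ⟨⟨a, b⟩, hx, hne⟩ := Finset.exists_ne_zero_of_sum_ne_zero he
  rw [← Finset.HasAntidiagonal.mem_antidiagonal.mp hx]
  have h1 := hF a (left_ne_zero_of_mul hne)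
  have h2 := hG b (right_ne_zero_of_mul hne)
  simp only [Finsupp.coe_add, Pi.add_apply, Nat.cast_add, add_mul, Finset.sum_add_distrib]
  exact add_le_add h1 h2

lemma smul (c : ℚ) (hF : IndexGE w t F) : IndexGE w t (c • F) := fun e he => by
  rw [coeff_smul] at he
  exact hF e (right_ne_zero_of_smul he)

lemma sum {ι : Type*} (S : Finset ι) {f : ι → MvPolynomial σ ℚ}
    (h : ∀ i ∈ S, IndexGE w t (f i)) : IndexGE w t (∑ i ∈ S, f i) := by
  intro e he
  rw [coeff_sum] at he
  obtain ⟨i, hi, hne⟩ := Finset.exists_ne_zero_of_sum_ne_zero he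
  exact h i hi e hne

lemma prod (hw : ∀ i, 0 ≤ w i) {ι : Type*} (S : Finset ι) {f : ι → MvPolynomial σ ℚ} {T : ι → ℝ}
    (h : ∀ i ∈ S, IndexGE w (T i) (f i)) : IndexGE w (∑ i ∈ S, T i) (∏ i ∈ S, f i) := by
  classical
  induction S using Finset.induction_on with
  | empty => simpa using of_nonneg hw 1
  | insert a S ha ih =>
    rw [Finset.sum_insert ha, Finset.prod_insert ha]
    exact (h a (by simp)).mul (ih fun i hi => h i (by simp [hi]))

lemma det (hw : ∀ i, 0 ≤ w i) {k : ℕ} {M : Matrix (Fin k) (Fin k) (MvPolynomial σ ℚ)}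
    {T : Fin k → ℝ} (h : ∀ a b, IndexGE w (T b) (M a b)) : IndexGE w (∑ b, T b) M.det := by
  rw [Matrix.det_apply']
  refine sum _ fun τ _ => ?_
  have := (prod hw Finset.univ (f := fun i => M (τ i) i) (T := T) fun i _ => h _ _).smul
    ((Equiv.Perm.sign τ : ℤ) : ℚ)
  simpa [Algebra.smul_def] using this

lemma pderiv (i : σ) (hF : IndexGE w t F) : IndexGE w (t - w i) (MvPolynomial.pderiv i F) := by
  classical
  intro e he
  rw [coeff_pderiv] at he
  have := hF _ (left_ne_zero_of_mul he)
  simp only [Finsupp.coe_add, Pi.add_apply, Nat.cast_add, add_mul, Finset.sum_add_distrib] at this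
  have h2 : ∑ h, ((Finsupp.single i 1 h : ℕ) : ℝ) * w h = w i := by
    simp [Finsupp.single_apply]
  linarith

lemma iterDeriv (l : List σ) (hF : IndexGE w t F) :
    IndexGE w (t - (l.map w).sum) (_root_.iterDeriv (fun i => MvPolynomial.pderiv i) l F) := by
  induction l with
  | nil => simpa [iterDeriv_nil] using hF
  | cons i l ih =>
    rw [iterDeriv_cons]
    refine (ih.pderiv i).mono ?_
    simp only [List.map_cons, List.sum_cons]
    linarith

end IndexGE

/-- Translation of a polynomial by `ξ`. -/
noncomputable def MvPolynomial.translate {σ : Type*} (ξ : σ → ℚ) :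
    MvPolynomial σ ℚ →ₐ[ℚ] MvPolynomial σ ℚ :=
  aeval fun h => X h + C (ξ h)

lemma MvPolynomial.pderiv_translate {σ : Type*} (ξ : σ → ℚ) (i : σ) (F : MvPolynomial σ ℚ) :
    pderiv i (translate ξ F) = translate ξ (pderiv i F) := by
  classical
  induction F using MvPolynomial.induction_on with
  | C a => simp [translate]
  | add p q hp hq => simp [hp, hq]
  | mul_X p j hp =>
    have hX : pderiv i (translate ξ (X j)) = translate ξ (pderiv i (X j)) := by
      simp only [translate, aeval_X, map_add, pderiv_X, pderiv_C, add_zero]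
      by_cases h : j = i
      · subst h; simp
      · simp [h]
    rw [map_mul, pderiv_mul, pderiv_mul, hp, hX, map_add, map_mul, map_mul]

lemma MvPolynomial.iterDeriv_translate {σ : Type*} (ξ : σ → ℚ) (w : List σ)
    (F : MvPolynomial σ ℚ) :
    iterDeriv (fun i => pderiv i) w (translate ξ F) =
      translate ξ (iterDeriv (fun i => pderiv i) w F) := by
  induction w with
  | nil => rfl
  | cons i w ih => rw [iterDeriv_cons, iterDeriv_cons, ih, pderiv_translate]

end Index

section RothLemma

open MvPolynomial

/-- Rank factorisation of a finite family of vectors. -/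
lemma exists_linearIndependent_factorization {V : Type*} [AddCommGroup V] [Module ℚ V] {n : ℕ}
    (f : Fin n → V) : ∃ k ≤ n, ∃ (φ : Fin k → V) (c : Fin n → Fin k → ℚ),
      LinearIndependent ℚ φ ∧ (∀ t, f t = ∑ j, c t j • φ j) ∧
      LinearIndependent ℚ fun j : Fin k => fun t : Fin n => c t j := by
  set S := Submodule.span ℚ (Set.range f)
  have : FiniteDimensional ℚ S := FiniteDimensional.span_of_finite ℚ (Set.finite_range f)
  set b := Module.finBasis ℚ S
  have hmem : ∀ t, f t ∈ S := fun t => Submodule.subset_span ⟨t, rfl⟩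
  refine ⟨Module.finrank ℚ S, (finrank_range_le_card (R := ℚ) f).trans (by simp),
    fun j => (b j : V), fun t j => b.repr ⟨f t, hmem t⟩ j, ?_, ?_, ?_⟩
  · exact b.linearIndependent.map' S.subtype (Submodule.ker_subtype S)
  · intro t
    have := congrArg S.subtype (b.sum_repr ⟨f t, hmem t⟩)
    rw [map_sum] at this
    exact this.symm
  · rw [Fintype.linearIndependent_iff]
    intro g hg
    set L : S →ₗ[ℚ] ℚ := b.constr ℚ g
    have hL : ∀ t, L ⟨f t, hmem t⟩ = 0 := by
      intro t
      have h1 := congrFun hg t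
      simp only [Finset.sum_apply, Pi.smul_apply, Pi.zero_apply, smul_eq_mul] at h1
      rw [Module.Basis.constr_apply_fintype]
      rw [← h1]
      refine Finset.sum_congr rfl fun j _ => ?_
      rw [Module.Basis.equivFun_apply, smul_eq_mul, mul_comm]
    have hL0 : ∀ x : S, L x = 0 := by
      rintro ⟨x, hx⟩
      induction hx using Submodule.span_induction with
      | mem x hx =>
        obtain ⟨t, rfl⟩ := hx
        exact hL t
      | zero => exact map_zero L
      | add x y hx hy h1 h2 =>
        have : (⟨x + y, S.add_mem hx hy⟩ : S) = ⟨x, hx⟩ + ⟨y, hy⟩ := rfl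
        rw [this, map_add, h1, h2, add_zero]
      | smul a x hx h1 =>
        have : (⟨a • x, S.smul_mem a hx⟩ : S) = a • ⟨x, hx⟩ := rfl
        rw [this, map_smul, h1, smul_zero]
    intro j
    have := hL0 (b j)
    rwa [Module.Basis.constr_basis] at this

lemma MvPolynomial.finSuccEquiv_rename_succ {R : Type*} [CommRing R] {m : ℕ}
    (U : MvPolynomial (Fin m) R) :
    finSuccEquiv R m (rename Fin.succ U) = Polynomial.C U := by
  induction U using MvPolynomial.induction_on with
  | C a => rw [rename_C, finSuccEquiv_apply, eval₂Hom_C]; rfl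
  | add p q hp hq => rw [map_add, map_add, hp, hq, map_add]
  | mul_X p j hp => rw [map_mul, map_mul, hp, rename_X, finSuccEquiv_X_succ, map_mul]

lemma MvPolynomial.finSuccEquiv_aeval_X_zero {R : Type*} [CommRing R] {m : ℕ}
    (p : Polynomial R) :
    finSuccEquiv R m (Polynomial.aeval (X 0) p) = p.map MvPolynomial.C := by
  induction p using Polynomial.induction_on' with
  | add p q hp hq => rw [map_add, map_add, hp, hq, Polynomial.map_add]
  | monomial n a =>
    rw [Polynomial.aeval_monomial, map_mul, map_pow, finSuccEquiv_X_zero, Polynomial.map_monomial,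
      ← Polynomial.C_mul_X_pow_eq_monomial, algebraMap_eq, finSuccEquiv_apply, eval₂Hom_C]
    rfl

lemma MvPolynomial.coeff_cons_rename_mul_aeval {R : Type*} [CommRing R] {m : ℕ}
    (U : MvPolynomial (Fin m) R) (V : Polynomial R) (l : ℕ) (E : Fin m →₀ ℕ) :
    coeff (E.cons l) (rename Fin.succ U * Polynomial.aeval (X 0) V) = V.coeff l * coeff E U := by
  rw [← finSuccEquiv_coeff_coeff, map_mul, finSuccEquiv_rename_succ, finSuccEquiv_aeval_X_zero,
    Polynomial.coeff_C_mul, Polynomial.coeff_map, mul_comm, coeff_C_mul]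

/-- Splitting a polynomial as a sum of products of a polynomial in the first variable and a
polynomial in the others, both families being linearly independent. -/
lemma MvPolynomial.exists_sum_rename_mul_aeval {m N : ℕ} (F : MvPolynomial (Fin (m + 1)) ℚ)
    (hF : ∀ e, coeff e F ≠ 0 → e 0 ≤ N) :
    ∃ k ≤ N + 1, ∃ (φ : Fin k → MvPolynomial (Fin m) ℚ) (ψ : Fin k → Polynomial ℚ),
      LinearIndependent ℚ φ ∧ LinearIndependent ℚ ψ ∧
      F = ∑ j, rename Fin.succ (φ j) * Polynomial.aeval (X 0) (ψ j) := by
  obtain ⟨k, hk, φ, c, hφ, hf, hc⟩ := exists_linearIndependent_factorization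
    (fun t : Fin (N + 1) => (finSuccEquiv ℚ m F).coeff t)
  have hcoef : ∀ (j : Fin k) (t : ℕ),
      (∑ t : Fin (N + 1), Polynomial.monomial (t : ℕ) (c t j)).coeff t =
        if h : t < N + 1 then c ⟨t, h⟩ j else 0 := by
    intro j t
    rw [Polynomial.finsetSum_coeff]
    simp_rw [Polynomial.coeff_monomial]
    split_ifs with h
    · rw [Finset.sum_eq_single ⟨t, h⟩]
      · simp
      · intro b _ hb
        rw [if_neg]
        rintro rfl
        exact hb rfl
      · simp
    · refine Finset.sum_eq_zero fun b _ => if_neg ?_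
      rintro rfl
      exact h b.2
  refine ⟨k, hk, φ, fun j => ∑ t : Fin (N + 1), Polynomial.monomial t (c t j), hφ, ?_, ?_⟩
  · rw [Fintype.linearIndependent_iff] at hc ⊢
    intro g hg
    refine hc g ?_
    ext t
    have h1 := congrArg (fun p => Polynomial.coeff p t) hg
    simp only [Polynomial.finsetSum_coeff, Polynomial.coeff_smul, Polynomial.coeff_zero] at h1
    rw [Finset.sum_apply]
    refine Eq.trans ?_ h1
    refine Finset.sum_congr rfl fun j _ => ?_
    rw [← Polynomial.finsetSum_coeff, hcoef, dif_pos t.2]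
    rfl
  · ext e
    rw [← Finsupp.cons_tail e, coeff_sum]
    simp_rw [coeff_cons_rename_mul_aeval, hcoef]
    by_cases h : e 0 < N + 1
    · rw [← finSuccEquiv_coeff_coeff, hf ⟨e 0, h⟩, coeff_sum]
      simp [h]
    · simp only [h, dite_false, zero_mul, Finset.sum_const_zero]
      by_contra hne
      have := hF _ hne
      rw [Finsupp.cons_zero] at this
      omega

end RothLemma

section RothLemma

open MvPolynomial

lemma MvPolynomial.pderiv_zero_rename_succ {m : ℕ} (U : MvPolynomial (Fin m) ℚ) :
    pderiv 0 (rename Fin.succ U) = 0 := by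
  induction U using MvPolynomial.induction_on with
  | C a => simp
  | add p q hp hq => simp [hp, hq]
  | mul_X p j hp => simp [hp, pderiv_X_of_ne (Fin.succ_ne_zero j)]

lemma MvPolynomial.pderiv_zero_aeval {m : ℕ} (V : Polynomial ℚ) :
    pderiv (0 : Fin (m + 1)) (Polynomial.aeval (X 0 : MvPolynomial (Fin (m + 1)) ℚ) V) =
      Polynomial.aeval (X 0) (Polynomial.derivative V) := by
  rw [Derivation.map_aeval]
  simp

lemma MvPolynomial.pderiv_succ_aeval {m : ℕ} (i : Fin m) (V : Polynomial ℚ) :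
    pderiv i.succ (Polynomial.aeval (X 0 : MvPolynomial (Fin (m + 1)) ℚ) V) = 0 := by
  rw [Derivation.map_aeval, pderiv_X_of_ne (Fin.succ_ne_zero i).symm, smul_zero]

lemma MvPolynomial.iterDeriv_rename_mul_aeval {m : ℕ} (U : MvPolynomial (Fin m) ℚ)
    (V : Polynomial ℚ) (w : List (Fin m)) (v : List Unit) :
    iterDeriv (fun i => pderiv i) (List.replicate v.length 0 ++ w.map Fin.succ)
        (rename Fin.succ U * Polynomial.aeval (X 0) V) =
      rename Fin.succ (iterDeriv (fun i => pderiv i) w U) *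
        Polynomial.aeval (X 0) (iterDeriv (fun _ => Polynomial.derivative') v V) := by
  have h1 : iterDeriv (fun i => pderiv i) (w.map Fin.succ)
      (rename Fin.succ U * Polynomial.aeval (X 0 : MvPolynomial (Fin (m + 1)) ℚ) V) =
      rename Fin.succ (iterDeriv (fun i => pderiv i) w U) * Polynomial.aeval (X 0) V := by
    induction w with
    | nil => rfl
    | cons i w ih =>
      rw [List.map_cons, iterDeriv_cons, ih, pderiv_mul, pderiv_succ_aeval, mul_zero, add_zero,
        pderiv_rename (Fin.succ_injective m), iterDeriv_cons]
  rw [iterDeriv_append, h1]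
  induction v with
  | nil => rfl
  | cons i v ih =>
    rw [List.length_cons, List.replicate_succ, iterDeriv_cons, ih, pderiv_mul,
      pderiv_zero_rename_succ, zero_mul, zero_add, pderiv_zero_aeval]
    rfl

lemma iterDeriv_sum {A ι κ : Type*} [CommRing A] [Algebra ℚ A] (D : ι → Derivation ℚ A A)
    (w : List ι) (s : Finset κ) (f : κ → A) :
    iterDeriv D w (∑ j ∈ s, f j) = ∑ j ∈ s, iterDeriv D w (f j) := by
  induction w with
  | nil => rfl
  | cons i w ih => simp_rw [iterDeriv_cons, ih, map_sum]

/-- The word differentiating along `v` in the first variable and along `w` in the others. -/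
def joinWord {m : ℕ} (v : List Unit) (w : List (Fin m)) : List (Fin (m + 1)) :=
  List.replicate v.length 0 ++ w.map Fin.succ

lemma prod_factorial_count_joinWord {m : ℕ} (v : List Unit) (w : List (Fin m)) :
    ∏ h, ((joinWord v w).count h).factorial =
      v.length.factorial * ∏ h, (w.count h).factorial := by
  rw [Fin.prod_univ_succ]
  congr 1
  · have : (w.map Fin.succ).count 0 = 0 := by
      rw [List.count_eq_zero]
      simp [Fin.succ_ne_zero]
    simp [joinWord, this]
  · refine Finset.prod_congr rfl fun h _ => ?_
    rw [joinWord, List.count_append, List.count_map_of_injective _ _ (Fin.succ_injective m),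
      List.count_replicate]
    simp [(Fin.succ_ne_zero h).symm]

/-- The determinant of Hasse derivatives of `Q` along the words `joinWord (v b) (w a)`. -/
noncomputable def hasseDet {m k : ℕ} (Q : MvPolynomial (Fin (m + 1)) ℤ)
    (w : Fin k → List (Fin m)) (v : Fin k → List Unit) : MvPolynomial (Fin (m + 1)) ℤ :=
  (Matrix.of fun a b => hasse (fun h => (joinWord (v b) (w a)).count h) Q).det

lemma exists_smul_hasseDet_eq {m k : ℕ} (Q : MvPolynomial (Fin (m + 1)) ℤ)
    (w : Fin k → List (Fin m)) (v : Fin k → List Unit) :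
    ∃ c : ℚ, c ≠ 0 ∧ c • map (Int.castRingHom ℚ) (hasseDet Q w v) =
      (Matrix.of fun a b => iterDeriv (fun i => pderiv i) (joinWord (v b) (w a))
        (map (Int.castRingHom ℚ) Q)).det := by
  refine ⟨(∏ b, ((v b).length.factorial : ℚ)) *
    ∏ a, ((∏ h, ((w a).count h).factorial : ℕ) : ℚ), ?_, ?_⟩
  · refine mul_ne_zero ?_ ?_
    · exact Finset.prod_ne_zero_iff.mpr fun b _ => Nat.cast_ne_zero.mpr (Nat.factorial_ne_zero _)
    · exact Finset.prod_ne_zero_iff.mpr fun a _ => Nat.cast_ne_zero.mpr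
        (Finset.prod_ne_zero_iff.mpr fun h _ => Nat.factorial_ne_zero _)
  · set H : Matrix (Fin k) (Fin k) (MvPolynomial (Fin (m + 1)) ℚ) := Matrix.of fun a b =>
      map (Int.castRingHom ℚ) (hasse (fun h => (joinWord (v b) (w a)).count h) Q)
    have h1 : map (Int.castRingHom ℚ) (hasseDet Q w v) = H.det := by
      rw [hasseDet, RingHom.map_det]
      rfl
    have h2 : (Matrix.of fun a b => iterDeriv (fun i => pderiv i) (joinWord (v b) (w a))
        (map (Int.castRingHom ℚ) Q)) = Matrix.of fun a b =>
          C ((v b).length.factorial : ℚ) * (Matrix.of fun a b =>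
            C ((∏ h, ((w a).count h).factorial : ℕ) : ℚ) * H a b) a b := by
      ext1 a b
      simp only [Matrix.of_apply]
      rw [iterDeriv_pderiv_map, prod_factorial_count_joinWord, smul_eq_C_mul, ← mul_assoc, ← C_mul]
      push_cast
      rfl
    rw [h2, Matrix.det_mul_row, Matrix.det_mul_column, h1, smul_eq_C_mul, ← map_prod, ← map_prod,
      ← mul_assoc, ← C_mul]

/-- A family of words making the matrix of derivatives of a product decomposition split. -/
lemma det_iterDeriv_joinWord {m k : ℕ} (φ : Fin k → MvPolynomial (Fin m) ℚ)
    (ψ : Fin k → Polynomial ℚ) (w : Fin k → List (Fin m)) (v : Fin k → List Unit) :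
    (Matrix.of fun a b => iterDeriv (fun i => pderiv i) (joinWord (v b) (w a))
        (∑ j, rename Fin.succ (φ j) * Polynomial.aeval (X 0) (ψ j))).det =
      rename Fin.succ (Matrix.of fun a b => iterDeriv (fun i => pderiv i) (w a) (φ b)).det *
      Polynomial.aeval (X 0)
        (Matrix.of fun a b => iterDeriv (fun _ => Polynomial.derivative') (v a) (ψ b)).det := by
  rw [AlgHom.map_det, AlgHom.map_det,
    ← Matrix.det_transpose (AlgHom.mapMatrix (Polynomial.aeval _) _),
    ← Matrix.det_mul]
  · congr 1
    ext1 a b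
    simp only [Matrix.of_apply, Matrix.mul_apply, iterDeriv_sum, joinWord,
      iterDeriv_rename_mul_aeval]
    rfl

lemma majorized_hasse {σ : Type*} [Fintype σ] {Q : MvPolynomial σ ℤ} {r : σ → ℕ} {B : ℝ}
    (hr : ∀ e, coeff e Q ≠ 0 → ∀ h, e h ≤ r h) (hB : ∀ e, |((coeff e Q : ℤ) : ℝ)| ≤ B) (i : σ → ℕ) :
    Majorized (map (Int.castRingHom ℝ) (hasse i Q))
      (C (2 ^ (∑ h, r h) * B) * ∏ h, (1 + X h) ^ r h) := by
  intro d
  have hB0 : 0 ≤ B := (abs_nonneg _).trans (hB 0)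
  rw [coeff_C_mul, coeff_prod_one_add_X_pow, coeff_map, coeff_hasse]
  set e := d + Finsupp.equivFunOnFinite.symm i with he
  by_cases h0 : coeff e Q = 0
  · rw [h0]
    simp only [mul_zero, map_zero, abs_zero]
    positivity
  have hle : ∀ h, d h + i h ≤ r h := fun h => hr e h0 h
  have h1 : ((∏ h, (d h + i h).choose (i h) : ℕ) : ℝ) ≤ 2 ^ (∑ h, r h) := by
    rw [← Finset.prod_pow_eq_pow_sum]
    push_cast
    refine Finset.prod_le_prod (fun _ _ => Nat.cast_nonneg _) fun h _ => ?_
    exact_mod_cast (Nat.choose_le_two_pow _ _).trans (Nat.pow_le_pow_right two_pos (hle h))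
  have h2 : (1 : ℝ) ≤ ∏ h, ((r h).choose (d h) : ℝ) := by
    rw [← Finset.prod_const_one (s := Finset.univ (α := σ))]
    refine Finset.prod_le_prod (fun _ _ => zero_le_one) fun h _ => ?_
    exact_mod_cast Nat.choose_pos ((Nat.le_add_right _ _).trans (hle h))
  simp only [eq_intCast, Int.cast_mul, Int.cast_natCast, abs_mul]
  rw [Nat.abs_cast]
  calc _ ≤ 2 ^ (∑ h, r h) * B :=
        mul_le_mul h1 (hB e) (abs_nonneg _) (by positivity)
    _ ≤ _ := le_mul_of_one_le_right (by positivity) h2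

lemma abs_coeff_hasseDet_le {m k : ℕ} {Q : MvPolynomial (Fin (m + 1)) ℤ} {r : Fin (m + 1) → ℕ}
    {B : ℝ} (hr : ∀ e, coeff e Q ≠ 0 → ∀ h, e h ≤ r h) (hB : ∀ e, |((coeff e Q : ℤ) : ℝ)| ≤ B)
    (w : Fin k → List (Fin m)) (v : Fin k → List Unit) (e : Fin (m + 1) →₀ ℕ) :
    |((coeff e (hasseDet Q w v) : ℤ) : ℝ)| ≤
      k.factorial * (2 ^ (∑ h, r h) * B) ^ k * ∏ h, ((k * r h).choose (e h) : ℝ) := by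
  have h1 : Majorized (map (Int.castRingHom ℝ) (hasseDet Q w v))
      ((k.factorial : ℝ) • (C (2 ^ (∑ h, r h) * B) * ∏ h, (1 + X h) ^ r h) ^ k) := by
    rw [hasseDet, RingHom.map_det]
    exact Majorized.det fun a b => majorized_hasse hr hB
      (fun h => (joinWord (v b) (w a)).count h)
  have h2 := h1 e
  rw [coeff_smul, mul_pow, ← C_pow, coeff_C_mul, ← Finset.prod_pow] at h2
  simp_rw [← pow_mul'] at h2
  rw [coeff_prod_one_add_X_pow, coeff_map] at h2
  simpa [mul_assoc] using h2

/-- Gauss's lemma: the multiplicity of a rational root is controlled by the coefficients. -/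
lemma pow_rootMultiplicity_le {V : Polynomial ℤ} (hV : V ≠ 0) {p q : ℤ} (hq : 0 < q)
    (hpq : IsCoprime p q) {B : ℝ} (hB : ∀ l, |(V.coeff l : ℝ)| ≤ B) :
    (q : ℝ) ^ (V.map (Int.castRingHom ℚ)).rootMultiplicity ((p : ℚ) / q) ≤ B := by
  set l := (V.map (Int.castRingHom ℚ)).rootMultiplicity ((p : ℚ) / q)
  set L : Polynomial ℤ := Polynomial.C q * Polynomial.X - Polynomial.C p with hL
  have hprim : L.IsPrimitive := by
    intro c hc
    rw [Polynomial.C_dvd_iff_dvd_coeff] at hc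
    have h0 := hc 0
    have h1 := hc 1
    simp only [hL, Polynomial.coeff_sub, Polynomial.coeff_C_mul, Polynomial.coeff_X_zero,
      mul_zero, Polynomial.coeff_C_zero, zero_sub, dvd_neg, Polynomial.coeff_X_one, mul_one,
      Polynomial.coeff_C_succ, sub_zero] at h0 h1
    exact hpq.isUnit_of_dvd' h0 h1
  have hprimpow : (L ^ l).IsPrimitive := by
    induction l with
    | zero => simp
    | succ l ih => rw [pow_succ]; exact ih.mul hprim
  have hqQ : (q : ℚ) ≠ 0 := by exact_mod_cast hq.ne'
  have hLmap : L.map (Int.castRingHom ℚ) =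
      Polynomial.C (q : ℚ) * (Polynomial.X - Polynomial.C ((p : ℚ) / q)) := by
    simp only [hL, Polynomial.map_sub, Polynomial.map_mul, Polynomial.map_C, Polynomial.map_X,
      mul_sub, ← Polynomial.C_mul]
    congr 3
    simp [mul_div_cancel₀ _ hqQ]
  have hdvd : L ^ l ∣ V.primPart := by
    refine hprimpow.dvd_of_fraction_map_dvd_fraction_map (K := ℚ) ?_
    have hc : (V.content : ℚ) ≠ 0 := by
      exact_mod_cast fun h => hV (Polynomial.content_eq_zero_iff.mp h)
    have h1 : V.map (Int.castRingHom ℚ) =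
        Polynomial.C (V.content : ℚ) * V.primPart.map (Int.castRingHom ℚ) := by
      conv_lhs => rw [V.eq_C_content_mul_primPart]
      simp
    have h2 : (Polynomial.X - Polynomial.C ((p : ℚ) / q)) ^ l ∣ V.map (Int.castRingHom ℚ) :=
      Polynomial.pow_rootMultiplicity_dvd _ _
    rw [h1] at h2
    have hu : IsUnit (Polynomial.C (V.content : ℚ)) := Polynomial.isUnit_C.mpr hc.isUnit
    have hu' : IsUnit (Polynomial.C (q : ℚ) ^ l) := (Polynomial.isUnit_C.mpr hqQ.isUnit).pow l
    rw [hu.dvd_mul_left] at h2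
    have h3 : (L ^ l).map (algebraMap ℤ ℚ) = Polynomial.C (q : ℚ) ^ l *
        (Polynomial.X - Polynomial.C ((p : ℚ) / q)) ^ l := by
      rw [Polynomial.map_pow, ← mul_pow]
      congr 1
    rw [h3, hu'.mul_left_dvd]
    exact h2
  have hdvd' : L ^ l ∣ V := hdvd.trans (Polynomial.primPart_dvd V)
  obtain ⟨G, hG⟩ := hdvd'
  have hlc : V.leadingCoeff = q ^ l * G.leadingCoeff := by
    have hLlc : L.leadingCoeff = q := by
      rw [hL, sub_eq_add_neg, ← Polynomial.C_neg]
      exact Polynomial.leadingCoeff_linear hq.ne'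
    rw [hG, Polynomial.leadingCoeff_mul, Polynomial.leadingCoeff_pow, hLlc]
  have hG0 : G.leadingCoeff ≠ 0 := by
    intro h
    rw [h, mul_zero] at hlc
    exact hV (Polynomial.leadingCoeff_eq_zero.mp hlc)
  refine le_trans ?_ (hB V.natDegree)
  rw [Polynomial.coeff_natDegree, hlc]
  push_cast
  rw [abs_mul, abs_of_nonneg (by positivity : (0 : ℝ) ≤ (q : ℝ) ^ l)]
  refine le_mul_of_one_le_right (by positivity) ?_
  exact_mod_cast Int.one_le_abs hG0

lemma le_sum_max_sub_div {k r : ℕ} (hr : 0 < r) (hk : k ≤ r + 1) {θ : ℝ} (hθ : 0 < θ)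
    (hθ1 : θ ≤ 1) : k * θ ^ 2 / 8 ≤ ∑ b : Fin k, max 0 (θ - b / r) := by
  have hr' : (0 : ℝ) < r := by exact_mod_cast hr
  set n := min k (⌊θ * r / 2⌋₊ + 1)
  have h1 : ∑ b ∈ Finset.range n, (θ / 2) ≤ ∑ b ∈ Finset.range k, max 0 (θ - b / r) := by
    refine (Finset.sum_le_sum fun b hb => ?_).trans (Finset.sum_le_sum_of_subset_of_nonneg
      (Finset.range_subset_range.mpr (min_le_left _ _)) fun _ _ _ => le_max_left _ _)
    refine le_max_of_le_right ?_
    have hb' : b ≤ ⌊θ * r / 2⌋₊ := by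
      have := (Finset.mem_range.mp hb).trans_le (min_le_right _ _)
      omega
    have h2 : (b : ℝ) ≤ θ * r / 2 := (Nat.le_floor_iff (by positivity)).mp hb'
    have h3 : (b : ℝ) / r ≤ θ / 2 := by
      rw [div_le_iff₀ hr']
      linarith
    linarith
  rw [Finset.sum_const, Finset.card_range, nsmul_eq_mul] at h1
  rw [Fin.sum_univ_eq_sum_range (fun b => max 0 (θ - (b : ℝ) / r))]
  refine le_trans ?_ h1
  have hk2 : (k : ℝ) ≤ 2 * r := by
    have : k ≤ 2 * r := by omega
    exact_mod_cast this
  have hn : (k : ℝ) * θ / 4 ≤ n := by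
    rw [Nat.cast_min, le_min_iff]
    constructor
    · nlinarith [Nat.cast_nonneg (α := ℝ) k]
    · push_cast
      refine le_trans ?_ (Nat.lt_floor_add_one _).le
      nlinarith
  nlinarith

end RothLemma

section RothLemma

open MvPolynomial

/-- The conclusion of Roth's lemma for given parameters: polynomials whose coefficients are small
compared with the heights of the coordinates have index at most `θ`. -/
def RothBound (m : ℕ) (θ ω : ℝ) : Prop :=
  ∀ (r : Fin m → ℕ) (p q : Fin m → ℤ) (Λ : ℝ) (Q : MvPolynomial (Fin m) ℤ), 0 < Λ →
    (∀ h, 0 < r h) → (∀ i j, i < j → (r i : ℝ) ≤ ω * r j) → (∀ h, 0 < q h) →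
    (∀ h, IsCoprime (p h) (q h)) → (∀ h, Λ ≤ r h * Real.log (q h)) → (∀ h, (r h : ℝ) ≤ ω * Λ) →
    (∀ e, coeff e Q ≠ 0 → ∀ h, e h ≤ r h) →
    (∀ e, |((coeff e Q : ℤ) : ℝ)| ≤ Real.exp (ω * Λ)) → Q ≠ 0 →
    ∃ E, coeff E (translate (fun h => (p h : ℚ) / q h) (map (Int.castRingHom ℚ) Q)) ≠ 0 ∧
      ∑ h, (E h : ℝ) * (r h : ℝ)⁻¹ ≤ θ

lemma MvPolynomial.translate_rename_mul_aeval {m : ℕ} (ξ : Fin (m + 1) → ℚ)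
    (U : MvPolynomial (Fin m) ℚ) (V : Polynomial ℚ) :
    translate ξ (rename Fin.succ U * Polynomial.aeval (X 0) V) =
      rename Fin.succ (translate (fun h => ξ h.succ) U) *
        Polynomial.aeval (X 0) (Polynomial.taylor (ξ 0) V) := by
  rw [map_mul]
  congr 1
  · rw [translate, translate, aeval_rename]
    induction U using MvPolynomial.induction_on with
    | C a => simp
    | add p q hp hq => rw [map_add, hp, hq, map_add, map_add]
    | mul_X p j hp => rw [map_mul, hp, map_mul, map_mul, aeval_X, aeval_X]; simp
  · rw [translate, ← Polynomial.aeval_algHom_apply, aeval_X, Polynomial.taylor_apply,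
      Polynomial.aeval_comp]
    simp

lemma Polynomial.coeff_rootMultiplicity_taylor_ne_zero {V : Polynomial ℚ} (hV : V ≠ 0) (ξ : ℚ) :
    (Polynomial.taylor ξ V).coeff (V.rootMultiplicity ξ) ≠ 0 := by
  obtain ⟨G, hG, hnd⟩ := V.exists_eq_pow_rootMultiplicity_mul_and_not_dvd hV ξ
  have h1 : Polynomial.taylor ξ V = Polynomial.X ^ (V.rootMultiplicity ξ) *
      Polynomial.taylor ξ G := by
    conv_lhs => rw [hG]
    rw [Polynomial.taylor_mul, Polynomial.taylor_pow]
    simp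
  rw [h1]
  have := Polynomial.coeff_X_pow_mul (Polynomial.taylor ξ G) (V.rootMultiplicity ξ) 0
  rw [zero_add] at this
  rw [this, Polynomial.taylor_coeff_zero]
  rwa [Polynomial.dvd_iff_isRoot] at hnd

lemma sum_map_inv_joinWord_le {m k : ℕ} {r : Fin (m + 1) → ℕ} {ω : ℝ} (hr : ∀ h, 0 < r h)
    (hω : 0 ≤ ω)
    (hmono : ∀ i j, i < j → (r i : ℝ) ≤ ω * r j) (hk : k ≤ r 0 + 1) {a b : Fin k}
    {v : List Unit} {w : List (Fin m)} (hv : v.length ≤ b) (hw : w.length ≤ a) :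
    ((joinWord v w).map fun h => ((r h : ℝ))⁻¹).sum ≤ b / r 0 + ω := by
  have hr0 : (0 : ℝ) < r 0 := by exact_mod_cast hr 0
  rw [joinWord, List.map_append, List.sum_append, List.map_replicate, List.sum_replicate,
    nsmul_eq_mul, List.map_map]
  refine add_le_add ?_ ?_
  · rw [div_eq_mul_inv]
    gcongr
  · have h1 : (w.map ((fun h => ((r h : ℝ))⁻¹) ∘ Fin.succ)).sum ≤
        (w.map fun _ => ω / r 0).sum := by
      refine List.sum_le_sum fun i _ => ?_
      have hri : (0 : ℝ) < r i.succ := by exact_mod_cast hr i.succ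
      rw [Function.comp_apply, inv_eq_one_div, div_le_div_iff₀ hri hr0, one_mul]
      exact hmono _ _ (Fin.succ_pos i)
    refine h1.trans ?_
    rw [List.map_const', List.sum_replicate, nsmul_eq_mul]
    have h2 : (w.length : ℝ) ≤ r 0 := by
      have := a.2
      exact_mod_cast (by omega : w.length ≤ r 0)
    rw [mul_div_assoc', div_le_iff₀ hr0, mul_comm]
    gcongr

lemma factorial_mul_pow_le_exp {m k R r0 : ℕ} {x : ℝ} (hk : k ≤ r0 + 1)
    (hr : (r0 : ℝ) ≤ x) (hR : (R : ℝ) ≤ (m + 1) * x) :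
    k.factorial * (2 ^ R * Real.exp x) ^ k * 2 ^ (k * R) ≤ Real.exp (k * ((2 * m + 5) * x)) := by
  have h2 : (2 : ℝ) ≤ Real.exp 1 := by
    have := Real.add_one_le_exp (1 : ℝ)
    linarith
  have hR2 : (2 : ℝ) ^ R ≤ Real.exp ((m + 1) * x) := by
    calc (2 : ℝ) ^ R ≤ Real.exp 1 ^ R := by gcongr
      _ = Real.exp R := by rw [← Real.exp_nat_mul, mul_one]
      _ ≤ _ := Real.exp_le_exp.mpr hR
  have hfac : (k.factorial : ℝ) ≤ Real.exp x ^ k := by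
    have h3 : (k : ℝ) ≤ Real.exp x := by
      have := Real.add_one_le_exp x
      have hk' : (k : ℝ) ≤ r0 + 1 := by exact_mod_cast hk
      linarith
    calc (k.factorial : ℝ) ≤ (k : ℝ) ^ k := by exact_mod_cast Nat.factorial_le_pow k
      _ ≤ _ := by gcongr
  calc (k.factorial : ℝ) * (2 ^ R * Real.exp x) ^ k * 2 ^ (k * R)
      = k.factorial * (2 ^ R * Real.exp x * 2 ^ R) ^ k := by rw [pow_mul']; ring
    _ ≤ Real.exp x ^ k * (Real.exp ((m + 1) * x) * Real.exp x * Real.exp ((m + 1) * x)) ^ k := by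
        gcongr
    _ = Real.exp (k * ((2 * m + 4) * x)) := by
        rw [← mul_pow, ← Real.exp_add, ← Real.exp_add, ← Real.exp_add, ← Real.exp_nat_mul]
        congr 1
        ring
    _ ≤ _ := by
        have : (0 : ℝ) ≤ x := (Nat.cast_nonneg _).trans hr
        gcongr
        norm_num

lemma rothBound_succ {m : ℕ} (ih : ∀ θ : ℝ, 0 < θ → ∃ ω : ℝ, 0 < ω ∧ RothBound m θ ω) {θ : ℝ}
    (hθ : 0 < θ) (hθ1 : θ ≤ 1) : ∃ ω : ℝ, 0 < ω ∧ RothBound (m + 1) θ ω := by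
  obtain ⟨ω', hω', hR⟩ := ih (θ ^ 2 / 128) (by positivity)
  set ω := min ω' (θ ^ 2 / 128) / (2 * m + 5) with hω_def
  have hω : 0 < ω := by positivity
  have hωmul : (2 * m + 5) * ω = min ω' (θ ^ 2 / 128) := by
    rw [hω_def, mul_div_cancel₀ _ (by positivity)]
  have hω1 : (2 * m + 5) * ω ≤ ω' := hωmul.le.trans (min_le_left _ _)
  have hω2 : (2 * m + 5) * ω ≤ θ ^ 2 / 128 := hωmul.le.trans (min_le_right _ _)
  have hm0 : (0 : ℝ) ≤ m := Nat.cast_nonneg m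
  have hωω' : ω ≤ ω' := by nlinarith
  have hωθ : ω ≤ θ / 2 := by nlinarith
  refine ⟨ω, hω, ?_⟩
  intro r p q Λ Q hΛ hr hmono hq hpq hlog hrω hsupp hcoef hQ
  have hr' : ∀ h, (0 : ℝ) < r h := fun h => by exact_mod_cast hr h
  set FQ := map (Int.castRingHom ℚ) Q with hFQ
  have hFQ0 : FQ ≠ 0 := by
    rw [hFQ, ne_eq, map_eq_zero_iff _ (map_injective _ Int.cast_injective)]
    exact hQ
  obtain ⟨k, hk, φ, ψ, hφ, hψ, hF⟩ := exists_sum_rename_mul_aeval (N := r 0) FQ (by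
    intro e he
    refine hsupp e ?_ 0
    rintro h
    apply he
    rw [hFQ, coeff_map, h, map_zero])
  have hk0 : 0 < k := by
    rcases Nat.eq_zero_or_pos k with rfl | h
    · exact absurd (by simpa using hF) hFQ0
    · exact h
  have hk0' : (0 : ℝ) < k := by exact_mod_cast hk0
  obtain ⟨w, hw, hU⟩ := exists_iterDeriv_det_ne_zero (fun i => pderiv i)
    MvPolynomial.exists_eq_smul_of_mul_pderiv_eq k φ hφ
  obtain ⟨v, hv, hV⟩ := exists_iterDeriv_det_ne_zero
    (fun _ : Unit => Polynomial.derivative' (R := ℚ))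
    (fun N W hW h => Polynomial.exists_eq_smul_of_mul_derivative_eq N W hW (h ())) k ψ hψ
  obtain ⟨c, hc, hcW⟩ := exists_smul_hasseDet_eq Q w v
  rw [← hFQ, hF, det_iterDeriv_joinWord] at hcW
  set U := (Matrix.of fun a b => iterDeriv (fun i => pderiv i) (w a) (φ b)).det
  set V := (Matrix.of fun a b => iterDeriv (fun _ => Polynomial.derivative') (v a) (ψ b)).det
  set W := hasseDet Q w v with hW
  have hUV : ∀ l E, c * ((coeff (E.cons l) W : ℤ) : ℚ) = V.coeff l * coeff E U := by
    intro l E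
    rw [← coeff_cons_rename_mul_aeval, ← hcW, coeff_smul, coeff_map]
    rfl
  have hWe := abs_coeff_hasseDet_le hsupp hcoef w v
  have hWs : ∀ e, coeff e W ≠ 0 → ∀ h, e h ≤ k * r h := by
    intro e he h
    by_contra hlt
    push Not at hlt
    have h1 := hWe e
    rw [Finset.prod_eq_zero (Finset.mem_univ h)
      (by rw [Nat.choose_eq_zero_of_lt hlt, Nat.cast_zero]), mul_zero] at h1
    exact he (by exact_mod_cast abs_nonpos_iff.mp h1)
  have hWb : ∀ e, |((coeff e W : ℤ) : ℝ)| ≤ Real.exp (k * ((2 * m + 5) * (ω * Λ))) := by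
    intro e
    refine (hWe e).trans (le_trans ?_ (factorial_mul_pow_le_exp hk (hrω 0)
      (R := ∑ h, r h) (m := m) ?_))
    · refine mul_le_mul_of_nonneg_left ?_ (by positivity)
      rw [Finset.mul_sum, ← Finset.prod_pow_eq_pow_sum]
      refine Finset.prod_le_prod (fun _ _ => Nat.cast_nonneg _) fun h _ => ?_
      exact_mod_cast Nat.choose_le_two_pow _ _
    · push_cast
      refine (Finset.sum_le_sum fun h _ => hrω h).trans ?_
      simp
  obtain ⟨l0, hl0⟩ : ∃ l, V.coeff l ≠ 0 := by
    by_contra hcon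
    push Not at hcon
    exact hV (Polynomial.ext fun l => by rw [hcon, Polynomial.coeff_zero])
  obtain ⟨E0, hE0⟩ := exists_coeff_ne_zero hU
  -- the factor in the last `m` variables
  set U' := (finSuccEquiv ℤ m W).coeff l0 with hU'
  have hU'c : ∀ E, coeff E U' = coeff (E.cons l0) W := fun E => finSuccEquiv_coeff_coeff _ _ _
  have hU'U : map (Int.castRingHom ℚ) U' = (V.coeff l0 / c) • U := by
    ext E
    rw [coeff_map, hU'c, coeff_smul, smul_eq_mul, div_mul_eq_mul_div, eq_div_iff hc, ← hUV,
      mul_comm]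
    rfl
  obtain ⟨E', hE', hE'i⟩ := hR (fun h => k * r h.succ) (fun h => p h.succ) (fun h => q h.succ)
    (k * Λ) U' (by positivity) (fun h => Nat.mul_pos hk0 (hr _))
    (by
      intro i j hij
      push_cast
      have := hmono i.succ j.succ (Fin.succ_lt_succ_iff.mpr hij)
      have h2 := hr' j.succ
      rw [mul_left_comm]
      gcongr
      refine this.trans ?_
      gcongr)
    (fun h => hq _) (fun h => hpq _)
    (by
      intro h
      push_cast
      rw [mul_assoc]
      exact mul_le_mul_of_nonneg_left (hlog _) hk0'.le)
    (by
      intro h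
      push_cast
      rw [mul_left_comm]
      refine mul_le_mul_of_nonneg_left ((hrω _).trans ?_) hk0'.le
      gcongr)
    (by
      intro E hE h
      rw [hU'c] at hE
      simpa using hWs _ hE h.succ)
    (by
      intro E
      rw [hU'c]
      refine (hWb _).trans (Real.exp_le_exp.mpr ?_)
      rw [mul_left_comm ω', ← mul_assoc (2 * (m : ℝ) + 5)]
      gcongr)
    (by
      intro h0
      rw [h0, map_zero, eq_comm, smul_eq_zero] at hU'U
      exact hU'U.elim (div_ne_zero hl0 hc) hU)
  rw [hU'U, map_smul, coeff_smul, smul_eq_mul] at hE'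
  -- the factor in the first variable
  set V' : Polynomial ℤ := ∑ l ∈ Finset.range (k * r 0 + 1),
    Polynomial.monomial l (coeff (E0.cons l) W)
  have hV'c : ∀ l, V'.coeff l = coeff (E0.cons l) W := by
    intro l
    simp only [V', Polynomial.finsetSum_coeff, Polynomial.coeff_monomial]
    rw [Finset.sum_ite_eq']
    split_ifs with h
    · rfl
    · by_contra hne
      have := hWs _ (Ne.symm hne) 0
      rw [Finsupp.cons_zero] at this
      exact h (Finset.mem_range.mpr (by omega))
  have hV'V : V'.map (Int.castRingHom ℚ) = Polynomial.C (coeff E0 U / c) * V := by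
    ext l
    rw [Polynomial.coeff_map, hV'c, Polynomial.coeff_C_mul, div_mul_eq_mul_div, eq_div_iff hc,
      mul_comm (coeff E0 U), ← hUV, mul_comm]
    rfl
  have hV'0 : V' ≠ 0 := by
    intro h0
    rw [h0, Polynomial.map_zero, eq_comm, mul_eq_zero, Polynomial.C_eq_zero] at hV'V
    exact hV'V.elim (div_ne_zero hE0 hc) hV
  have hgauss := pow_rootMultiplicity_le hV'0 (hq 0) (hpq 0) (fun l => by
    rw [hV'c]; exact hWb _)
  set l := (V'.map (Int.castRingHom ℚ)).rootMultiplicity ((p 0 : ℚ) / q 0) with hl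
  have hltay : (Polynomial.taylor ((p 0 : ℚ) / q 0) V).coeff l ≠ 0 := by
    have h1 := Polynomial.coeff_rootMultiplicity_taylor_ne_zero
      (V := V'.map (Int.castRingHom ℚ)) (by
        rw [hV'V]; exact mul_ne_zero (Polynomial.C_ne_zero.mpr (div_ne_zero hE0 hc)) hV)
      ((p 0 : ℚ) / q 0)
    rw [← hl, hV'V, Polynomial.taylor_mul, Polynomial.taylor_C, Polynomial.coeff_C_mul] at h1
    exact right_ne_zero_of_mul h1
  have hlb : (l : ℝ) * (r 0 : ℝ)⁻¹ ≤ k * (θ ^ 2 / 128) := by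
    rw [← div_eq_mul_inv, div_le_iff₀ (hr' 0)]
    have hq0 : (0 : ℝ) < q 0 := by exact_mod_cast hq 0
    have h1 := (Real.log_le_log (by positivity) hgauss)
    rw [Real.log_pow, Real.log_exp] at h1
    have h2 := hlog 0
    have h3 : (l : ℝ) * Λ ≤ (k * (θ ^ 2 / 128) * r 0) * Λ := by
      calc (l : ℝ) * Λ ≤ l * (r 0 * Real.log (q 0)) := by gcongr
        _ = r 0 * (l * Real.log (q 0)) := by ring
        _ ≤ r 0 * (k * ((2 * m + 5) * (ω * Λ))) := by gcongr
        _ = r 0 * k * ((2 * m + 5) * ω) * Λ := by ring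
        _ ≤ r 0 * k * (θ ^ 2 / 128) * Λ := by gcongr
        _ = _ := by ring
    exact le_of_mul_le_mul_right h3 hΛ
  -- comparison with the lower bound for the index of the determinant
  by_contra hcon
  push Not at hcon
  set ξ : Fin (m + 1) → ℚ := fun h => (p h : ℚ) / q h
  set ρ : Fin (m + 1) → ℝ := fun h => ((r h : ℝ))⁻¹
  have hρ : ∀ h, 0 ≤ ρ h := fun h => inv_nonneg.mpr (hr' h).le
  have hind : IndexGE ρ θ (translate ξ FQ) := fun e he => (hcon e he).le
  have hentry : ∀ a b : Fin k, IndexGE ρ (max 0 ((θ - ω) - ((b : ℕ) : ℝ) / r 0))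
      (translate ξ (iterDeriv (fun i => pderiv i) (joinWord (v b) (w a)) FQ)) := by
    intro a b
    rcases le_total ((θ - ω) - ((b : ℕ) : ℝ) / r 0) 0 with h | h
    · rw [max_eq_left h]
      exact IndexGE.of_nonneg hρ _
    · rw [max_eq_right h, ← iterDeriv_translate]
      refine (hind.iterDeriv _).mono ?_
      have := sum_map_inv_joinWord_le hr hω.le hmono hk (hv b) (hw a)
      linarith
  have hdet := IndexGE.det hρ (M := Matrix.of fun a b =>
    translate ξ (iterDeriv (fun i => pderiv i) (joinWord (v b) (w a)) FQ)) hentry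
  have hdet' : (Matrix.of fun a b =>
      translate ξ (iterDeriv (fun i => pderiv i) (joinWord (v b) (w a)) FQ)).det =
      translate ξ (rename Fin.succ U * Polynomial.aeval (X 0) V) := by
    rw [← det_iterDeriv_joinWord, ← hF, AlgHom.map_det]
    rfl
  rw [hdet', translate_rename_mul_aeval] at hdet
  have hfin := hdet (E'.cons l) (by
    rw [coeff_cons_rename_mul_aeval]
    exact mul_ne_zero hltay (right_ne_zero_of_mul hE'))
  have hlow := le_sum_max_sub_div (hr 0) hk (θ := θ - ω) (by linarith) (by linarith)
  rw [Fin.sum_univ_succ] at hfin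
  simp only [Finsupp.cons_zero, Finsupp.cons_succ] at hfin
  have hE'k : ∑ h, (E' h : ℝ) * ρ h.succ ≤ k * (θ ^ 2 / 128) := by
    have : ∑ h, (E' h : ℝ) * ρ h.succ = k * ∑ h, (E' h : ℝ) * (((k * r h.succ : ℕ) : ℝ))⁻¹ := by
      rw [Finset.mul_sum]
      refine Finset.sum_congr rfl fun h _ => ?_
      have := hr' h.succ
      push_cast
      simp only [ρ]
      field_simp
    rw [this]
    gcongr
  have hsq : (θ / 2) ^ 2 ≤ (θ - ω) ^ 2 := by
    have : θ / 2 ≤ θ - ω := by linarith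
    gcongr
  have h5 : (k : ℝ) * (θ / 2) ^ 2 / 8 ≤ k * (θ ^ 2 / 128) + k * (θ ^ 2 / 128) := by
    refine le_trans ?_ (hlow.trans (hfin.trans (add_le_add hlb hE'k)))
    gcongr
  have : 0 < (k : ℝ) * θ ^ 2 := by positivity
  nlinarith

/-- Roth's lemma. -/
theorem exists_rothBound (m : ℕ) : ∀ θ : ℝ, 0 < θ → ∃ ω : ℝ, 0 < ω ∧ RothBound m θ ω := by
  induction m with
  | zero =>
    intro θ hθ
    refine ⟨1, one_pos, ?_⟩
    intro r p q Λ Q _ _ _ _ _ _ _ _ _ hQ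
    refine ⟨0, ?_, by simpa using hθ.le⟩
    rw [MvPolynomial.eq_C_of_isEmpty Q] at hQ ⊢
    have hQ' : coeff 0 Q ≠ 0 := fun h => hQ (by rw [h, C_0])
    rw [map_C, MvPolynomial.translate, aeval_C, algebraMap_eq, coeff_C, if_pos rfl]
    simpa using hQ'
  | succ m ih =>
    intro θ hθ
    obtain ⟨ω, hω, h⟩ := rothBound_succ ih (θ := min θ 1) (by positivity) (min_le_right _ _)
    refine ⟨ω, hω, fun r p q Λ Q h1 h2 h3 h4 h5 h6 h7 h8 h9 h10 => ?_⟩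
    obtain ⟨E, hE, hE'⟩ := h r p q Λ Q h1 h2 h3 h4 h5 h6 h7 h8 h9 h10
    exact ⟨E, hE, hE'.trans (min_le_left _ _)⟩

end RothLemma

section Siegel

attribute [local instance] Matrix.seminormedAddCommGroup

/-- Powers of an algebraic number reduced to the range `α ^ l`, `l ≤ e`. -/
lemma exists_reduction_pow {α : ℝ} {e : ℕ} (f : ℕ → ℤ) {H : ℝ} (hH : ∀ l, |(f l : ℝ)| ≤ H)
    (hα : ∑ l ∈ Finset.range (e + 2), (f l : ℝ) * α ^ l = 0) (n : ℕ) :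
    ∃ b : ℕ → ℤ, (f (e + 1) : ℝ) ^ n * α ^ n = ∑ l ∈ Finset.range (e + 1), (b l : ℝ) * α ^ l ∧
      ∀ l, |(b l : ℝ)| ≤ (2 * H) ^ n := by
  have hH0 : 0 ≤ H := (abs_nonneg _).trans (hH 0)
  induction n with
  | zero =>
    refine ⟨fun l => if l = 0 then 1 else 0, ?_, fun l => ?_⟩
    · rw [Finset.sum_range_succ']
      simp
    · dsimp only
      split_ifs <;> simp
  | succ n ih =>
    obtain ⟨b, hb, hbH⟩ := ih
    refine ⟨fun l => (if l = 0 then 0 else f (e + 1) * b (l - 1)) - b e * f l, ?_, fun l => ?_⟩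
    · have h1 : ∑ l ∈ Finset.range (e + 1),
          (((if l = 0 then 0 else f (e + 1) * b (l - 1)) - b e * f l : ℤ) : ℝ) * α ^ l =
          ∑ l ∈ Finset.range e, f (e + 1) * (b l : ℝ) * α ^ (l + 1) -
            b e * ∑ l ∈ Finset.range (e + 1), (f l : ℝ) * α ^ l := by
        push_cast
        simp_rw [sub_mul]
        rw [Finset.sum_sub_distrib, Finset.mul_sum, Finset.sum_range_succ']
        simp [mul_assoc]
      rw [h1]
      rw [Finset.sum_range_succ] at hα hb
      have h2 : (f (e + 1) : ℝ) ^ (n + 1) * α ^ (n + 1) =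
          f (e + 1) * α * ((f (e + 1) : ℝ) ^ n * α ^ n) := by ring
      have h3 : ∑ l ∈ Finset.range e, f (e + 1) * (b l : ℝ) * α ^ (l + 1) =
          f (e + 1) * α * ∑ l ∈ Finset.range e, (b l : ℝ) * α ^ l := by
        rw [Finset.mul_sum]
        exact Finset.sum_congr rfl fun l _ => by ring
      rw [h2, hb, h3]
      linear_combination (b e : ℝ) * hα
    · push_cast
      have h1 : |((if l = 0 then 0 else f (e + 1) * b (l - 1) : ℤ) : ℝ)| ≤ H * (2 * H) ^ n := by
        split_ifs
        · simp only [Int.cast_zero, abs_zero]; positivity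
        · push_cast
          rw [abs_mul]
          exact mul_le_mul (hH _) (hbH _) (abs_nonneg _) hH0
      have h2 : |(b e : ℝ) * f l| ≤ H * (2 * H) ^ n := by
        rw [abs_mul, mul_comm]
        exact mul_le_mul (hH _) (hbH _) (abs_nonneg _) hH0
      push_cast at h1
      calc _ ≤ _ := abs_sub _ _
        _ ≤ _ := add_le_add h1 h2
        _ = _ := by ring

/-- Siegel's lemma for linear forms whose coefficients are integers times powers of `α`. -/
lemma exists_siegel {α : ℝ} (hα : IsAlgebraic ℚ α) : ∃ d : ℕ, 0 < d ∧ ∃ C : ℝ, 1 ≤ C ∧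
    ∀ {ρ γ : Type} [Fintype ρ] [Fintype γ] [Nonempty γ] (κ : ρ → γ → ℤ) (n : ρ → γ → ℕ)
      {K : ℝ} {N : ℕ}, 1 ≤ K → (∀ i j, |(κ i j : ℝ)| ≤ K) → (∀ i j, n i j ≤ N) →
      2 * (d * Fintype.card ρ) ≤ Fintype.card γ →
      ∃ a : γ → ℤ, a ≠ 0 ∧ (∀ j, |(a j : ℝ)| ≤ Fintype.card γ * (K * C ^ N)) ∧
        ∀ i, ∑ j, (a j : ℝ) * (κ i j * α ^ n i j) = 0 := by
  obtain ⟨f, hf0, hf⟩ := (IsFractionRing.isAlgebraic_iff ℤ ℚ ℝ).mpr hα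
  obtain ⟨e, he⟩ : ∃ e, f.natDegree = e + 1 := by
    refine Nat.exists_eq_succ_of_ne_zero fun h => hf0 ?_
    rw [Polynomial.eq_C_of_natDegree_eq_zero h] at hf ⊢
    rw [Polynomial.aeval_C] at hf
    have : f.coeff 0 = 0 := by simpa using hf
    rw [this, map_zero]
  set H : ℝ := 1 + ∑ l ∈ f.support, |(f.coeff l : ℝ)| with hH
  have hH1 : 1 ≤ H := by
    have : 0 ≤ ∑ l ∈ f.support, |(f.coeff l : ℝ)| := Finset.sum_nonneg fun _ _ => abs_nonneg _
    linarith
  have hfH : ∀ l, |(f.coeff l : ℝ)| ≤ H := by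
    intro l
    by_cases hl : l ∈ f.support
    · have := Finset.single_le_sum (f := fun l => |(f.coeff l : ℝ)|)
        (fun _ _ => abs_nonneg _) hl
      linarith
    · rw [Polynomial.notMem_support_iff.mp hl]
      simp only [Int.cast_zero, abs_zero]
      linarith
  have hsum : ∑ l ∈ Finset.range (e + 2), (f.coeff l : ℝ) * α ^ l = 0 := by
    rw [Polynomial.aeval_eq_sum_range, he] at hf
    simpa using hf
  choose b hb hbH using exists_reduction_pow f.coeff hfH hsum
  have hA : (f.coeff (e + 1) : ℝ) ≠ 0 := by
    rw [← he]
    exact_mod_cast Polynomial.leadingCoeff_ne_zero.mpr hf0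
  refine ⟨e + 1, Nat.succ_pos e, 2 * H, by linarith, ?_⟩
  intro ρ γ _ _ _ κ n K N hK hκ hn hcard
  rcases isEmpty_or_nonempty ρ with hρ | hρ
  · refine ⟨fun _ => 1, fun h => one_ne_zero (congrFun h (Classical.arbitrary γ)), fun j => ?_,
      fun i => hρ.elim i⟩
    have h1 : (1 : ℝ) ≤ Fintype.card γ := by exact_mod_cast Fintype.card_pos
    have h2 : (1 : ℝ) ≤ (2 * H) ^ N := one_le_pow₀ (by linarith)
    simp only [Int.cast_one, abs_one]
    nlinarith [mul_le_mul h1 (mul_le_mul hK h2 zero_le_one (by linarith)) (by norm_num)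
      (by linarith)]
  set M : Matrix (ρ × Fin (e + 1)) γ ℤ := fun il j =>
    κ il.1 j * (f.coeff (e + 1) ^ (N - n il.1 j) * b (n il.1 j) il.2) with hM
  have hc1 : Fintype.card (ρ × Fin (e + 1)) = (e + 1) * Fintype.card ρ := by
    rw [Fintype.card_prod, Fintype.card_fin, mul_comm]
  have hpos : 0 < Fintype.card (ρ × Fin (e + 1)) := Fintype.card_pos
  obtain ⟨a, ha0, ha, hnorm⟩ := Int.Matrix.exists_ne_zero_int_vec_norm_le M (by omega) hpos
  have hKC : 1 ≤ K * (2 * H) ^ N := one_le_mul_of_one_le_of_one_le hK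
    (one_le_pow₀ (by linarith))
  have hMnorm : ‖M‖ ≤ K * (2 * H) ^ N := by
    rw [Matrix.norm_le_iff (by linarith)]
    intro il j
    rw [Int.norm_eq_abs]
    simp only [hM]
    push_cast
    rw [abs_mul, abs_mul, abs_pow]
    have h1 : |(f.coeff (e + 1) : ℝ)| ^ (N - n il.1 j) ≤ (2 * H) ^ (N - n il.1 j) := by
      gcongr
      exact (hfH _).trans (by linarith)
    calc _ ≤ K * ((2 * H) ^ (N - n il.1 j) * (2 * H) ^ (n il.1 j)) := by
          gcongr
          · exact hκ _ _
          · exact hbH _ _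
      _ = _ := by rw [← pow_add, Nat.sub_add_cancel (hn _ _)]
  refine ⟨a, ha0, fun j => ?_, fun i => ?_⟩
  · have hcγ : (1 : ℝ) ≤ Fintype.card γ := by exact_mod_cast Fintype.card_pos
    have h1 : ‖a j‖ ≤ ‖a‖ := norm_le_pi_norm a j
    rw [Int.norm_eq_abs] at h1
    refine h1.trans (hnorm.trans ?_)
    have h2 : (1 : ℝ) ≤ Fintype.card γ * max 1 ‖M‖ :=
      one_le_mul_of_one_le_of_one_le hcγ (le_max_left _ _)
    have h3 : (Fintype.card (ρ × Fin (e + 1)) : ℝ) /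
        (Fintype.card γ - Fintype.card (ρ × Fin (e + 1))) ≤ 1 := by
      have h4 : 2 * (Fintype.card (ρ × Fin (e + 1)) : ℝ) ≤ Fintype.card γ := by
        exact_mod_cast hc1 ▸ hcard
      have h5 : (0 : ℝ) < Fintype.card (ρ × Fin (e + 1)) := by exact_mod_cast hpos
      rw [div_le_one (by linarith)]
      linarith
    refine (Real.rpow_le_rpow_of_exponent_le h2 h3).trans ?_
    rw [Real.rpow_one]
    gcongr
    exact max_le hKC hMnorm
  · have h1 : ∀ l : Fin (e + 1), ∑ j, (a j : ℝ) * (κ i j * ((f.coeff (e + 1) : ℝ) ^ (N - n i j) *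
        b (n i j) l)) = 0 := by
      intro l
      have := congrFun ha (i, l)
      simp only [Matrix.mulVec, dotProduct, hM, Pi.zero_apply] at this
      have h2 := congrArg (Int.cast : ℤ → ℝ) this
      push_cast at h2
      rw [← h2]
      exact Finset.sum_congr rfl fun j _ => by ring
    have h2 : (f.coeff (e + 1) : ℝ) ^ N * ∑ j, (a j : ℝ) * (κ i j * α ^ n i j) =
        ∑ l : Fin (e + 1), (∑ j, (a j : ℝ) * (κ i j * ((f.coeff (e + 1) : ℝ) ^ (N - n i j) *
        b (n i j) l))) * α ^ (l : ℕ) := by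
      simp_rw [Finset.sum_mul]
      rw [Finset.sum_comm, Finset.mul_sum]
      refine Finset.sum_congr rfl fun j _ => ?_
      have h3 := hb (n i j)
      rw [Finset.sum_range] at h3
      rw [← Nat.sub_add_cancel (hn i j), pow_add]
      have h4 : ∀ l : Fin (e + 1), (a j : ℝ) * (κ i j * ((f.coeff (e + 1) : ℝ) ^ (N - n i j) *
        b (n i j) l)) * α ^ (l : ℕ) = ((a j : ℝ) * κ i j * (f.coeff (e + 1) : ℝ) ^ (N - n i j)) *
          (b (n i j) l * α ^ (l : ℕ)) := fun l => by ring
      simp only [Nat.sub_add_cancel (hn i j)]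
      simp_rw [h4]
      rw [← Finset.mul_sum, ← h3]
      ring
    have h3 : (f.coeff (e + 1) : ℝ) ^ N * ∑ j, (a j : ℝ) * (κ i j * α ^ n i j) = 0 := by
      rw [h2]
      exact Finset.sum_eq_zero fun l _ => by rw [h1, zero_mul]
    exact (mul_eq_zero.mp h3).resolve_left (pow_ne_zero _ hA)

end Siegel

section LargeDeviation

/-- An upper bound for the number of tuples whose coordinates have a large average. -/
lemma card_filter_lt_sum_le {m : ℕ} {τ : Type*} (T : Fin m → Finset τ) (ξ : Fin m → τ → ℝ)
    (h1 : ∀ h, ∀ j ∈ T h, |ξ h j| ≤ 1) (h0 : ∀ h, ∑ j ∈ T h, ξ h j = 0) {ε : ℝ} (hε : 0 < ε)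
    (hε1 : ε ≤ 1) :
    (((Fintype.piFinset T).filter fun J => m * ε < ∑ h, ξ h (J h)).card : ℝ) ≤
      Real.exp (-(m * ε ^ 2 / 4)) * (Fintype.piFinset T).card := by
  classical
  have hstep : ∀ h, ∑ j ∈ T h, Real.exp (ε / 2 * ξ h j - ε ^ 2 / 2) ≤
      Real.exp (-(ε ^ 2 / 4)) * (T h).card := by
    intro h
    have h2 : ∀ j ∈ T h, Real.exp (ε / 2 * ξ h j - ε ^ 2 / 2) ≤
        Real.exp (- (ε ^ 2 / 2)) * (1 + ε ^ 2 / 4 + ε / 2 * ξ h j) := by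
      intro j hj
      rw [sub_eq_neg_add, Real.exp_add]
      refine mul_le_mul_of_nonneg_left ?_ (Real.exp_nonneg _)
      have hj1 := h1 h j hj
      have habs : |ε / 2 * ξ h j| ≤ ε / 2 := by
        rw [abs_mul, abs_of_pos (by positivity : 0 < ε / 2)]
        exact mul_le_of_le_one_right (by positivity) hj1
      have h3 := (abs_le.mp (Real.abs_exp_sub_one_sub_id_le (x := ε / 2 * ξ h j)
        (habs.trans (by linarith)))).2
      have h4 : (ε / 2 * ξ h j) ^ 2 ≤ (ε / 2) ^ 2 := sq_le_sq' (abs_le.mp habs).1 (abs_le.mp habs).2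
      nlinarith
    refine (Finset.sum_le_sum h2).trans ?_
    rw [← Finset.mul_sum, Finset.sum_add_distrib, ← Finset.mul_sum, h0, mul_zero, add_zero,
      Finset.sum_const, nsmul_eq_mul]
    have h5 : 1 + ε ^ 2 / 4 ≤ Real.exp (ε ^ 2 / 4) := by
      have := Real.add_one_le_exp (ε ^ 2 / 4)
      linarith
    calc _ ≤ Real.exp (-(ε ^ 2 / 2)) * ((T h).card * Real.exp (ε ^ 2 / 4)) := by gcongr
      _ = Real.exp (-(ε ^ 2 / 2) + ε ^ 2 / 4) * (T h).card := by rw [Real.exp_add]; ring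
      _ = _ := by congr 2; ring
  calc (((Fintype.piFinset T).filter fun J => m * ε < ∑ h, ξ h (J h)).card : ℝ)
      = ∑ J ∈ (Fintype.piFinset T).filter fun J => m * ε < ∑ h, ξ h (J h), (1 : ℝ) := by simp
    _ ≤ ∑ J ∈ (Fintype.piFinset T).filter fun J => m * ε < ∑ h, ξ h (J h),
        ∏ h, Real.exp (ε / 2 * ξ h (J h) - ε ^ 2 / 2) := by
        refine Finset.sum_le_sum fun J hJ => ?_
        rw [← Real.exp_sum, Finset.sum_sub_distrib, ← Finset.mul_sum]
        apply Real.one_le_exp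
        have := (Finset.mem_filter.mp hJ).2
        simp only [Finset.sum_const, Finset.card_univ, Fintype.card_fin, nsmul_eq_mul]
        nlinarith
    _ ≤ ∑ J ∈ Fintype.piFinset T, ∏ h, Real.exp (ε / 2 * ξ h (J h) - ε ^ 2 / 2) :=
        Finset.sum_le_sum_of_subset_of_nonneg (Finset.filter_subset _ _)
          fun _ _ _ => Finset.prod_nonneg fun _ _ => Real.exp_nonneg _
    _ = ∏ h, ∑ j ∈ T h, Real.exp (ε / 2 * ξ h j - ε ^ 2 / 2) :=
        (Finset.prod_univ_sum T fun h j => Real.exp (ε / 2 * ξ h j - ε ^ 2 / 2)).symm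
    _ ≤ ∏ h, (Real.exp (-(ε ^ 2 / 4)) * (T h).card) :=
        Finset.prod_le_prod (fun _ _ => Finset.sum_nonneg fun _ _ => Real.exp_nonneg _)
          fun h _ => hstep h
    _ = _ := by
        rw [Finset.prod_mul_distrib, Fintype.card_piFinset, Finset.prod_const, ← Real.exp_nat_mul]
        push_cast
        congr 2
        simp
        ring

end LargeDeviation

section TernaryExpansion

open Finset

/-- Exponents of the ternary forms of degree `r`. -/
abbrev ternaryExp (r : ℕ) : Finset (Fin 3 → ℕ) := piAntidiag univ r

lemma mem_ternaryExp {r : ℕ} {j : Fin 3 → ℕ} : j ∈ ternaryExp r ↔ j 0 + j 1 + j 2 = r := by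
  simp [mem_piAntidiag, Fin.sum_univ_three]

lemma multinomial_le_three_pow {r : ℕ} {k : Fin 3 → ℕ} (hk : k ∈ ternaryExp r) :
    Nat.multinomial univ k ≤ 3 ^ r := by
  have h := sum_pow_eq_sum_piAntidiag (univ : Finset (Fin 3)) (fun _ => (1 : ℕ)) r
  simp only [sum_const, card_univ, Fintype.card_fin, smul_eq_mul, mul_one, one_pow,
    prod_const_one] at h
  rw [h]
  exact single_le_sum (f := fun k => ((Nat.multinomial univ k : ℕ) : ℕ))
    (fun _ _ => Nat.zero_le _) hk

lemma card_ternaryExp_le (r : ℕ) : #(ternaryExp r) ≤ 3 ^ r := by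
  have h := sum_pow_eq_sum_piAntidiag (univ : Finset (Fin 3)) (fun _ => (1 : ℕ)) r
  simp only [sum_const, card_univ, Fintype.card_fin, smul_eq_mul, mul_one, one_pow,
    prod_const_one] at h
  rw [h, card_eq_sum_ones]
  exact sum_le_sum fun k _ => Nat.multinomial_pos univ k

lemma three_mul_sum_ternaryExp (r : ℕ) (e : Fin 3) :
    3 * ∑ j ∈ ternaryExp r, j e = r * #(ternaryExp r) := by
  have hsymm : ∀ e', ∑ j ∈ ternaryExp r, j e' = ∑ j ∈ ternaryExp r, j e := by
    intro e'
    refine sum_equiv (Equiv.arrowCongr (Equiv.swap e e') (Equiv.refl ℕ)) (fun j => ?_)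
      (fun j _ => ?_)
    · simp only [mem_piAntidiag, mem_univ, implies_true, and_true, Equiv.arrowCongr_apply,
        Equiv.coe_refl, Function.id_comp]
      rw [← Equiv.sum_comp (Equiv.swap e e').symm j]
      rfl
    · simp [Equiv.arrowCongr_apply]
  calc 3 * ∑ j ∈ ternaryExp r, j e = ∑ e', ∑ j ∈ ternaryExp r, j e' := by
        rw [sum_congr rfl fun e' _ => hsymm e']
        simp
    _ = ∑ j ∈ ternaryExp r, r := by
        rw [sum_comm]
        exact sum_congr rfl fun j hj => (mem_piAntidiag.mp hj).1
    _ = _ := by rw [sum_const, smul_eq_mul, mul_comm]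

/-- The integer part of the coefficients in `prod_pow_eq_sum_shiftCoeff`. -/
def shiftCoeff (i j : Fin 3 → ℕ) : ℤ :=
  if i 1 ≤ j 1 ∧ i 2 ≤ j 2 then
    (-1) ^ ((j 1 - i 1) + (j 2 - i 2)) * Nat.multinomial univ ![j 0, j 1 - i 1, j 2 - i 2]
  else 0

/-- The exponent of `α` in the coefficients in `prod_pow_eq_sum_shiftCoeff`. -/
def shiftExp (i j : Fin 3 → ℕ) : ℕ := (j 1 - i 1) + 2 * (j 2 - i 2)

lemma abs_shiftCoeff_le {r : ℕ} {i j : Fin 3 → ℕ} (hj : j ∈ ternaryExp r) :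
    |(shiftCoeff i j : ℝ)| ≤ 3 ^ r := by
  rw [shiftCoeff]
  split_ifs with h
  · push_cast
    rw [abs_mul, abs_pow, abs_neg, abs_one, one_pow, one_mul, Nat.abs_cast]
    have h1 : Nat.multinomial univ ![j 0, j 1 - i 1, j 2 - i 2] ≤
        3 ^ (j 0 + (j 1 - i 1) + (j 2 - i 2)) :=
      multinomial_le_three_pow (mem_ternaryExp.mpr rfl)
    have h2 : j 0 + (j 1 - i 1) + (j 2 - i 2) ≤ r := by
      have := mem_ternaryExp.mp hj
      omega
    exact_mod_cast h1.trans (Nat.pow_le_pow_right (by norm_num) h2)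
  · simp

lemma shiftExp_le {r : ℕ} {i j : Fin 3 → ℕ} (hj : j ∈ ternaryExp r) :
    shiftExp i j ≤ 2 * r := by
  have := mem_ternaryExp.mp hj
  rw [shiftExp]
  omega

/-- A monomial in `z` expanded in the variables `z 0 + α z 1 + α² z 2`, `z 1`, `z 2`. -/
lemma prod_pow_eq_sum_shiftCoeff {S : Type*} [CommRing S] [Algebra ℝ S] (α : ℝ) (z : Fin 3 → S)
    {r : ℕ} {i : Fin 3 → ℕ} (hi : i ∈ ternaryExp r) :
    ∏ e, z e ^ i e = ∑ j ∈ ternaryExp r, ((shiftCoeff i j : ℝ) * α ^ shiftExp i j) •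
      ((z 0 + α • z 1 + α ^ 2 • z 2) ^ j 0 * z 1 ^ j 1 * z 2 ^ j 2) := by
  have hi' := mem_ternaryExp.mp hi
  set w := z 0 + α • z 1 + α ^ 2 • z 2 with hw
  have h0 : z 0 = ∑ e : Fin 3, ![w, -(α • z 1), -(α ^ 2 • z 2)] e := by
    simp only [Fin.sum_univ_three, hw, Matrix.cons_val_zero, Matrix.cons_val_one, Matrix.cons_val]
    ring
  rw [Fin.prod_univ_three, h0, sum_pow_eq_sum_piAntidiag, sum_mul, sum_mul]
  refine sum_of_injOn (fun k => ![k 0, k 1 + i 1, k 2 + i 2]) ?_ ?_ ?_ ?_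
  · intro k _ k' _ h
    have e0 := congrFun h 0
    have e1 := congrFun h 1
    have e2 := congrFun h 2
    simp at e0 e1 e2
    funext e
    fin_cases e <;> assumption
  · intro k hk
    have := mem_ternaryExp.mp hk
    refine mem_ternaryExp.mpr ?_
    simp
    omega
  · intro j hj hj'
    rw [shiftCoeff, if_neg, Int.cast_zero, zero_mul, zero_smul]
    rintro ⟨h1, h2⟩
    refine hj' ⟨![j 0, j 1 - i 1, j 2 - i 2], ?_, ?_⟩
    · have := mem_ternaryExp.mp hj
      refine mem_ternaryExp.mpr ?_
      simp
      omega
    · funext e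
      fin_cases e <;> simp [h1, h2]
  · intro k _
    have hk : ![k 0, k 1, k 2] = k := by
      funext e
      fin_cases e <;> rfl
    simp only [Fin.prod_univ_three, shiftCoeff, shiftExp, Matrix.cons_val_zero, Matrix.cons_val_one,
      Matrix.cons_val, Nat.le_add_left, and_self, if_true, Nat.add_sub_cancel, hk,
      Algebra.smul_def, map_mul, map_pow, map_intCast]
    push_cast
    ring

end TernaryExpansion

section AuxiliaryPolynomial

open Finset

/-- Exponents of the multihomogeneous forms of multidegree `r` in blocks of three variables. -/
abbrev multiTernaryExp {m : ℕ} (r : Fin m → ℕ) : Finset (Fin m → Fin 3 → ℕ) :=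
  Fintype.piFinset fun h => ternaryExp (r h)

lemma card_multiTernaryExp_le {m : ℕ} (r : Fin m → ℕ) :
    #(multiTernaryExp r) ≤ 3 ^ ∑ h, r h := by
  rw [Fintype.card_piFinset, ← prod_pow_eq_pow_sum]
  exact prod_le_prod' fun h _ => card_ternaryExp_le (r h)

lemma multiTernaryExp_nonempty {m : ℕ} (r : Fin m → ℕ) : (multiTernaryExp r).Nonempty :=
  Fintype.piFinset_nonempty.mpr fun h => ⟨![r h, 0, 0], mem_ternaryExp.mpr (by simp)⟩

/-- Few multi-exponents have a weighted degree far above the average. -/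
lemma card_filter_multiTernaryExp_le {m : ℕ} {r : Fin m → ℕ} (hr : ∀ h, 0 < r h) {b : Fin 3 → ℝ}
    (hb : ∀ e, |b e| ≤ 2) {ε : ℝ} (hε : 0 < ε) (hε1 : ε ≤ 1) :
    (#{J ∈ multiTernaryExp r |
      m * ((∑ e, b e) / 3 + ε) < ∑ h, (∑ e, b e * J h e) / r h} : ℝ) ≤
      Real.exp (-(m * ε ^ 2 / 64)) * #(multiTernaryExp r) := by
  have hbs : |∑ e, b e| ≤ 6 := by
    refine (abs_sum_le_sum_abs _ _).trans ((sum_le_sum fun e _ => hb e).trans ?_)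
    norm_num
  set ξ : Fin m → (Fin 3 → ℕ) → ℝ := fun h j =>
    ((∑ e, b e * j e) / r h - (∑ e, b e) / 3) / 4 with hξ
  have h1 : ∀ h, ∀ j ∈ ternaryExp (r h), |ξ h j| ≤ 1 := by
    intro h j hj
    have hrh : (0 : ℝ) < r h := by exact_mod_cast hr h
    have h2 : |∑ e, b e * j e| ≤ 2 * r h := by
      have hs : ∑ e, (j e : ℝ) = r h := by exact_mod_cast (mem_piAntidiag.mp hj).1
      rw [← hs, mul_sum]
      refine (abs_sum_le_sum_abs _ _).trans (sum_le_sum fun e _ => ?_)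
      rw [abs_mul, Nat.abs_cast]
      exact mul_le_mul_of_nonneg_right (hb e) (Nat.cast_nonneg _)
    have h3 : |(∑ e, b e * j e) / r h| ≤ 2 := by
      rw [abs_div, Nat.abs_cast, div_le_iff₀ hrh]
      exact h2
    rw [abs_le] at h3 hbs ⊢
    simp only [hξ]
    constructor <;> linarith
  have h0 : ∀ h, ∑ j ∈ ternaryExp (r h), ξ h j = 0 := by
    intro h
    have hrh : (r h : ℝ) ≠ 0 := by exact_mod_cast (hr h).ne'
    simp only [hξ]
    rw [← sum_div, sum_sub_distrib, ← sum_div, sum_comm, sum_const, nsmul_eq_mul]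
    have h2 : ∀ e, ∑ j ∈ ternaryExp (r h), b e * (j e : ℝ) =
        b e * (r h * #(ternaryExp (r h)) / 3) := by
      intro e
      rw [← mul_sum]
      congr 1
      have : (3 : ℝ) * ∑ j ∈ ternaryExp (r h), (j e : ℝ) = r h * #(ternaryExp (r h)) := by
        exact_mod_cast three_mul_sum_ternaryExp (r h) e
      linarith
    simp_rw [h2]
    rw [← sum_mul]
    field_simp
    ring
  have key := card_filter_lt_sum_le (fun h => ternaryExp (r h)) ξ h1 h0
    (by positivity : 0 < ε / 4) (by linarith)
  have hfil : ({J ∈ multiTernaryExp r | m * ((∑ e, b e) / 3 + ε) <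
      ∑ h, (∑ e, b e * J h e) / r h} : Finset (Fin m → Fin 3 → ℕ)) =
      {J ∈ multiTernaryExp r | m * (ε / 4) < ∑ h, ξ h (J h)} := by
    refine filter_congr fun J _ => ?_
    simp only [hξ]
    rw [← sum_div, sum_sub_distrib, sum_const, card_univ, Fintype.card_fin, nsmul_eq_mul]
    constructor <;> intro h <;> linarith
  rw [hfil]
  refine key.trans_eq ?_
  congr 3
  ring

/-- Auxiliary multihomogeneous polynomials with small integer coefficients whose expansion in the
linear forms `y 0 + α y 1 + α² y 2`, `y 1`, `y 2` contains no monomial of large weight. -/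
lemma exists_auxiliary {α : ℝ} (hα : IsAlgebraic ℚ α) {b : Fin 3 → ℝ} (hb : ∀ e, |b e| ≤ 2)
    {ε : ℝ} (hε : 0 < ε) (hε1 : ε ≤ 1) :
    ∃ m : ℕ, 0 < m ∧ ∃ C : ℝ, 1 ≤ C ∧ ∀ r : Fin m → ℕ, (∀ h, 0 < r h) →
      ∃ (a : (Fin m → Fin 3 → ℕ) → ℤ) (c : (Fin m → Fin 3 → ℕ) → ℝ),
        (∃ i ∈ multiTernaryExp r, a i ≠ 0) ∧
        (∀ i ∈ multiTernaryExp r, |(a i : ℝ)| ≤ C ^ ∑ h, r h) ∧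
        (∀ J ∈ multiTernaryExp r, |c J| ≤ C ^ ∑ h, r h) ∧
        (∀ J ∈ multiTernaryExp r, c J ≠ 0 →
          ∑ h, (∑ e, b e * J h e) / r h ≤ m * ((∑ e, b e) / 3 + ε)) ∧
        ∀ {S : Type} [CommRing S] [Algebra ℝ S] (y : Fin m → Fin 3 → S),
          ∑ i ∈ multiTernaryExp r, (a i : S) * ∏ h, ∏ e, y h e ^ i h e =
          ∑ J ∈ multiTernaryExp r, c J • ∏ h, ((y h 0 + α • y h 1 + α ^ 2 • y h 2) ^ J h 0 *
            y h 1 ^ J h 1 * y h 2 ^ J h 2) := by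
  obtain ⟨d, hd, C, hC, hS⟩ := exists_siegel hα
  obtain ⟨m, hm⟩ : ∃ m : ℕ, 2 * d * Real.exp (-(m * ε ^ 2 / 64)) ≤ 1 := by
    obtain ⟨m, hm⟩ := exists_nat_ge (2 * d / (ε ^ 2 / 64) : ℝ)
    refine ⟨m, ?_⟩
    rw [Real.exp_neg, ← div_eq_mul_inv, div_le_one (Real.exp_pos _)]
    rw [div_le_iff₀ (by positivity)] at hm
    have := Real.add_one_le_exp (m * ε ^ 2 / 64)
    linarith
  have hm0 : 0 < m := by
    rcases Nat.eq_zero_or_pos m with rfl | h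
    · have : (1 : ℝ) ≤ d := by exact_mod_cast hd
      norm_num at hm
      linarith
    · exact h
  set A : ℝ := max 1 |α| with hA
  have hA1 : 1 ≤ A := le_max_left _ _
  refine ⟨m, hm0, 27 * C ^ 2 * A ^ 2 * 3, ?_, fun r hr => ?_⟩
  · have h1 : 1 ≤ C ^ 2 := one_le_pow₀ hC
    have h2 : 1 ≤ A ^ 2 := one_le_pow₀ hA1
    nlinarith [one_le_mul_of_one_le_of_one_le h1 h2]
  set bad : Finset (Fin m → Fin 3 → ℕ) := {J ∈ multiTernaryExp r |
      m * ((∑ e, b e) / 3 + ε) < ∑ h, (∑ e, b e * J h e) / r h} with hbad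
  set R : ℕ := ∑ h, r h with hR
  let κ : (Fin m → Fin 3 → ℕ) → (Fin m → Fin 3 → ℕ) → ℤ := fun i J => ∏ h, shiftCoeff (i h) (J h)
  let n : (Fin m → Fin 3 → ℕ) → (Fin m → Fin 3 → ℕ) → ℕ := fun i J => ∑ h, shiftExp (i h) (J h)
  have hκ : ∀ i, ∀ J ∈ multiTernaryExp r, |(κ i J : ℝ)| ≤ 3 ^ R := by
    intro i J hJ
    simp only [κ]
    push_cast
    rw [abs_prod, hR, ← prod_pow_eq_pow_sum]
    exact prod_le_prod (fun _ _ => abs_nonneg _)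
      fun h _ => abs_shiftCoeff_le (Fintype.mem_piFinset.mp hJ h)
  have hn : ∀ i, ∀ J ∈ multiTernaryExp r, n i J ≤ 2 * R := by
    intro i J hJ
    simp only [n]
    rw [hR, mul_sum]
    exact sum_le_sum fun h _ => shiftExp_le (Fintype.mem_piFinset.mp hJ h)
  have : Nonempty (multiTernaryExp r) := (multiTernaryExp_nonempty r).to_subtype
  have hbadmem : ∀ J : bad, J.1 ∈ multiTernaryExp r := fun J => (mem_filter.mp J.2).1
  have hcard : 2 * (d * Fintype.card bad) ≤ Fintype.card (multiTernaryExp r) := by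
    rw [Fintype.card_coe, Fintype.card_coe]
    have h1 := card_filter_multiTernaryExp_le hr hb hε hε1
    rw [← hbad] at h1
    have h2 : (2 * (d * #bad) : ℝ) ≤ #(multiTernaryExp r) := by
      calc (2 * (d * #bad) : ℝ) = 2 * d * #bad := by ring
        _ ≤ 2 * d * (Real.exp (-(m * ε ^ 2 / 64)) * #(multiTernaryExp r)) := by gcongr
        _ = (2 * d * Real.exp (-(m * ε ^ 2 / 64))) * #(multiTernaryExp r) := by ring
        _ ≤ 1 * #(multiTernaryExp r) := by gcongr
        _ = _ := one_mul _
    exact_mod_cast h2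
  obtain ⟨a', ha'0, ha', ha'v⟩ := hS (ρ := bad) (γ := multiTernaryExp r)
    (fun J i => κ i.1 J.1) (fun J i => n i.1 J.1) (K := 3 ^ R) (N := 2 * R)
    (one_le_pow₀ (by norm_num)) (fun J i => hκ _ _ (hbadmem J)) (fun J i => hn _ _ (hbadmem J))
    hcard
  classical
  let a : (Fin m → Fin 3 → ℕ) → ℤ := fun i => if hi : i ∈ multiTernaryExp r then a' ⟨i, hi⟩ else 0
  have haa' : ∀ i : multiTernaryExp r, a i.1 = a' i := fun i => dif_pos i.2
  have hcT : (#(multiTernaryExp r) : ℝ) ≤ 3 ^ R := by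
    exact_mod_cast card_multiTernaryExp_le r
  have hab : ∀ i ∈ multiTernaryExp r, |(a i : ℝ)| ≤ 3 ^ R * (3 ^ R * C ^ (2 * R)) := by
    intro i hi
    rw [haa' ⟨i, hi⟩]
    refine (ha' ⟨i, hi⟩).trans ?_
    rw [Fintype.card_coe]
    gcongr
  let c : (Fin m → Fin 3 → ℕ) → ℝ := fun J =>
    ∑ i ∈ multiTernaryExp r, (a i : ℝ) * (κ i J * α ^ n i J)
  refine ⟨a, c, ?_, fun i hi => ?_, fun J hJ => ?_, fun J hJ hcJ => ?_, ?_⟩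
  · by_contra! h
    refine ha'0 (funext fun i => ?_)
    rw [← haa']
    exact h i.1 i.2
  · refine (hab i hi).trans ?_
    calc (3 ^ R * (3 ^ R * C ^ (2 * R)) : ℝ) = (3 * 3 * C ^ 2 * 1 * 1) ^ R := by
          rw [pow_mul]; simp only [mul_pow]; ring
      _ ≤ (27 * C ^ 2 * A ^ 2 * 3) ^ R := by
          have h2 : 1 ≤ A ^ 2 := one_le_pow₀ hA1
          gcongr <;> norm_num
  · calc |c J| ≤ ∑ i ∈ multiTernaryExp r, 3 ^ R * (3 ^ R * C ^ (2 * R)) *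
          (3 ^ R * A ^ (2 * R)) := by
          refine (abs_sum_le_sum_abs _ _).trans (sum_le_sum fun i hi => ?_)
          rw [abs_mul, abs_mul, abs_pow]
          gcongr
          · exact hab i hi
          · exact hκ i J hJ
          · exact (pow_le_pow_left₀ (abs_nonneg _) (le_max_right _ _) _).trans
              (pow_le_pow_right₀ hA1 (hn i J hJ))
      _ ≤ 3 ^ R * (3 ^ R * (3 ^ R * C ^ (2 * R)) * (3 ^ R * A ^ (2 * R))) := by
          rw [sum_const, nsmul_eq_mul]
          gcongr
      _ = (3 * 3 * 3 * 3 * C ^ 2 * A ^ 2) ^ R := by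
          rw [pow_mul, pow_mul]; simp only [mul_pow]; ring
      _ = _ := by congr 1; ring
  · by_contra! h
    refine hcJ ?_
    have := ha'v ⟨J, mem_filter.mpr ⟨hJ, h⟩⟩
    rw [← this]
    simp only [c]
    rw [← sum_coe_sort]
    exact sum_congr rfl fun i _ => by rw [haa']
  · intro S _ _ y
    have h1 : ∀ i ∈ multiTernaryExp r, (a i : S) * ∏ h, ∏ e, y h e ^ i h e =
        ∑ J ∈ multiTernaryExp r, ((a i : ℝ) * (κ i J * α ^ n i J)) •
          ∏ h, ((y h 0 + α • y h 1 + α ^ 2 • y h 2) ^ J h 0 *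
            y h 1 ^ J h 1 * y h 2 ^ J h 2) := by
      intro i hi
      rw [prod_congr rfl fun h _ => prod_pow_eq_sum_shiftCoeff α (y h)
        (Fintype.mem_piFinset.mp hi h), prod_univ_sum, mul_sum]
      refine sum_congr rfl fun J _ => ?_
      rw [mul_smul]
      have h2 : ((κ i J : ℝ) * α ^ n i J) =
          ∏ h, ((shiftCoeff (i h) (J h) : ℝ) * α ^ shiftExp (i h) (J h)) := by
        rw [prod_mul_distrib, prod_pow_eq_pow_sum]
        simp [κ, n]
      rw [h2, ← Finset.prod_smul, Algebra.smul_def, map_intCast]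
    rw [sum_congr rfl h1, sum_comm]
    exact sum_congr rfl fun J _ => (sum_smul ..).symm

end AuxiliaryPolynomial

section Pencil

open MvPolynomial Finset

variable {m : ℕ}

/-- The generic point `s • (1, 0, 0) + t • v + u • w` in each block. -/
noncomputable def pencilVar (v w : Fin m → Fin 3 → ℤ) (h : Fin m) (e : Fin 3) :
    MvPolynomial (Fin m × Fin 3) ℤ :=
  (if e = 0 then X (h, 0) else 0) + C (v h e) * X (h, 1) + C (w h e) * X (h, 2)

/-- The restriction of a multihomogeneous form to the generic points `pencilVar`. -/
noncomputable def pencil (r : Fin m → ℕ) (a : (Fin m → Fin 3 → ℕ) → ℤ) (v w : Fin m → Fin 3 → ℤ) :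
    MvPolynomial (Fin m × Fin 3) ℤ :=
  ∑ i ∈ multiTernaryExp r, C (a i) * ∏ h, ∏ e, pencilVar v w h e ^ i h e

lemma abs_coeff_pencil_le {α : ℝ} {r : Fin m → ℕ} {a : (Fin m → Fin 3 → ℕ) → ℤ}
    {c : (Fin m → Fin 3 → ℕ) → ℝ}
    (hac : ∀ {S : Type} [CommRing S] [Algebra ℝ S] (y : Fin m → Fin 3 → S),
      ∑ i ∈ multiTernaryExp r, (a i : S) * ∏ h, ∏ e, y h e ^ i h e =
      ∑ J ∈ multiTernaryExp r, c J • ∏ h, ((y h 0 + α • y h 1 + α ^ 2 • y h 2) ^ J h 0 *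
        y h 1 ^ J h 1 * y h 2 ^ J h 2))
    {v w : Fin m → Fin 3 → ℤ} {B : Fin m → Fin 3 → ℝ} (hB : ∀ h e, 0 ≤ B h e)
    (hv0 : ∀ h, |(v h 0 : ℝ) + α * v h 1 + α ^ 2 * v h 2| ≤ B h 0)
    (hw0 : ∀ h, |(w h 0 : ℝ) + α * w h 1 + α ^ 2 * w h 2| ≤ B h 0)
    (hv : ∀ h e, e ≠ 0 → |(v h e : ℝ)| ≤ B h e) (hw : ∀ h e, e ≠ 0 → |(w h e : ℝ)| ≤ B h e)
    (E : Fin m × Fin 3 →₀ ℕ) :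
    |((coeff E (pencil r a v w) : ℤ) : ℝ)| * ∏ h, B h 0 ^ E (h, 0) ≤
      ∑ J ∈ multiTernaryExp r, |c J| * (3 ^ (∑ h, r h) * ∏ h, ∏ e, B h e ^ J h e) := by
  set y : Fin m → Fin 3 → MvPolynomial (Fin m × Fin 3) ℝ := fun h e =>
    map (Int.castRingHom ℝ) (pencilVar v w h e) with hy
  have hmap : map (Int.castRingHom ℝ) (pencil r a v w) =
      ∑ J ∈ multiTernaryExp r, c J • ∏ h, ((y h 0 + α • y h 1 + α ^ 2 • y h 2) ^ J h 0 *
        y h 1 ^ J h 1 * y h 2 ^ J h 2) := by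
    rw [← hac y, pencil]
    simp [map_sum, map_prod, hy]
  have hlin : ∀ h, Majorized (y h 0 + α • y h 1 + α ^ 2 • y h 2)
      (X (h, 0) + C (B h 0) * X (h, 1) + C (B h 0) * X (h, 2)) := by
    intro h
    have h1 : y h 0 + α • y h 1 + α ^ 2 • y h 2 =
        X (h, 0) + C ((v h 0 : ℝ) + α * v h 1 + α ^ 2 * v h 2) * X (h, 1) +
          C ((w h 0 : ℝ) + α * w h 1 + α ^ 2 * w h 2) * X (h, 2) := by
      simp only [hy, pencilVar, smul_eq_C_mul]
      simp only [map_add, map_mul, map_X, map_zero, map_pow, if_true,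
        one_ne_zero, if_false, (by decide : (2 : Fin 3) ≠ 0), eq_intCast, map_intCast]
      ring
    rw [h1]
    exact ((Majorized.X _).add ((Majorized.C (hv0 h)).mul (Majorized.X _))).add
      ((Majorized.C (hw0 h)).mul (Majorized.X _))
  have hne : ∀ h e, e ≠ 0 → Majorized (y h e) (C (B h e) * X (h, 1) + C (B h e) * X (h, 2)) := by
    intro h e he
    have h1 : y h e = C (v h e : ℝ) * X (h, 1) + C (w h e : ℝ) * X (h, 2) := by
      simp [hy, pencilVar, he]
    rw [h1]
    exact ((Majorized.C (hv h e he)).mul (Majorized.X _)).add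
      ((Majorized.C (hw h e he)).mul (Majorized.X _))
  have hmaj : Majorized (map (Int.castRingHom ℝ) (pencil r a v w))
      (∑ J ∈ multiTernaryExp r, C |c J| * ∏ h,
        ((X (h, 0) + C (B h 0) * X (h, 1) + C (B h 0) * X (h, 2)) ^ J h 0 *
        (C (B h 1) * X (h, 1) + C (B h 1) * X (h, 2)) ^ J h 1 *
        (C (B h 2) * X (h, 1) + C (B h 2) * X (h, 2)) ^ J h 2)) := by
    rw [hmap]
    refine Majorized.sum _ fun J _ => ?_
    rw [smul_eq_C_mul]
    exact (Majorized.C le_rfl).mul (Majorized.prod _ fun h _ => (((hlin h).pow _).mul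
      ((hne h 1 (by decide)).pow _)).mul ((hne h 2 (by decide)).pow _))
  set ρ : Fin m × Fin 3 → ℝ := fun x => if x.2 = 0 then B x.1 0 else 1 with hρ
  have hρ0 : ∀ x, 0 ≤ ρ x := fun x => by
    simp only [hρ]
    split_ifs
    · exact hB _ _
    · exact zero_le_one
  have key := hmaj.coeff_mul_prod_le hρ0 E
  rw [coeff_map, Finsupp.prod_fintype _ _ (fun _ => pow_zero _), Fintype.prod_prod_type] at key
  simp only [Fin.prod_univ_three, hρ, if_true, one_ne_zero, if_false, one_pow, mul_one,
    (by decide : (2 : Fin 3) ≠ 0), eq_intCast] at key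
  refine key.trans ?_
  rw [map_sum]
  refine sum_le_sum fun J hJ => ?_
  simp only [map_mul, map_prod, map_pow, map_add, eval_C, eval_X, if_true, one_ne_zero, if_false,
    (by decide : (2 : Fin 3) ≠ 0), mul_one]
  refine mul_le_mul_of_nonneg_left ?_ (abs_nonneg _)
  rw [← prod_pow_eq_pow_sum, ← prod_mul_distrib]
  refine prod_le_prod (fun h _ => ?_) fun h _ => ?_
  · have := hB h 0
    have := hB h 1
    have := hB h 2
    positivity
  · have h0 := hB h 0
    have h1 := hB h 1
    have h2 := hB h 2
    have hs := mem_ternaryExp.mp (Fintype.mem_piFinset.mp hJ h)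
    rw [Fin.prod_univ_three]
    calc (B h 0 + B h 0 + B h 0) ^ J h 0 * (B h 1 + B h 1) ^ J h 1 * (B h 2 + B h 2) ^ J h 2
        ≤ (3 * B h 0) ^ J h 0 * (3 * B h 1) ^ J h 1 * (3 * B h 2) ^ J h 2 := by
          gcongr <;> linarith
      _ = _ := by
          rw [← hs, pow_add, pow_add, mul_pow, mul_pow, mul_pow]
          ring

end Pencil

section Specialisation

open MvPolynomial Finset

variable {m : ℕ}

/-- The part of a multihomogeneous form with exponents `s` in the last variables, dehomogenised. -/
noncomputable def bottomPart (r : Fin m → ℕ) (a : (Fin m → Fin 3 → ℕ) → ℤ) (s : Fin m → ℕ) :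
    MvPolynomial (Fin m) ℤ :=
  ∑ i ∈ multiTernaryExp r with ∀ h, i h 2 = s h,
    monomial (Finsupp.equivFunOnFinite.symm fun h => i h 0) (a i)

/-- The images of the variables in `pencil_specialisation`. -/
noncomputable def specVar (v w : Fin m → Fin 3 → ℤ) (x : Fin m × Fin 3) :
    MvPolynomial (Fin m) (MvPolynomial (Fin m) ℚ) :=
  ![X x.1,
    C (C ((v x.1 1 * w x.1 2 - v x.1 2 * w x.1 1 : ℤ) : ℚ)⁻¹ *
      (C (w x.1 2 : ℚ) - C (w x.1 1 : ℚ) * X x.1)),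
    C (C ((v x.1 1 * w x.1 2 - v x.1 2 * w x.1 1 : ℤ) : ℚ)⁻¹ *
      (C (v x.1 1 : ℚ) * X x.1 - C (v x.1 2 : ℚ)))] x.2

lemma coeff_eval₂Hom_specVar_eq_zero {v w : Fin m → Fin 3 → ℤ}
    {p : MvPolynomial (Fin m × Fin 3) ℤ} {E : Fin m →₀ ℕ}
    (hE : ∀ F : Fin m × Fin 3 →₀ ℕ, (∀ h, F (h, 0) = E h) → coeff F p = 0) :
    coeff E (eval₂Hom (Int.castRingHom _) (specVar v w) p) = 0 := by
  rw [coe_eval₂Hom, eval₂_eq', coeff_sum]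
  refine sum_eq_zero fun F hF => ?_
  obtain ⟨k, hk⟩ : ∃ k : MvPolynomial (Fin m) ℚ, ∏ x, specVar v w x ^ F x =
      C k * monomial (Finsupp.equivFunOnFinite.symm fun h => F (h, 0)) 1 := by
    have h1 : ∀ h, ∃ k : MvPolynomial (Fin m) ℚ, ∏ e, specVar v w (h, e) ^ F (h, e) =
        C k * X h ^ F (h, 0) := by
      intro h
      rw [Fin.prod_univ_three]
      simp only [specVar, Matrix.cons_val_zero, Matrix.cons_val_one, Matrix.cons_val, ← C_pow]
      rw [mul_assoc, ← C_mul, mul_comm]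
      exact ⟨_, rfl⟩
    choose k hk using h1
    refine ⟨∏ h, k h, ?_⟩
    rw [Fintype.prod_prod_type, prod_congr rfl fun h _ => hk h, prod_mul_distrib, map_prod,
      monomial_eq, C_1, one_mul, Finsupp.prod_fintype _ _ fun _ => pow_zero _]
    rfl
  have hFE : (Finsupp.equivFunOnFinite.symm fun h => F (h, 0)) ≠ E := by
    rintro rfl
    exact mem_support_iff.mp hF (hE F fun _ => rfl)
  rw [hk, eq_intCast, ← map_intCast (C : MvPolynomial (Fin m) ℚ →+* _), coeff_C_mul, coeff_C_mul,
    coeff_monomial, if_neg hFE, mul_zero, mul_zero]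

lemma eval₂Hom_specVar_pencil {v w x : Fin m → Fin 3 → ℤ} (hx : ∀ h, x h 0 ≠ 0)
    (hxv : ∀ h, x h 0 * v h 0 + x h 1 * v h 1 + x h 2 * v h 2 = 0)
    (hxw : ∀ h, x h 0 * w h 0 + x h 1 * w h 1 + x h 2 * w h 2 = 0)
    (hdet : ∀ h, v h 1 * w h 2 - v h 2 * w h 1 ≠ 0) (r : Fin m → ℕ)
    (a : (Fin m → Fin 3 → ℕ) → ℤ) :
    eval₂Hom (Int.castRingHom _) (specVar v w) (pencil r a v w) =
      ∑ i ∈ multiTernaryExp r, C (monomial (Finsupp.equivFunOnFinite.symm fun h => i h 2)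
        (a i : ℚ)) * ∏ h, (X h + C (C (-(x h 1 : ℚ) / x h 0) - C ((x h 2 : ℚ) / x h 0) * X h)) ^
          i h 0 := by
  have hvar : ∀ h, ∀ y : Fin 3 → ℕ,
      ∏ e, (eval₂Hom (Int.castRingHom _) (specVar v w) (pencilVar v w h e)) ^ y e =
      C (X h ^ y 2) *
        (X h + C (C (-(x h 1 : ℚ) / x h 0) - C ((x h 2 : ℚ) / x h 0) * X h)) ^ y 0 := by
    intro h y
    have hD : ((v h 1 * w h 2 - v h 2 * w h 1 : ℤ) : ℚ) ≠ 0 := by exact_mod_cast hdet h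
    have hx0 : (x h 0 : ℚ) ≠ 0 := by exact_mod_cast hx h
    have ev : (x h 0 : ℚ) * v h 0 + x h 1 * v h 1 + x h 2 * v h 2 = 0 := by exact_mod_cast hxv h
    have ew : (x h 0 : ℚ) * w h 0 + x h 1 * w h 1 + x h 2 * w h 2 = 0 := by exact_mod_cast hxw h
    set D : ℚ := ((v h 1 * w h 2 - v h 2 * w h 1 : ℤ) : ℚ) with hDdef
    have hDv : D = v h 1 * w h 2 - v h 2 * w h 1 := by rw [hDdef]; push_cast; ring
    have hcast : ∀ n : ℤ, ((n : ℤ) : MvPolynomial (Fin m) (MvPolynomial (Fin m) ℚ)) =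
        C (C (n : ℚ)) := fun n => by simp
    have hcomb : ∀ p q : ℤ, eval₂Hom (Int.castRingHom _) (specVar v w)
        (C p * X (h, 1) + C q * X (h, 2)) =
          C (C ((p * w h 2 - q * v h 2) / D) + C ((q * v h 1 - p * w h 1) / D) * X h) := by
      intro p q
      have hC : ∀ n : ℤ, eval₂Hom (Int.castRingHom _) (specVar v w) (C n) = C (C (n : ℚ)) :=
        fun n => by rw [coe_eval₂Hom, eval₂_C, eq_intCast, hcast]
      simp only [map_add, map_mul, hC, eval₂Hom_X', specVar,
        Matrix.cons_val_one, Matrix.cons_val, ← hDdef, div_eq_mul_inv, map_sub]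
      ring
    have e1 : eval₂Hom (Int.castRingHom _) (specVar v w) (pencilVar v w h 1) = 1 := by
      have h1 : (v h 1 * w h 2 - w h 1 * v h 2 : ℚ) = D := by rw [hDv]; ring
      rw [pencilVar, if_neg one_ne_zero, zero_add, hcomb, mul_comm (w h 1 : ℚ) (v h 1), sub_self,
        zero_div, h1, div_self hD]
      simp
    have e2 : eval₂Hom (Int.castRingHom _) (specVar v w) (pencilVar v w h 2) = C (X h) := by
      have h1 : (w h 2 * v h 1 - v h 2 * w h 1 : ℚ) = D := by rw [hDv]; ring
      rw [pencilVar, if_neg (by decide), zero_add, hcomb, mul_comm (w h 2 : ℚ) (v h 2), sub_self,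
        zero_div, h1, div_self hD]
      simp
    have e0 : eval₂Hom (Int.castRingHom _) (specVar v w) (pencilVar v w h 0) =
        X h + C (C (-(x h 1 : ℚ) / x h 0) - C ((x h 2 : ℚ) / x h 0) * X h) := by
      have h1 : ((v h 0 : ℚ) * w h 2 - w h 0 * v h 2) / D = -(x h 1 : ℚ) / x h 0 := by
        rw [div_eq_div_iff hD hx0, hDv]
        linear_combination (w h 2 : ℚ) * ev - (v h 2 : ℚ) * ew
      have h2 : ((w h 0 : ℚ) * v h 1 - v h 0 * w h 1) / D = -((x h 2 : ℚ) / x h 0) := by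
        rw [← neg_div, div_eq_div_iff hD hx0, hDv]
        linear_combination (v h 1 : ℚ) * ew - (w h 1 : ℚ) * ev
      rw [pencilVar, if_pos rfl, add_assoc, map_add, hcomb, h1, h2, coe_eval₂Hom, eval₂_X,
        map_neg, neg_mul, ← sub_eq_add_neg]
      rfl
    rw [Fin.prod_univ_three, e0, e1, e2, one_pow, mul_one, ← C_pow, mul_comm]
  rw [pencil, map_sum]
  refine sum_congr rfl fun i _ => ?_
  simp only [map_mul, map_prod, map_pow]
  rw [prod_congr rfl fun h _ => hvar h (i h), prod_mul_distrib, ← mul_assoc]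
  congr 1
  rw [← map_prod, coe_eval₂Hom, eval₂_C, eq_intCast,
    ← map_intCast (C : MvPolynomial (Fin m) ℚ →+* MvPolynomial (Fin m) (MvPolynomial (Fin m) ℚ)),
    ← C_mul]
  congr 1
  rw [monomial_eq, Finsupp.prod_fintype _ _ fun _ => pow_zero _, map_intCast]
  rfl

/-- If the pencil of a form vanishes to high order, so does its bottom part at `-x₁ / x₀`. -/
lemma coeff_translate_bottomPart_eq_zero {v w x : Fin m → Fin 3 → ℤ} (hx : ∀ h, x h 0 ≠ 0)
    (hxv : ∀ h, x h 0 * v h 0 + x h 1 * v h 1 + x h 2 * v h 2 = 0)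
    (hxw : ∀ h, x h 0 * w h 0 + x h 1 * w h 1 + x h 2 * w h 2 = 0)
    (hdet : ∀ h, v h 1 * w h 2 - v h 2 * w h 1 ≠ 0) {r : Fin m → ℕ}
    {a : (Fin m → Fin 3 → ℕ) → ℤ} {s : Fin m → ℕ}
    (hs : ∀ i ∈ multiTernaryExp r, a i ≠ 0 → (∀ h, i h 2 ≤ s h) → ∀ h, i h 2 = s h)
    {E : Fin m →₀ ℕ} (hE : ∀ F : Fin m × Fin 3 →₀ ℕ, (∀ h, F (h, 0) = E h) →
      coeff F (pencil r a v w) = 0) :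
    coeff E (translate (fun h => ((-x h 1 : ℤ) : ℚ) / x h 0)
      (map (Int.castRingHom ℚ) (bottomPart r a s))) = 0 := by
  classical
  have h0 := coeff_eval₂Hom_specVar_eq_zero (v := v) (w := w) hE
  rw [eval₂Hom_specVar_pencil hx hxv hxw hdet, coeff_sum] at h0
  have h1 := congrArg (coeff (Finsupp.equivFunOnFinite.symm s)) h0
  rw [coeff_sum, coeff_zero] at h1
  rw [← h1, bottomPart, map_sum, map_sum, coeff_sum, sum_filter]
  refine sum_congr rfl fun i hi => ?_
  rw [coeff_C_mul, coeff_monomial_mul']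
  split_ifs with hc hle hle
  · have hse : (Finsupp.equivFunOnFinite.symm s : Fin m →₀ ℕ) -
        Finsupp.equivFunOnFinite.symm (fun h => i h 2) = 0 := by
      ext h
      simp [hc h]
    rw [hse, map_monomial, ← mul_one ((Int.castRingHom ℚ) (a i)), ← C_mul_monomial, map_mul,
      MvPolynomial.translate, algHom_C, MvPolynomial.algebraMap_eq, coeff_C_mul, eq_intCast]
    congr 1
    rw [← constantCoeff_eq, ← coeff_map, map_prod]
    simp only [map_pow, map_add, map_X, map_C, map_sub, map_mul, constantCoeff_C, constantCoeff_X]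
    rw [monomial_eq, Finsupp.prod_fintype _ _ fun _ => pow_zero _, C_1, one_mul, map_prod]
    simp
  · exact absurd (fun h => (hc h).le) hle
  · by_cases hai : a i = 0
    · simp [hai]
    · exact absurd (hs i hi hai hle) hc
  · rfl

lemma coeff_bottomPart {r : Fin m → ℕ} {a : (Fin m → Fin 3 → ℕ) → ℤ} {s : Fin m → ℕ}
    {i : Fin m → Fin 3 → ℕ} (hi : i ∈ multiTernaryExp r) (his : ∀ h, i h 2 = s h) :
    coeff (Finsupp.equivFunOnFinite.symm fun h => i h 0) (bottomPart r a s) = a i := by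
  classical
  rw [bottomPart, coeff_sum, sum_eq_single i]
  · rw [coeff_monomial, if_pos rfl]
  · intro j hj hji
    rw [coeff_monomial, if_neg]
    intro h
    have h0 := Finsupp.equivFunOnFinite.symm.injective h
    obtain ⟨hj, hjs⟩ := mem_filter.mp hj
    refine hji (funext fun k => funext fun e => ?_)
    have e0 := congrFun h0 k
    have e1 := mem_ternaryExp.mp (Fintype.mem_piFinset.mp hj k)
    have e2 := mem_ternaryExp.mp (Fintype.mem_piFinset.mp hi k)
    have e3 := hjs k
    have e4 := his k
    fin_cases e <;> simp <;> omega
  · exact fun h => absurd (mem_filter.mpr ⟨hi, his⟩) h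

lemma exists_of_coeff_bottomPart_ne_zero {r : Fin m → ℕ} {a : (Fin m → Fin 3 → ℕ) → ℤ}
    {s : Fin m → ℕ} {E : Fin m →₀ ℕ} (hE : coeff E (bottomPart r a s) ≠ 0) :
    ∃ i ∈ multiTernaryExp r, coeff E (bottomPart r a s) = a i ∧ ∀ h, E h = i h 0 := by
  classical
  have hE' := hE
  rw [bottomPart, coeff_sum] at hE'
  obtain ⟨i, hi, hne⟩ := exists_ne_zero_of_sum_ne_zero hE'
  rw [coeff_monomial] at hne
  obtain ⟨hi, his⟩ := mem_filter.mp hi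
  have h1 : (Finsupp.equivFunOnFinite.symm fun h => i h 0) = E := by
    by_contra h
    exact hne (if_neg h)
  exact ⟨i, hi, by rw [← h1, coeff_bottomPart hi his], fun h => by rw [← h1]; rfl⟩

end Specialisation

section HighIndex

open MvPolynomial Finset

/-- An integer point `x` together with two independent integer vectors orthogonal to it whose
coordinates in the basis of forms `y₀ + α y₁ + α² y₂`, `y₁`, `y₂` are at most `x₀ ^ b₀`, `x₀ ^ b₁`,
`x₀ ^ b₂`. -/
structure IsAdmissible (α : ℝ) (b : Fin 3 → ℝ) (x v w : Fin 3 → ℤ) : Prop where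
  pos : 0 < x 0
  coprime : IsCoprime (-x 1) (x 0)
  orth_left : x 0 * v 0 + x 1 * v 1 + x 2 * v 2 = 0
  orth_right : x 0 * w 0 + x 1 * w 1 + x 2 * w 2 = 0
  det : v 1 * w 2 - v 2 * w 1 ≠ 0
  form_left : |(v 0 : ℝ) + α * v 1 + α ^ 2 * v 2| ≤ Real.exp (b 0 * Real.log (x 0))
  form_right : |(w 0 : ℝ) + α * w 1 + α ^ 2 * w 2| ≤ Real.exp (b 0 * Real.log (x 0))
  coord_left : ∀ e, e ≠ 0 → |(v e : ℝ)| ≤ Real.exp (b e * Real.log (x 0))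
  coord_right : ∀ e, e ≠ 0 → |(w e : ℝ)| ≤ Real.exp (b e * Real.log (x 0))

/-- A polynomial with small integer coefficients and large index at `-x₁ / x₀`. -/
lemma exists_polynomial_of_isAdmissible {α : ℝ} (hα : IsAlgebraic ℚ α) {b : Fin 3 → ℝ}
    (hb : ∀ e, |b e| ≤ 2) {δ : ℝ} (hδ : 0 < δ) (hbδ : ∑ e, b e = -δ) :
    ∃ m : ℕ, 0 < m ∧ ∃ C : ℝ, 1 ≤ C ∧ ∀ (r : Fin m → ℕ) (Λ : ℝ) (x v w : Fin m → Fin 3 → ℤ),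
      0 < Λ → (∀ h, 0 < r h) → (∀ h, IsAdmissible α b (x h) (v h) (w h)) →
      (∀ h, Λ ≤ r h * Real.log (x h 0)) → (∀ h, r h * Real.log (x h 0) ≤ (1 + δ / 24) * Λ) →
      (9 * C) ^ (∑ h, r h) ≤ Real.exp (δ * m * Λ / 12) →
      ∃ Q : MvPolynomial (Fin m) ℤ, Q ≠ 0 ∧
        (∀ e, |((coeff e Q : ℤ) : ℝ)| ≤ C ^ ∑ h, r h) ∧
        (∀ e, coeff e Q ≠ 0 → ∀ h, e h ≤ r h) ∧
        ∀ E, coeff E (translate (fun h => ((-x h 1 : ℤ) : ℚ) / x h 0)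
          (map (Int.castRingHom ℚ) Q)) ≠ 0 → δ * m / 48 ≤ ∑ h, (E h : ℝ) * (r h : ℝ)⁻¹ := by
  have hδ6 : δ ≤ 6 := by
    have h1 : |∑ e, b e| ≤ 6 := by
      refine (abs_sum_le_sum_abs _ _).trans ((sum_le_sum fun e _ => hb e).trans ?_)
      norm_num
    rw [hbδ, abs_neg, abs_of_pos hδ] at h1
    exact h1
  obtain ⟨m, hm, C, hC, haux⟩ := exists_auxiliary hα hb (by positivity : 0 < δ / 12) (by linarith)
  refine ⟨m, hm, C, hC, fun r Λ x v w hΛ hr hadm hlow hupp hR => ?_⟩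
  obtain ⟨a, c, hane, habd, hcbd, hc0, hac⟩ := haux r hr
  obtain ⟨i₀, hi₀, hmin⟩ := exists_min_image {i ∈ multiTernaryExp r | a i ≠ 0}
    (fun i => ∑ h, i h 2) (by
      obtain ⟨i, hi, hai⟩ := hane
      exact ⟨i, mem_filter.mpr ⟨hi, hai⟩⟩)
  obtain ⟨hi₀, hai₀⟩ := mem_filter.mp hi₀
  set s : Fin m → ℕ := fun h => i₀ h 2 with hs
  have hCR : (0 : ℝ) ≤ C ^ ∑ h, r h := by positivity
  refine ⟨bottomPart r a s, fun h => hai₀ ?_, fun e => ?_, fun e he h => ?_, fun E hE => ?_⟩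
  · rw [← coeff_bottomPart (a := a) (s := s) hi₀ fun _ => rfl, h, coeff_zero]
  · by_cases he : coeff e (bottomPart r a s) = 0
    · rw [he, Int.cast_zero, abs_zero]
      exact hCR
    · obtain ⟨i, hi, hai, -⟩ := exists_of_coeff_bottomPart_ne_zero he
      rw [hai]
      exact habd i hi
  · obtain ⟨i, hi, -, hei⟩ := exists_of_coeff_bottomPart_ne_zero he
    have := mem_ternaryExp.mp (Fintype.mem_piFinset.mp hi h)
    rw [hei]
    omega
  by_contra! hlt
  refine hE (coeff_translate_bottomPart_eq_zero (fun h => (hadm h).pos.ne')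
    (fun h => (hadm h).orth_left) (fun h => (hadm h).orth_right) (fun h => (hadm h).det)
    (fun i hi hai hle => ?_) fun F hF => ?_)
  · have h1 := hmin i (mem_filter.mpr ⟨hi, hai⟩)
    have h2 := (sum_eq_sum_iff_of_le fun h _ => hle h).mp
      (le_antisymm (sum_le_sum fun h _ => hle h) h1)
    exact fun h => h2 h (mem_univ h)
  by_contra hne
  have hrpos : ∀ h, (0 : ℝ) < r h := fun h => by exact_mod_cast hr h
  have key := abs_coeff_pencil_le hac
    (B := fun h e => Real.exp (b e * Real.log (x h 0))) (fun _ _ => (Real.exp_pos _).le)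
    (fun h => (hadm h).form_left) (fun h => (hadm h).form_right) (fun h => (hadm h).coord_left)
    (fun h => (hadm h).coord_right) F
  have h1 : (1 : ℝ) ≤ |((coeff F (pencil r a v w) : ℤ) : ℝ)| := by
    exact_mod_cast Int.one_le_abs hne
  have h2 : Real.exp (-(δ * m * Λ / 12)) <
      ∏ h, Real.exp (b 0 * Real.log (x h 0)) ^ F (h, 0) := by
    simp_rw [← Real.exp_nat_mul]
    rw [← Real.exp_sum, Real.exp_lt_exp]
    have h3 : ∀ h, -(4 * Λ) * (E h * (r h : ℝ)⁻¹) ≤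
        (F (h, 0) : ℝ) * (b 0 * Real.log (x h 0)) := by
      intro h
      rw [hF]
      have h4 : -2 ≤ b 0 := (abs_le.mp (hb 0)).1
      have h5 : (0 : ℝ) ≤ E h := Nat.cast_nonneg _
      have h6 : Real.log (x h 0) ≤ 2 * Λ * (r h : ℝ)⁻¹ := by
        rw [← div_eq_mul_inv, le_div_iff₀ (hrpos h), mul_comm]
        refine (hupp h).trans ?_
        gcongr
        linarith
      have h7 : 0 ≤ Real.log (x h 0) :=
        Real.log_nonneg (by exact_mod_cast (hadm h).pos)
      have h8 : -(4 * Λ * (r h : ℝ)⁻¹) ≤ b 0 * Real.log (x h 0) := by nlinarith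
      calc _ = (E h : ℝ) * -(4 * Λ * (r h : ℝ)⁻¹) := by ring
        _ ≤ _ := by gcongr
    refine lt_of_lt_of_le ?_ (sum_le_sum fun h _ => h3 h)
    rw [← mul_sum]
    nlinarith
  have h3 : ∀ J ∈ multiTernaryExp r, |c J| * (3 ^ (∑ h, r h) *
      ∏ h, ∏ e, Real.exp (b e * Real.log (x h 0)) ^ J h e) ≤
        C ^ (∑ h, r h) * (3 ^ (∑ h, r h) * Real.exp (-(δ * m * Λ / 6))) := by
    intro J hJ
    by_cases hcJ : c J = 0
    · rw [hcJ, abs_zero, zero_mul]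
      positivity
    refine mul_le_mul (hcbd J hJ) ?_ (by positivity) hCR
    refine mul_le_mul_of_nonneg_left ?_ (by positivity)
    simp_rw [← Real.exp_nat_mul, ← Real.exp_sum]
    rw [Real.exp_le_exp]
    have h4 : ∀ h, ∑ e, (J h e : ℝ) * (b e * Real.log (x h 0)) ≤
        Λ * ((∑ e, b e * J h e) / r h) + δ * Λ / 12 := by
      intro h
      have h5 : |∑ e, b e * J h e| ≤ 2 * r h := by
        have hJs : ∑ e, (J h e : ℝ) = r h := by
          exact_mod_cast (mem_piAntidiag.mp (Fintype.mem_piFinset.mp hJ h)).1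
        rw [← hJs, mul_sum]
        refine (abs_sum_le_sum_abs _ _).trans (sum_le_sum fun e _ => ?_)
        rw [abs_mul, Nat.abs_cast]
        exact mul_le_mul_of_nonneg_right (hb e) (Nat.cast_nonneg _)
      have h6 : (∑ e, b e * J h e) / r h ≤ 2 := by
        rw [div_le_iff₀ (hrpos h)]
        exact (abs_le.mp h5).2
      have h7 : ∑ e, (J h e : ℝ) * (b e * Real.log (x h 0)) =
          (r h * Real.log (x h 0)) * ((∑ e, b e * J h e) / r h) := by
        have := (hrpos h).ne'
        field_simp
        rw [mul_sum]
        exact sum_congr rfl fun e _ => by ring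
      rw [h7]
      have h8 := hlow h
      have h9 := hupp h
      nlinarith
    refine (sum_le_sum fun h _ => h4 h).trans ?_
    rw [sum_add_distrib, ← mul_sum, sum_const, card_univ, Fintype.card_fin, nsmul_eq_mul]
    have h5 := mul_le_mul_of_nonneg_left (hc0 J hJ hcJ) hΛ.le
    rw [hbδ] at h5
    calc _ ≤ Λ * (m * (-δ / 3 + δ / 12)) + m * (δ * Λ / 12) := by gcongr
      _ = _ := by ring
  have h4 := key.trans (sum_le_sum h3)
  rw [sum_const, nsmul_eq_mul] at h4
  have hcT : (#(multiTernaryExp r) : ℝ) ≤ 3 ^ ∑ h, r h := by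
    exact_mod_cast card_multiTernaryExp_le r
  have h5 : Real.exp (-(δ * m * Λ / 12)) < Real.exp (-(δ * m * Λ / 12)) := by
    calc Real.exp (-(δ * m * Λ / 12)) < ∏ h, Real.exp (b 0 * Real.log (x h 0)) ^ F (h, 0) := h2
      _ ≤ |((coeff F (pencil r a v w) : ℤ) : ℝ)| *
          ∏ h, Real.exp (b 0 * Real.log (x h 0)) ^ F (h, 0) :=
          le_mul_of_one_le_left (prod_nonneg fun _ _ => by positivity) h1
      _ ≤ _ := h4
      _ ≤ 3 ^ (∑ h, r h) * (C ^ (∑ h, r h) *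
          (3 ^ (∑ h, r h) * Real.exp (-(δ * m * Λ / 6)))) := by gcongr
      _ = (9 * C) ^ (∑ h, r h) * Real.exp (-(δ * m * Λ / 6)) := by
          rw [(by ring : 9 * C = 3 * 3 * C), mul_pow, mul_pow]
          ring
      _ ≤ Real.exp (δ * m * Λ / 12) * Real.exp (-(δ * m * Λ / 6)) := by gcongr
      _ = _ := by
          rw [← Real.exp_add]
          congr 1
          ring
  exact lt_irrefl _ h5

end HighIndex

section ParametricSubspace

open MvPolynomial Finset

/-- Finite sequences with rapidly decreasing values in a family of unbounded values. -/
lemma exists_decreasing_sequence {β : Type*} {P : β → Prop} {f : β → ℝ}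
    (h : ∀ B : ℝ, ∃ y, P y ∧ B ≤ f y) (K B : ℝ) (m : ℕ) :
    ∃ g : Fin m → β, (∀ i, P (g i)) ∧ (∀ i, B ≤ f (g i)) ∧
      ∀ i j, i < j → K * f (g j) ≤ f (g i) := by
  induction m with
  | zero => exact ⟨Fin.elim0, fun i => i.elim0, fun i => i.elim0, fun i => i.elim0⟩
  | succ m ih =>
    obtain ⟨g, hP, hB, hK⟩ := ih
    obtain ⟨M, hM⟩ := (Set.finite_range fun j => K * f (g j)).bddAbove
    obtain ⟨y, hy, hyB⟩ := h (max B M)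
    refine ⟨Fin.cons y g, fun i => ?_, fun i => ?_, fun i j hij => ?_⟩
    · refine Fin.cases hy (fun i => ?_) i
      exact hP i
    · refine Fin.cases ?_ (fun i => ?_) i
      · exact (le_max_left _ _).trans hyB
      · exact hB i
    · obtain ⟨j, rfl⟩ := Fin.exists_succ_eq.mpr (Fin.ne_zero_of_lt hij)
      rcases Fin.eq_zero_or_eq_succ i with rfl | ⟨i, rfl⟩
      · exact (hM ⟨j, rfl⟩).trans ((le_max_right _ _).trans hyB)
      · exact hK i j (Fin.succ_lt_succ_iff.mp hij)

/-- There are no admissible points of large height. -/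
theorem not_forall_exists_isAdmissible {α : ℝ} (hα : IsAlgebraic ℚ α) {b : Fin 3 → ℝ}
    (hb : ∀ e, |b e| ≤ 2) (hsum : ∑ e, b e < 0) :
    ¬ ∀ B : ℝ, ∃ y : (Fin 3 → ℤ) × (Fin 3 → ℤ) × (Fin 3 → ℤ),
      IsAdmissible α b y.1 y.2.1 y.2.2 ∧ B ≤ Real.log (y.1 0) := by
  intro hub
  obtain ⟨δ, hδ, hbδ⟩ : ∃ δ : ℝ, 0 < δ ∧ ∑ e, b e = -δ := ⟨-∑ e, b e, by linarith, by ring⟩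
  obtain ⟨m, hm, C, hC, hQ⟩ := exists_polynomial_of_isAdmissible hα hb hδ hbδ
  have hm' : (0 : ℝ) < m := by exact_mod_cast hm
  obtain ⟨ω, hω, hroth⟩ := exists_rothBound m (δ * m / 96) (by positivity)
  have hlog : 0 ≤ Real.log (9 * C) := Real.log_nonneg (by linarith)
  set B : ℝ := 1 + 2 / ω + 24 * Real.log (9 * C) / δ + 2 * m * Real.log (9 * C) / ω with hB
  have hB1 : 0 ≤ 2 / ω := by positivity
  have hB2 : 0 ≤ 24 * Real.log (9 * C) / δ := by positivity
  have hB3 : 0 ≤ 2 * m * Real.log (9 * C) / ω := by positivity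
  have hBpos : 0 < B := by linarith
  obtain ⟨g, hP, hBg, hK⟩ := exists_decreasing_sequence hub (2 / ω) B m
  set ℓ : Fin m → ℝ := fun h => Real.log ((g h).1 0) with hℓ
  have hℓB : ∀ h, B ≤ ℓ h := hBg
  have hℓ0 : ∀ h, 0 < ℓ h := fun h => hBpos.trans_le (hℓB h)
  obtain ⟨L, hL⟩ := (Set.finite_range ℓ).bddAbove
  have hL : ∀ h, ℓ h ≤ L := fun h => hL ⟨h, rfl⟩
  have hL0 : 0 < L := (hℓ0 ⟨0, hm⟩).trans_le (hL _)
  set Λ : ℝ := L + 24 * L / δ with hΛ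
  have hΛ1 : L ≤ Λ := by
    have : 0 ≤ 24 * L / δ := by positivity
    linarith
  have hΛ2 : L ≤ δ / 24 * Λ := by
    have : δ / 24 * Λ = δ / 24 * L + L := by
      rw [hΛ]
      field_simp
    have : 0 ≤ δ / 24 * L := by positivity
    linarith
  have hΛ0 : 0 < Λ := hL0.trans_le hΛ1
  set r : Fin m → ℕ := fun h => ⌈Λ / ℓ h⌉₊ with hr
  have hr0 : ∀ h, 0 < r h := fun h => Nat.ceil_pos.mpr (div_pos hΛ0 (hℓ0 h))
  have hlow' : ∀ h, Λ / ℓ h ≤ r h := fun h => Nat.le_ceil _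
  have hlow : ∀ h, Λ ≤ r h * ℓ h := fun h => (div_le_iff₀ (hℓ0 h)).mp (hlow' h)
  have hupp' : ∀ h, r h * ℓ h ≤ Λ + ℓ h := by
    intro h
    have h1 := (Nat.ceil_lt_add_one (div_pos hΛ0 (hℓ0 h)).le).le
    have h2 := mul_le_mul_of_nonneg_right h1 (hℓ0 h).le
    rwa [add_mul, one_mul, div_mul_cancel₀ _ (hℓ0 h).ne'] at h2
  have hupp : ∀ h, r h * ℓ h ≤ (1 + δ / 24) * Λ := fun h => by
    have := hupp' h
    have := hL h
    linarith
  have hupp2 : ∀ h, (r h : ℝ) ≤ 2 * Λ / ℓ h := fun h => by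
    rw [le_div_iff₀ (hℓ0 h)]
    have := hupp' h
    have := hL h
    linarith
  have hR : ((∑ h, r h : ℕ) : ℝ) ≤ m * (2 * Λ / B) := by
    push_cast
    have h1 : ∀ h ∈ (univ : Finset (Fin m)), (r h : ℝ) ≤ 2 * Λ / B := fun h _ =>
      (hupp2 h).trans (div_le_div_of_nonneg_left (by positivity) hBpos (hℓB h))
    refine (sum_le_sum h1).trans ?_
    rw [sum_const, card_univ, Fintype.card_fin, nsmul_eq_mul]
  have hpow : ∀ {t : ℝ}, 2 * m * Real.log (9 * C) ≤ t * B →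
      (9 * C) ^ (∑ h, r h) ≤ Real.exp (t * Λ) := by
    intro t ht
    rw [← Real.exp_log (show (0 : ℝ) < 9 * C by linarith), ← Real.exp_nat_mul, Real.exp_le_exp]
    calc _ ≤ m * (2 * Λ / B) * Real.log (9 * C) := by gcongr
      _ = 2 * m * Real.log (9 * C) * (Λ / B) := by ring
      _ ≤ t * B * (Λ / B) := by gcongr
      _ = t * Λ := by field_simp
  obtain ⟨Q, hQ0, hQc, hQd, hQi⟩ := hQ r Λ (fun h => (g h).1) (fun h => (g h).2.1)
    (fun h => (g h).2.2) hΛ0 hr0 hP hlow hupp (by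
      have h1 : 2 * m * Real.log (9 * C) ≤ δ * m / 12 * B := by
        calc _ = δ * m / 12 * (24 * Real.log (9 * C) / δ) := by field_simp; ring
          _ ≤ δ * m / 12 * B := by gcongr; linarith
      refine (hpow h1).trans_eq ?_
      congr 1
      ring)
  obtain ⟨E, hE, hEle⟩ := hroth r (fun h => -(g h).1 1) (fun h => (g h).1 0) Λ Q hΛ0 hr0
    (fun i j hij => by
      have h1 := hK i j hij
      have h2 : 2 / ℓ i ≤ ω / ℓ j := by
        rw [div_le_div_iff₀ (hℓ0 i) (hℓ0 j)]
        have h3 := mul_le_mul_of_nonneg_left h1 hω.le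
        calc 2 * ℓ j = ω * (2 / ω * ℓ j) := by field_simp
          _ ≤ ω * ℓ i := h3
      calc (r i : ℝ) ≤ 2 * Λ / ℓ i := hupp2 i
        _ = Λ * (2 / ℓ i) := by ring
        _ ≤ Λ * (ω / ℓ j) := by gcongr
        _ = ω * (Λ / ℓ j) := by ring
        _ ≤ _ := by gcongr; exact hlow' j)
    (fun h => (hP h).pos) (fun h => (hP h).coprime) hlow
    (fun h => by
      have h1 : 2 / ω ≤ ℓ h := le_trans (by linarith) (hℓB h)
      refine (hupp2 h).trans ?_
      rw [div_le_iff₀ (hℓ0 h)]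
      have h2 : 2 ≤ ω * ℓ h := by rwa [div_le_iff₀ hω, mul_comm] at h1
      nlinarith)
    hQd
    (fun e => (hQc e).trans ((pow_le_pow_left₀ (by linarith) (by linarith) _).trans
      (hpow (by
        calc _ = ω * (2 * m * Real.log (9 * C) / ω) := by field_simp
          _ ≤ ω * B := by gcongr; linarith))))
    hQ0
  have h1 := hQi E hE
  have h2 : 0 < δ * m := by positivity
  linarith

end ParametricSubspace

section Liouville

open scoped IntermediateField

/-- Liouville's inequality for the values at `α` of quadratic integer polynomials. -/
lemma exists_liouville_bound {α : ℝ} (hα : IsAlgebraic ℚ α) :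
    ∃ (D : ℕ) (c : ℝ), 0 < c ∧ ∀ (y : Fin 3 → ℤ) (H : ℝ),
      (y 0 : ℝ) + α * y 1 + α ^ 2 * y 2 ≠ 0 → (∀ e, |(y e : ℝ)| ≤ H) →
      1 ≤ c * H ^ D * |(y 0 : ℝ) + α * y 1 + α ^ 2 * y 2| := by
  classical
  have hint : IsIntegral ℚ α := hα.isIntegral
  have : FiniteDimensional ℚ ℚ⟮α⟯ := IntermediateField.adjoin.finiteDimensional hint
  set g : ℚ⟮α⟯ := IntermediateField.AdjoinSimple.gen ℚ α with hg
  have hgα : algebraMap ℚ⟮α⟯ ℝ g = α := IntermediateField.AdjoinSimple.algebraMap_gen ℚ α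
  have hgalg : IsAlgebraic ℤ g :=
    (IsFractionRing.isAlgebraic_iff ℤ ℚ _).2 (Algebra.IsAlgebraic.isAlgebraic g)
  obtain ⟨A, hA0, hA⟩ := hgalg.exists_integral_multiple
  let σ₀ : ℚ⟮α⟯ →ₐ[ℚ] ℂ := (Complex.ofRealAm.restrictScalars ℚ).comp
    (IsScalarTower.toAlgHom ℚ ℚ⟮α⟯ ℝ)
  have hσ₀ : σ₀ g = (α : ℂ) := by
    change ((algebraMap ℚ⟮α⟯ ℝ g : ℝ) : ℂ) = _
    rw [hgα]
  obtain ⟨M, hM1, hM⟩ : ∃ M : ℝ, 1 ≤ M ∧ ∀ σ : ℚ⟮α⟯ →ₐ[ℚ] ℂ, ‖σ g‖ ≤ M := by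
    refine ⟨1 + ∑ σ : ℚ⟮α⟯ →ₐ[ℚ] ℂ, ‖σ g‖, ?_, fun σ => ?_⟩
    · have : 0 ≤ ∑ σ : ℚ⟮α⟯ →ₐ[ℚ] ℂ, ‖σ g‖ := Finset.sum_nonneg fun _ _ => norm_nonneg _
      linarith
    · have := Finset.single_le_sum (f := fun σ : ℚ⟮α⟯ →ₐ[ℚ] ℂ => ‖σ g‖)
        (fun _ _ => norm_nonneg _) (Finset.mem_univ σ)
      linarith
  set D := (Finset.univ.erase σ₀).card with hD
  set N : ℝ := |(A : ℝ)| ^ 2 * (1 + M + M ^ 2) with hN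
  have hA1 : (0 : ℝ) < |(A : ℝ)| := by
    rw [abs_pos]; exact_mod_cast hA0
  refine ⟨D, |(A : ℝ)| ^ 2 * N ^ D, by positivity, fun y H hy hH => ?_⟩
  have hH0 : 0 ≤ H := (abs_nonneg _).trans (hH 0)
  set t : ℚ⟮α⟯ := (A : ℚ⟮α⟯) ^ 2 * (y 0 + y 1 * g + y 2 * g ^ 2) with ht
  have hAg : IsIntegral ℤ ((A : ℚ⟮α⟯) * g) := by
    simpa [zsmul_eq_mul] using hA
  have htint : IsIntegral ℤ t := by
    have h1 : t = (algebraMap ℤ ℚ⟮α⟯ (A ^ 2 * y 0)) + algebraMap ℤ ℚ⟮α⟯ (A * y 1) * (A * g) +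
        algebraMap ℤ ℚ⟮α⟯ (y 2) * (A * g) ^ 2 := by
      simp only [ht, eq_intCast]
      push_cast
      ring
    rw [h1]
    exact (isIntegral_algebraMap.add (isIntegral_algebraMap.mul hAg)).add
      (isIntegral_algebraMap.mul (hAg.pow 2))
  have hσt : ∀ σ : ℚ⟮α⟯ →ₐ[ℚ] ℂ,
      σ t = (A : ℂ) ^ 2 * (y 0 + y 1 * σ g + y 2 * (σ g) ^ 2) := fun σ => by
    simp [ht]
  have hσ₀t : ‖σ₀ t‖ = |(A : ℝ)| ^ 2 * |(y 0 : ℝ) + α * y 1 + α ^ 2 * y 2| := by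
    have : σ₀ t = (((A : ℝ) ^ 2 * ((y 0 : ℝ) + α * y 1 + α ^ 2 * y 2) : ℝ) : ℂ) := by
      rw [hσt, hσ₀]
      push_cast
      ring
    rw [this, Complex.norm_real, Real.norm_eq_abs, abs_mul, abs_pow]
  have ht0 : t ≠ 0 := by
    intro h0
    rw [h0, map_zero, norm_zero] at hσ₀t
    exact (mul_pos (pow_pos hA1 2) (abs_pos.2 hy)).ne hσ₀t
  obtain ⟨n, hn⟩ := IsIntegrallyClosed.isIntegral_iff.1 (Algebra.isIntegral_norm ℚ htint)
  have hn0 : n ≠ 0 := by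
    rintro rfl
    rw [map_zero] at hn
    exact ht0 (Algebra.norm_eq_zero_iff.1 hn.symm)
  have hprod := Algebra.norm_eq_prod_embeddings ℚ ℂ t
  rw [← hn] at hprod
  have h1 : (1 : ℝ) ≤ ∏ σ : ℚ⟮α⟯ →ₐ[ℚ] ℂ, ‖σ t‖ := by
    rw [← norm_prod, ← hprod]
    simp only [eq_intCast, map_intCast, Complex.norm_intCast]
    exact_mod_cast Int.one_le_abs hn0
  rw [← Finset.mul_prod_erase _ _ (Finset.mem_univ σ₀)] at h1
  have h2 : ∏ σ ∈ Finset.univ.erase σ₀, ‖σ t‖ ≤ (N * H) ^ D := by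
    rw [hD]
    rw [← Finset.prod_const]
    refine Finset.prod_le_prod (fun _ _ => norm_nonneg _) fun σ _ => ?_
    rw [hσt, norm_mul, norm_pow, Complex.norm_intCast, hN, mul_assoc]
    refine mul_le_mul_of_nonneg_left ?_ (by positivity)
    have hb : ∀ e, ‖((y e : ℤ) : ℂ)‖ ≤ H := fun e => by
      rw [Complex.norm_intCast]; exact hH e
    calc ‖(y 0 : ℂ) + y 1 * σ g + y 2 * (σ g) ^ 2‖
        ≤ ‖(y 0 : ℂ)‖ + ‖(y 1 : ℂ)‖ * ‖σ g‖ + ‖(y 2 : ℂ)‖ * ‖σ g‖ ^ 2 := by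
          refine (norm_add₃_le).trans ?_
          rw [norm_mul, norm_mul, norm_pow]
      _ ≤ H + H * M + H * M ^ 2 := by
          gcongr
          · exact hb 0
          · exact hb 1
          · exact hM σ
          · exact hb 2
          · exact hM σ
      _ = (1 + M + M ^ 2) * H := by ring
  rw [hσ₀t] at h1
  calc (1 : ℝ) ≤ _ := h1
    _ ≤ |(A : ℝ)| ^ 2 * |(y 0 : ℝ) + α * y 1 + α ^ 2 * y 2| * (N * H) ^ D := by gcongr
    _ = _ := by rw [mul_pow]; ring

end Liouville

section LatticePair

open Finset

/-- In a plane lattice of covolume `X`, pigeonhole gives a nonzero point in every box of area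
exceeding `X`. -/
lemma exists_ne_zero_dvd_of_lt_mul {X : ℕ} (hX : 0 < X) (a b : ℤ) {m n : ℕ} (h : X < m * n) :
    ∃ y z : ℤ, (y ≠ 0 ∨ z ≠ 0) ∧ (X : ℤ) ∣ a * y + b * z ∧ y.natAbs < m ∧ z.natAbs < n := by
  have : NeZero X := ⟨hX.ne'⟩
  obtain ⟨p, hp, q, hq, hpq, he⟩ := exists_ne_map_eq_of_card_lt_of_maps_to
    (s := range m ×ˢ range n) (t := (univ : Finset (ZMod X)))
    (f := fun p => ((a * (p.1 : ℤ) + b * (p.2 : ℤ) : ℤ) : ZMod X))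
    (by simpa [ZMod.card] using h) (fun _ _ => mem_univ _)
  simp only [mem_product, mem_range] at hp hq
  refine ⟨(p.1 : ℤ) - q.1, (p.2 : ℤ) - q.2, ?_, ?_, by lia, by lia⟩
  · by_contra! h0
    exact hpq (Prod.ext (by lia) (by lia))
  · have h1 := (ZMod.intCast_eq_intCast_iff_dvd_sub _ _ _).1 he.symm
    convert h1 using 1
    ring

/-- Two independent points of a plane lattice of covolume `X`, with the first coordinates
separated by `T`. -/
lemma exists_lattice_pair {X : ℕ} (hX : 0 < X) (a b : ℤ) (hab : IsCoprime a X) {T : ℝ}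
    (hT : 0 < T) (hTX : T ≤ X) :
    ∃ v₁ v₂ w₁ w₂ : ℤ, (X : ℤ) ∣ a * v₁ + b * v₂ ∧ (X : ℤ) ∣ a * w₁ + b * w₂ ∧
      |(w₁ : ℝ)| < T ∧ T ≤ |(v₁ : ℝ)| ∧ |(v₂ : ℝ)| < |(w₂ : ℝ)| ∧
      |(v₁ : ℝ)| * |(w₂ : ℝ)| ≤ X := by
  classical
  have hw : ∃ n : ℕ, ∃ y z : ℤ, (y ≠ 0 ∨ z ≠ 0) ∧ (X : ℤ) ∣ a * y + b * z ∧ |(y : ℝ)| < T ∧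
      z.natAbs = n :=
    ⟨X, 0, X, Or.inr (by lia), by simp, by simpa using hT, by simp⟩
  obtain ⟨w₁, w₂, hw0, hwd, hwT, hwn⟩ := Nat.find_spec hw
  have hwmin : ∀ y z : ℤ, (y ≠ 0 ∨ z ≠ 0) → (X : ℤ) ∣ a * y + b * z → |(y : ℝ)| < T →
      w₂.natAbs ≤ z.natAbs := fun y z h1 h2 h3 => by
    rw [hwn]
    exact Nat.find_min' hw ⟨y, z, h1, h2, h3, rfl⟩
  have hw2 : w₂ ≠ 0 := by
    rintro rfl
    have h1 : (X : ℤ) ∣ w₁ := hab.symm.dvd_of_dvd_mul_left (by simpa using hwd)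
    have h2 : (X : ℤ) ≤ |w₁| := Int.le_of_dvd (abs_pos.2 (by simpa using hw0)) ((dvd_abs _ _).2 h1)
    have h3 : (X : ℝ) ≤ |(w₁ : ℝ)| := by exact_mod_cast h2
    linarith
  have hv : ∃ n : ℕ, ∃ y z : ℤ, (y ≠ 0 ∨ z ≠ 0) ∧ (X : ℤ) ∣ a * y + b * z ∧
      z.natAbs < w₂.natAbs ∧ y.natAbs = n :=
    ⟨X, X, 0, Or.inl (by lia), by simp, by lia, by simp⟩
  obtain ⟨v₁, v₂, hv0, hvd, hvw, hvn⟩ := Nat.find_spec hv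
  have hvmin : ∀ y z : ℤ, (y ≠ 0 ∨ z ≠ 0) → (X : ℤ) ∣ a * y + b * z → z.natAbs < w₂.natAbs →
      v₁.natAbs ≤ y.natAbs := fun y z h1 h2 h3 => by
    rw [hvn]
    exact Nat.find_min' hv ⟨y, z, h1, h2, h3, rfl⟩
  refine ⟨v₁, v₂, w₁, w₂, hvd, hwd, hwT, ?_, ?_, ?_⟩
  · by_contra! h
    have := hwmin v₁ v₂ hv0 hvd h
    lia
  · rw [← Int.cast_abs, ← Int.cast_abs, Int.abs_eq_natAbs, Int.abs_eq_natAbs]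
    exact_mod_cast hvw
  · by_contra! h
    have h1 : X < v₁.natAbs * w₂.natAbs := by
      rw [← Int.cast_abs, ← Int.cast_abs, Int.abs_eq_natAbs, Int.abs_eq_natAbs] at h
      exact_mod_cast h
    obtain ⟨y, z, h2, h3, h4, h5⟩ := exists_ne_zero_dvd_of_lt_mul hX a b h1
    have := hvmin y z h2 h3 h5
    lia

end LatticePair

section Approximation

/-- Orthogonality to a good approximation of `(1, α, α²)` makes the form
`y₀ + α y₁ + α² y₂` small. -/
lemma abs_form_le_of_orthogonal {α c S : ℝ} {x y : Fin 3 → ℤ} (hx : 0 < x 0)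
    (h1 : |x 0 * α - x 1| ≤ c / x 0) (h2 : |x 0 * α ^ 2 - x 2| ≤ c / x 0)
    (h : x 0 * y 0 + x 1 * y 1 + x 2 * y 2 = 0) (hy1 : |(y 1 : ℝ)| ≤ S) (hy2 : |(y 2 : ℝ)| ≤ S) :
    |(y 0 : ℝ) + α * y 1 + α ^ 2 * y 2| ≤ 2 * c * S / (x 0) ^ 2 := by
  have hX : (0 : ℝ) < x 0 := by exact_mod_cast hx
  have hR : (x 0 : ℝ) * y 0 + x 1 * y 1 + x 2 * y 2 = 0 := by exact_mod_cast h
  have he : (y 0 : ℝ) + α * y 1 + α ^ 2 * y 2 =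
      ((x 0 * α - x 1) * y 1 + (x 0 * α ^ 2 - x 2) * y 2) / x 0 := by
    rw [eq_div_iff hX.ne']
    linear_combination hR
  rw [he, abs_div, abs_of_pos hX, div_le_iff₀ hX]
  have hc : 0 ≤ c / x 0 := (abs_nonneg _).trans h1
  calc _ ≤ |x 0 * α - x 1| * |(y 1 : ℝ)| + |x 0 * α ^ 2 - x 2| * |(y 2 : ℝ)| := by
        rw [← abs_mul, ← abs_mul]
        exact abs_add_le _ _
    _ ≤ c / x 0 * S + c / x 0 * S := by gcongr
    _ = _ := by field_simp; ring

/-- A good integer approximation of `(1, α, α²)` of large height has two independent orthogonal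
integer vectors, the first of which is neither too short nor too long in its middle coordinate. -/
lemma exists_orthogonal_pair {α : ℝ} (hα : IsAlgebraic ℚ α) {c : ℝ}
    (hno : ∀ y : Fin 3 → ℤ, (y 0 : ℝ) + α * y 1 + α ^ 2 * y 2 = 0 → y = 0) :
    ∃ δ : ℝ, 0 < δ ∧ δ ≤ 1 / 2 ∧ ∃ B : ℝ, ∀ x : Fin 3 → ℤ, 0 < x 0 → B ≤ x 0 →
      IsCoprime (x 1) (x 0) → |x 0 * α - x 1| ≤ c / x 0 → |x 0 * α ^ 2 - x 2| ≤ c / x 0 →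
      ∃ v w : Fin 3 → ℤ, x 0 * v 0 + x 1 * v 1 + x 2 * v 2 = 0 ∧
        x 0 * w 0 + x 1 * w 1 + x 2 * w 2 = 0 ∧
        |(w 1 : ℝ)| < |(v 1 : ℝ)| ∧ |(v 2 : ℝ)| < |(w 2 : ℝ)| ∧
        |(v 1 : ℝ)| * |(w 2 : ℝ)| ≤ x 0 ∧
        Real.exp (δ * Real.log (x 0)) ≤ |(v 1 : ℝ)| ∧
        |(v 1 : ℝ)| ≤ Real.exp ((1 - δ) * Real.log (x 0)) := by
  obtain ⟨D, c', hc', hL⟩ := exists_liouville_bound hα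
  set M : ℝ := 1 + 2 * |c| + |α| + α ^ 2 with hM
  have hM1 : 1 ≤ M := by
    have := abs_nonneg c
    have := abs_nonneg α
    have := sq_nonneg α
    linarith
  refine ⟨1 / (D + 2), by positivity, ?_, 2 + 2 * |c| * c' * M ^ D, ?_⟩
  · gcongr
    have : (0 : ℝ) ≤ D := by positivity
    linarith
  set δ : ℝ := 1 / (D + 2) with hδ
  have hδD : δ * (D + 1) ≤ 1 := by
    rw [hδ, div_mul_eq_mul_div, div_le_one (by positivity)]
    linarith
  have hδ0 : 0 < δ := by positivity
  intro x hx hB hcop h1 h2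
  obtain ⟨X, hXx⟩ := Int.eq_ofNat_of_zero_le hx.le
  have hXR : (x 0 : ℝ) = X := by rw [hXx]; simp
  have hX : (0 : ℝ) < x 0 := by exact_mod_cast hx
  have hc0 : 0 ≤ c := by
    have h3 := (abs_nonneg _).trans h1
    by_contra! h4
    exact absurd h3 (not_le.2 (div_neg_of_neg_of_pos h4 hX))
  rw [abs_of_nonneg hc0] at hM hB
  have hX2 : 2 ≤ (x 0 : ℝ) := by
    have : 0 ≤ 2 * c * c' * M ^ D := by positivity
    linarith
  have hℓ : 0 ≤ Real.log (x 0) := Real.log_nonneg (by linarith)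
  have hexp : Real.exp (Real.log (x 0)) = x 0 := Real.exp_log hX
  set T := Real.exp (δ * Real.log (x 0)) with hT
  have hT0 : 0 < T := Real.exp_pos _
  have hT1 : 1 ≤ T := Real.one_le_exp (by positivity)
  have hTX : T ≤ x 0 := by
    rw [← hexp, hT]
    refine Real.exp_le_exp.2 ?_
    have : (0 : ℝ) ≤ D := by positivity
    nlinarith
  have hTD : T ^ (D + 1) ≤ x 0 := by
    rw [hT, ← Real.exp_nat_mul]
    refine (Real.exp_le_exp.2 ?_).trans_eq hexp
    push_cast
    nlinarith
  obtain ⟨v₁, v₂, w₁, w₂, ⟨v₀, hv⟩, ⟨w₀, hw⟩, hw1, hv1, hvw, hmul⟩ :=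
    exists_lattice_pair (X := X) (by lia) (x 1) (x 2) (hXx ▸ hcop) hT0 (hXR ▸ hTX)
  rw [← hXR] at hmul
  have hv10 : 0 < |(v₁ : ℝ)| := hT0.trans_le hv1
  have hwo : x 0 * ![-w₀, w₁, w₂] 0 + x 1 * ![-w₀, w₁, w₂] 1 + x 2 * ![-w₀, w₁, w₂] 2 = 0 := by
    simp [hXx]
    linarith
  refine ⟨![-v₀, v₁, v₂], ![-w₀, w₁, w₂], ?_, hwo, ?_, hvw, hmul, hv1, ?_⟩
  · simp [hXx]
    linarith
  · exact hw1.trans_le hv1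
  change |(v₁ : ℝ)| ≤ _
  by_contra! hlt
  have hw2 : |(w₂ : ℝ)| ≤ T := by
    by_contra! h3
    have h4 : (x 0 : ℝ) < |(v₁ : ℝ)| * |(w₂ : ℝ)| := by
      calc (x 0 : ℝ) = Real.exp ((1 - δ) * Real.log (x 0)) * T := by
            rw [hT, ← Real.exp_add, ← add_mul, sub_add_cancel, one_mul, hexp]
        _ < _ := by gcongr
    linarith
  have hform := abs_form_le_of_orthogonal hx h1 h2 hwo hw1.le hw2
  have hform1 : 2 * c * T / (x 0 : ℝ) ^ 2 ≤ 2 * c * T := div_le_self (by positivity) (by nlinarith)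
  have hne : ((![-w₀, w₁, w₂] 0 : ℤ) : ℝ) + α * (![-w₀, w₁, w₂] 1 : ℤ) +
      α ^ 2 * (![-w₀, w₁, w₂] 2 : ℤ) ≠ 0 := fun h0 => by
    have h5 := congrFun (hno _ h0) 2
    have h6 : w₂ = 0 := h5
    rw [h6, Int.cast_zero, abs_zero] at hvw
    exact absurd hvw (not_lt.2 (abs_nonneg _))
  have hMT : T ≤ M * T := le_mul_of_one_le_left hT0.le hM1
  have hw0 : |((-w₀ : ℤ) : ℝ)| ≤ M * T := by
    have h7 : |((-w₀ : ℤ) : ℝ) + α * w₁ + α ^ 2 * w₂| ≤ 2 * c * T := hform.trans hform1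
    have h8 : |α * w₁| ≤ |α| * T := by rw [abs_mul]; gcongr
    have h9 : |α ^ 2 * w₂| ≤ α ^ 2 * T := by rw [abs_mul, abs_of_nonneg (sq_nonneg α)]; gcongr
    rw [abs_le] at h7 h8 h9 ⊢
    rw [hM]
    constructor <;> nlinarith
  have hLw := hL ![-w₀, w₁, w₂] (M * T) hne (fun e => by
    fin_cases e
    · exact hw0
    · exact hw1.le.trans hMT
    · exact hw2.trans hMT)
  have hfin : 1 ≤ 2 * c * c' * M ^ D / x 0 := by
    calc (1 : ℝ) ≤ _ := hLw
      _ ≤ c' * (M * T) ^ D * (2 * c * T / (x 0 : ℝ) ^ 2) := by gcongr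
      _ = 2 * c * c' * M ^ D * T ^ (D + 1) / (x 0 : ℝ) ^ 2 := by rw [mul_pow, pow_succ]; ring
      _ ≤ 2 * c * c' * M ^ D * x 0 / (x 0 : ℝ) ^ 2 := by gcongr
      _ = _ := by field_simp
  rw [le_div_iff₀ hX] at hfin
  linarith

end Approximation

section SimultaneousApproximation

/-- An orthogonal pair whose first vector has middle coordinate about `x₀ ^ (k κ)` is admissible
for exponents with negative sum. -/
lemma isAdmissible_of_orthogonal_pair {α c δ κ : ℝ} {x v w : Fin 3 → ℤ} {k : ℝ}
    (hx : 1 < x 0) (hcop : IsCoprime (x 1) (x 0)) (h1 : |x 0 * α - x 1| ≤ c / x 0)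
    (h2 : |x 0 * α ^ 2 - x 2| ≤ c / x 0) (hv : x 0 * v 0 + x 1 * v 1 + x 2 * v 2 = 0)
    (hw : x 0 * w 0 + x 1 * w 1 + x 2 * w 2 = 0) (hwv : |(w 1 : ℝ)| < |(v 1 : ℝ)|)
    (hvw : |(v 2 : ℝ)| < |(w 2 : ℝ)|) (hmul : |(v 1 : ℝ)| * |(w 2 : ℝ)| ≤ x 0)
    (hlow : Real.exp (δ * Real.log (x 0)) ≤ |(v 1 : ℝ)|)
    (hupp : |(v 1 : ℝ)| ≤ Real.exp ((1 - δ) * Real.log (x 0)))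
    (hc : 2 * c ≤ Real.exp (κ * Real.log (x 0)))
    (hk1 : Real.exp ((k - 1) * κ * Real.log (x 0)) ≤ |(v 1 : ℝ)|)
    (hk2 : |(v 1 : ℝ)| ≤ Real.exp (k * κ * Real.log (x 0))) :
    IsAdmissible α ![-1 - δ + κ, k * κ, 1 - (k - 1) * κ] x v w := by
  have hX : (0 : ℝ) < x 0 := by exact_mod_cast (by lia : 0 < x 0)
  have hexp : Real.exp (Real.log (x 0)) = x 0 := Real.exp_log hX
  have hw2 : ∀ s, Real.exp (s * Real.log (x 0)) ≤ |(v 1 : ℝ)| →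
      |(w 2 : ℝ)| ≤ Real.exp ((1 - s) * Real.log (x 0)) := fun s hs => by
    have h3 : Real.exp (s * Real.log (x 0)) * |(w 2 : ℝ)| ≤
        Real.exp (s * Real.log (x 0)) * Real.exp ((1 - s) * Real.log (x 0)) := by
      calc _ ≤ |(v 1 : ℝ)| * |(w 2 : ℝ)| := by gcongr
        _ ≤ x 0 := hmul
        _ = _ := by rw [← Real.exp_add, ← add_mul, add_sub_cancel, one_mul, hexp]
    exact le_of_mul_le_mul_left h3 (Real.exp_pos _)
  have hform : ∀ y : Fin 3 → ℤ, x 0 * y 0 + x 1 * y 1 + x 2 * y 2 = 0 →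
      |(y 1 : ℝ)| ≤ Real.exp ((1 - δ) * Real.log (x 0)) →
      |(y 2 : ℝ)| ≤ Real.exp ((1 - δ) * Real.log (x 0)) →
      |(y 0 : ℝ) + α * y 1 + α ^ 2 * y 2| ≤ Real.exp ((-1 - δ + κ) * Real.log (x 0)) :=
    fun y hy hy1 hy2 => by
      refine (abs_form_le_of_orthogonal (by lia) h1 h2 hy hy1 hy2).trans ?_
      rw [div_le_iff₀ (by positivity)]
      calc _ ≤ Real.exp (κ * Real.log (x 0)) * Real.exp ((1 - δ) * Real.log (x 0)) := by gcongr
        _ = Real.exp ((-1 - δ + κ) * Real.log (x 0)) * Real.exp (Real.log (x 0)) ^ 2 := by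
          rw [← Real.exp_nat_mul, ← Real.exp_add, ← Real.exp_add]
          push_cast
          ring_nf
        _ = _ := by rw [hexp]
  refine ⟨by lia, hcop.neg_left, hv, hw, fun h => ?_, hform v hv hupp (hvw.le.trans (hw2 _ hlow)),
    hform w hw (hwv.le.trans hupp) (hw2 _ hlow), fun e he => ?_, fun e he => ?_⟩
  · have h3 : |(v 1 : ℝ)| * |(w 2 : ℝ)| = |(v 2 : ℝ)| * |(w 1 : ℝ)| := by
      rw [← abs_mul, ← abs_mul]
      congr 1
      exact_mod_cast sub_eq_zero.1 h
    have h4 := abs_nonneg (v 2 : ℝ)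
    have h5 := abs_nonneg (w 1 : ℝ)
    nlinarith
  · fin_cases e
    · exact absurd rfl he
    · exact hk2
    · exact hvw.le.trans (hw2 _ hk1)
  · fin_cases e
    · exact absurd rfl he
    · exact hwv.le.trans hk2
    · exact hw2 _ hk1

/-- If an algebraic number and its square have uniformly good simultaneous rational approximations
with the same denominator, then it is at most quadratic. -/
theorem exists_quadratic_relation {α : ℝ} (hα : IsAlgebraic ℚ α) {c : ℝ}
    (h : ∀ B : ℝ, ∃ x : Fin 3 → ℤ, B ≤ x 0 ∧ IsCoprime (x 1) (x 0) ∧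
      |x 0 * α - x 1| ≤ c / x 0 ∧ |x 0 * α ^ 2 - x 2| ≤ c / x 0) :
    ∃ y : Fin 3 → ℤ, y ≠ 0 ∧ (y 0 : ℝ) + α * y 1 + α ^ 2 * y 2 = 0 := by
  by_contra! hno
  obtain ⟨δ, hδ, hδ2, B₀, hpair⟩ := exists_orthogonal_pair hα (c := c)
    (fun y hy => by_contra fun h0 => hno y h0 hy)
  set κ : ℝ := δ / 3 with hκ
  have hκ0 : 0 < κ := by positivity
  have hbound : ∀ k : ℕ, ∃ B : ℝ, (k : ℝ) * κ ≤ 1 → ∀ x v w : Fin 3 → ℤ,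
      IsAdmissible α ![-1 - δ + κ, k * κ, 1 - (k - 1) * κ] x v w → Real.log (x 0) < B := by
    intro k
    by_cases hk : (k : ℝ) * κ ≤ 1
    · have h0 : 0 ≤ (k : ℝ) * κ := by positivity
      have := not_forall_exists_isAdmissible hα
        (b := ![-1 - δ + κ, k * κ, 1 - (k - 1) * κ]) (fun e => by
          rw [abs_le]
          fin_cases e <;> simp <;> constructor <;> linarith)
        (by
          simp [Fin.sum_univ_three]
          linarith)
      push Not at this
      obtain ⟨B, hB⟩ := this
      exact ⟨B, fun _ x v w hxvw => hB (x, v, w) hxvw⟩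
    · exact ⟨0, fun h' => absurd h' hk⟩
  choose B hB using hbound
  set K : ℕ := ⌈(1 - δ) / κ⌉₊
  set S : ℝ := ∑ k ∈ Finset.range (K + 1), |B k|
  have hS : ∀ k ≤ K, B k ≤ S := fun k hk =>
    (le_abs_self _).trans (Finset.single_le_sum (f := fun k => |B k|) (fun _ _ => abs_nonneg _)
      (Finset.mem_range.2 (by lia)))
  obtain ⟨x, hxB, hcop, h1, h2⟩ := h (2 + |B₀| + Real.exp S + Real.exp (2 * |c| / κ))
  have e1 := Real.exp_pos S
  have e2 := Real.exp_pos (2 * |c| / κ)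
  have e3 := abs_nonneg B₀
  have hx1 : 1 < x 0 := by
    have : (1 : ℝ) < x 0 := by linarith
    exact_mod_cast this
  have hX : (0 : ℝ) < x 0 := by exact_mod_cast (by lia : 0 < x 0)
  obtain ⟨v, w, hv, hw, hwv, hvw, hmul, hlow, hupp⟩ :=
    hpair x (by lia) (by linarith [le_abs_self B₀]) hcop h1 h2
  have hℓS : S ≤ Real.log (x 0) := (Real.le_log_iff_exp_le hX).2 (by linarith)
  have hℓc : 2 * |c| / κ ≤ Real.log (x 0) := (Real.le_log_iff_exp_le hX).2 (by linarith)
  have hℓ0 : 0 < Real.log (x 0) := Real.log_pos (by linarith)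
  have hκℓ : 0 < κ * Real.log (x 0) := by positivity
  have hv1 : 0 < |(v 1 : ℝ)| := (Real.exp_pos _).trans_le hlow
  have hlog0 : 0 ≤ Real.log |(v 1 : ℝ)| / (κ * Real.log (x 0)) := by
    refine div_nonneg ?_ hκℓ.le
    have : δ * Real.log (x 0) ≤ Real.log |(v 1 : ℝ)| := (Real.le_log_iff_exp_le hv1).2 hlow
    exact le_trans (by positivity) this
  have hlog1 : Real.log |(v 1 : ℝ)| / (κ * Real.log (x 0)) ≤ (1 - δ) / κ := by
    rw [div_le_div_iff₀ hκℓ hκ0]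
    have := (Real.log_le_iff_le_exp hv1).2 hupp
    nlinarith
  set k : ℕ := ⌈Real.log |(v 1 : ℝ)| / (κ * Real.log (x 0))⌉₊ with hk
  have hkK : k ≤ K := Nat.ceil_mono hlog1
  have hk1 := Nat.ceil_lt_add_one hlog0
  have hk2 := Nat.le_ceil (Real.log |(v 1 : ℝ)| / (κ * Real.log (x 0)))
  rw [← hk] at hk1 hk2
  refine absurd (hB k ?_ x v w (isAdmissible_of_orthogonal_pair hx1 hcop h1 h2 hv hw hwv hvw hmul
    hlow hupp ?_ ?_ ?_)) (not_lt.2 ((hS k hkK).trans hℓS))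
  · have h3 : (k : ℝ) ≤ (1 - δ) / κ + 1 := by linarith
    calc (k : ℝ) * κ ≤ ((1 - δ) / κ + 1) * κ := by gcongr
      _ = 1 - δ + κ := by field_simp
      _ ≤ 1 := by linarith
  · rw [div_le_iff₀ hκ0] at hℓc
    have h3 := Real.add_one_le_exp (κ * Real.log (x 0))
    have h4 := le_abs_self c
    linarith
  · rw [← Real.le_log_iff_exp_le hv1]
    have h3 := (le_div_iff₀ hκℓ).1 (sub_le_iff_le_add.2 hk1.le)
    linarith
  · rw [← Real.log_le_iff_le_exp hv1]
    have h3 := (div_le_iff₀ hκℓ).1 hk2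
    linarith

end SimultaneousApproximation

section Continuants

lemma contP_pos {a : ℕ → ℕ} (ha : ∀ k, 0 < a k) : ∀ k, 0 < contP a k
  | 0 => one_pos
  | 1 => Int.natCast_pos.2 (ha 0)
  | k + 2 => add_pos (mul_pos (Int.natCast_pos.2 (ha _)) (contP_pos ha (k + 1))) (contP_pos ha k)

lemma contQ_succ (a : ℕ → ℕ) : ∀ k, contQ a (k + 1) = contP (fun n => a (n + 1)) k
  | 0 => rfl
  | 1 => by simp [contQ, contP]
  | k + 2 => by rw [contQ, contP, contQ_succ a (k + 1), contQ_succ a k]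

lemma contP_succ (a : ℕ → ℕ) : ∀ k,
    contP a (k + 1) = a 0 * contP (fun n => a (n + 1)) k + contQ (fun n => a (n + 1)) k
  | 0 => by simp [contQ, contP]
  | 1 => by
    simp only [contQ, contP]
    ring
  | k + 2 => by
    rw [contP, contP_succ a (k + 1), contP_succ a k]
    simp only [contQ, contP]
    ring

lemma contQ_succ_pos {a : ℕ → ℕ} (ha : ∀ k, 0 < a k) (k : ℕ) : 0 < contQ a (k + 1) := by
  rw [contQ_succ]
  exact contP_pos (fun n => ha _) k

lemma contQ_nonneg {a : ℕ → ℕ} (ha : ∀ k, 0 < a k) : ∀ k, 0 ≤ contQ a k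
  | 0 => le_rfl
  | k + 1 => (contQ_succ_pos ha k).le

lemma contQ_le_succ {a : ℕ → ℕ} (ha : ∀ k, 0 < a k) : ∀ k, contQ a k ≤ contQ a (k + 1)
  | 0 => zero_le_one
  | k + 1 => by
    have h1 : (1 : ℤ) ≤ a (k + 1) := by exact_mod_cast ha (k + 1)
    have h2 := contQ_succ_pos ha k
    have h3 := contQ_nonneg ha k
    rw [contQ]
    nlinarith

lemma le_contQ_succ {a : ℕ → ℕ} (ha : ∀ k, 0 < a k) : ∀ k : ℕ, (k : ℤ) ≤ contQ a (k + 1)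
  | 0 => zero_le_one
  | 1 => contQ_succ_pos ha 1
  | k + 2 => by
    have h1 : (1 : ℤ) ≤ a (k + 2) := by exact_mod_cast ha (k + 2)
    have h2 := contQ_succ_pos ha k
    have h3 := le_contQ_succ ha (k + 1)
    rw [contQ]
    push_cast at h3 ⊢
    nlinarith

lemma contP_mul_contQ_sub (a : ℕ → ℕ) : ∀ k,
    contP a (k + 1) * contQ a k - contP a k * contQ a (k + 1) = (-1) ^ (k + 1)
  | 0 => by simp [contP, contQ]
  | k + 1 => by
    rw [pow_succ, ← contP_mul_contQ_sub a k, contP, contQ]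
    ring

lemma cfPrefix_succ (a : ℕ → ℕ) (i : ℕ) :
    cfPrefix a (i + 1) = a 0 :: cfPrefix (fun n => a (n + 1)) i := by
  simp [cfPrefix, List.range_succ_eq_map (n := i + 1)]

lemma cfVal_cons {l : List ℕ} (hl : l ≠ []) (n : ℕ) : cfVal (n :: l) = n + 1 / cfVal l := by
  cases l with
  | nil => exact absurd rfl hl
  | cons m t => rfl

lemma cfPrefix_ne_nil (a : ℕ → ℕ) (i : ℕ) : cfPrefix a i ≠ [] := by
  simp [cfPrefix]

lemma cfVal_cfPrefix_succ (a : ℕ → ℕ) (i : ℕ) :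
    cfVal (cfPrefix a (i + 1)) = a 0 + 1 / cfVal (cfPrefix (fun n => a (n + 1)) i) := by
  rw [cfPrefix_succ, cfVal_cons (cfPrefix_ne_nil _ i)]

lemma cfVal_cfPrefix {a : ℕ → ℕ} (ha : ∀ k, 0 < a k) (i : ℕ) :
    cfVal (cfPrefix a i) = contP a (i + 1) / contQ a (i + 1) := by
  induction i generalizing a with
  | zero => simp [cfPrefix, cfVal, contP, contQ]
  | succ i ih =>
    have h1 : (0 : ℝ) < contP (fun n => a (n + 1)) (i + 1) := by
      exact_mod_cast contP_pos (fun n => ha _) (i + 1)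
    rw [cfVal_cfPrefix_succ, ih (fun n => ha _), contP_succ a (i + 1), contQ_succ a (i + 1)]
    push_cast
    field_simp

lemma cfVal_reverse_cfPrefix {a : ℕ → ℕ} (ha : ∀ k, 0 < a k) (i : ℕ) :
    cfVal (cfPrefix a i).reverse = contP a (i + 1) / contP a i := by
  induction i with
  | zero => simp [cfPrefix, cfVal, contP]
  | succ i ih =>
    have h1 : (0 : ℝ) < contP a (i + 1) := by exact_mod_cast contP_pos ha (i + 1)
    have h2 : (cfPrefix a (i + 1)).reverse = a (i + 1) :: (cfPrefix a i).reverse := by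
      simp [cfPrefix, List.range_succ (n := i + 1)]
    rw [h2, cfVal_cons (by simpa using cfPrefix_ne_nil a i), ih, contP]
    push_cast
    field_simp

lemma contQ_eq_contP_of_isMPal_one {a : ℕ → ℕ} (ha : ∀ k, 0 < a k) {i : ℕ}
    (h : IsMPal 1 (cfPrefix a i)) : contQ a (i + 1) = contP a i := by
  have h1 : (contP a (i + 1) : ℝ) ≠ 0 := by exact_mod_cast (contP_pos ha (i + 1)).ne'
  have h2 : (contP a i : ℝ) ≠ 0 := by exact_mod_cast (contP_pos ha i).ne'
  have h3 : (contQ a (i + 1) : ℝ) ≠ 0 := by exact_mod_cast (contQ_succ_pos ha i).ne'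
  rw [IsMPal, cfVal_cfPrefix ha, cfVal_reverse_cfPrefix ha, Nat.cast_one, one_mul,
    div_eq_div_iff h3 h2] at h
  exact_mod_cast (mul_left_cancel₀ h1 h).symm

end Continuants

section CompleteQuotients

open Filter Topology

variable {a : ℕ → ℕ} {α : ℝ}

lemma one_lt_of_tendsto_cfVal (ha : ∀ k, 0 < a k)
    (hα : Tendsto (fun i => cfVal (cfPrefix a i)) atTop (𝓝 α)) (hirr : Irrational α) : 1 < α := by
  refine lt_of_le_of_ne (ge_of_tendsto' hα fun i => ?_) hirr.ne_one.symm
  rw [cfVal_cfPrefix ha, one_le_div (by exact_mod_cast contQ_succ_pos ha i), contP_succ, contQ_succ]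
  have h1 : (1 : ℤ) ≤ a 0 := by exact_mod_cast ha 0
  have h2 := contP_pos (fun n => ha (n + 1)) i
  have h3 := contQ_nonneg (fun n => ha (n + 1)) i
  exact_mod_cast (by nlinarith : contP (fun n => a (n + 1)) i ≤ _)

lemma tendsto_cfVal_shift
    (hα : Tendsto (fun i => cfVal (cfPrefix a i)) atTop (𝓝 α)) (hirr : Irrational α) :
    Tendsto (fun i => cfVal (cfPrefix (fun n => a (n + 1)) i)) atTop (𝓝 (α - a 0)⁻¹) := by
  have h1 := ((tendsto_add_atTop_iff_nat 1).2 hα).sub_const (a 0 : ℝ)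
  have h2 := h1.inv₀ (sub_ne_zero.2 (hirr.ne_nat _))
  refine h2.congr fun i => ?_
  rw [cfVal_cfPrefix_succ]
  simp

lemma irrational_shift (hirr : Irrational α) (n : ℕ) : Irrational (α - n)⁻¹ :=
  (hirr.sub_natCast n).inv

/-- Consecutive approximation errors have ratio minus the complete quotient. -/
lemma exists_completeQuotient (ha : ∀ k, 0 < a k)
    (hα : Tendsto (fun i => cfVal (cfPrefix a i)) atTop (𝓝 α)) (hirr : Irrational α) (k : ℕ) :
    ∃ β : ℝ, 1 < β ∧
      contQ a k * α - contP a k = -β * (contQ a (k + 1) * α - contP a (k + 1)) := by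
  suffices h : ∃ β : ℝ, Irrational β ∧
      Tendsto (fun i => cfVal (cfPrefix (fun n => a (n + (k + 1))) i)) atTop (𝓝 β) ∧
      contQ a k * α - contP a k = -β * (contQ a (k + 1) * α - contP a (k + 1)) by
    obtain ⟨β, h1, h2, h3⟩ := h
    exact ⟨β, one_lt_of_tendsto_cfVal (fun n => ha _) h2 h1, h3⟩
  induction k with
  | zero =>
    refine ⟨(α - a 0)⁻¹, irrational_shift hirr _, tendsto_cfVal_shift hα hirr, ?_⟩
    have h0 : α - a 0 ≠ 0 := sub_ne_zero.2 (hirr.ne_nat _)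
    simp [contP, contQ, h0]
  | succ k ih =>
    obtain ⟨β, h1, h2, h3⟩ := ih
    refine ⟨(β - a (k + 1))⁻¹, irrational_shift h1 _, ?_, ?_⟩
    · have h4 := tendsto_cfVal_shift h2 h1
      simp only [zero_add] at h4
      refine h4.congr fun i => ?_
      congr 2
      funext n
      congr 1
      ring
    · have h0 : β - a (k + 1) ≠ 0 := sub_ne_zero.2 (h1.ne_nat _)
      rw [neg_mul, eq_neg_iff_add_eq_zero]
      field_simp
      simp only [contP, contQ]
      push_cast
      linear_combination h3

lemma abs_error_mul_le (ha : ∀ k, 0 < a k)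
    (hα : Tendsto (fun i => cfVal (cfPrefix a i)) atTop (𝓝 α)) (hirr : Irrational α) (k : ℕ) :
    |contQ a k * α - contP a k| * contQ a (k + 1) ≤ 1 := by
  obtain ⟨β, hβ, h⟩ := exists_completeQuotient ha hα hirr k
  set ε : ℝ := contQ a k * α - contP a k
  have h1 : (contP a (k + 1) : ℝ) * contQ a k - contP a k * contQ a (k + 1) = (-1) ^ (k + 1) := by
    exact_mod_cast contP_mul_contQ_sub a k
  have hQ : (0 : ℝ) ≤ contQ a k := by exact_mod_cast contQ_nonneg ha k
  have hQ' : (0 : ℝ) ≤ contQ a (k + 1) := by exact_mod_cast contQ_nonneg ha (k + 1)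
  have hβ0 : (0 : ℝ) < β := by linarith
  have h2 : ε * (contQ a (k + 1) + contQ a k / β) = (-1) ^ (k + 1) := by
    have h3 : ε / β = -(contQ a (k + 1) * α - contP a (k + 1)) := by
      rw [div_eq_iff hβ0.ne']
      linear_combination h
    rw [mul_add, mul_div_assoc', mul_comm ε (contQ a k : ℝ), mul_div_assoc, h3, ← h1]
    simp only [ε]
    ring
  have h4 : |ε| * (contQ a (k + 1) + contQ a k / β) = 1 := by
    rw [← abs_of_nonneg (a := (contQ a (k + 1) + contQ a k / β : ℝ)) (by positivity), ← abs_mul,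
      h2, abs_neg_one_pow]
  calc |ε| * contQ a (k + 1) ≤ |ε| * (contQ a (k + 1) + contQ a k / β) := by
        gcongr
        linarith [div_nonneg hQ hβ0.le]
    _ = 1 := h4

end CompleteQuotients

section Palindromes

open Filter Topology

variable {a : ℕ → ℕ} {α : ℝ}

/-- The approximations of `(1, α, α²)` given by a palindromic prefix. -/
lemma approximation_of_isMPal_one (ha : ∀ k, 0 < a k)
    (hα : Tendsto (fun i => cfVal (cfPrefix a i)) atTop (𝓝 α)) (hirr : Irrational α) {i : ℕ}
    (hi : 0 < i) (h : IsMPal 1 (cfPrefix a i)) :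
    |contQ a i * α - contQ a (i + 1)| ≤ (α + 1) / contQ a i ∧
      |contQ a i * α ^ 2 - contP a (i + 1)| ≤ (α + 1) / contQ a i := by
  have hpal := contQ_eq_contP_of_isMPal_one ha h
  have hα1 := one_lt_of_tendsto_cfVal ha hα hirr
  have hr : (0 : ℝ) < contQ a i := by
    obtain ⟨j, rfl⟩ := Nat.exists_eq_succ_of_ne_zero hi.ne'
    exact_mod_cast contQ_succ_pos ha j
  have hle1 : (contQ a i : ℝ) ≤ contQ a (i + 1) := by exact_mod_cast contQ_le_succ ha i
  have hle2 : (contQ a i : ℝ) ≤ contQ a (i + 2) := by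
    exact_mod_cast (contQ_le_succ ha i).trans (contQ_le_succ ha (i + 1))
  have hε : ∀ k, (contQ a i : ℝ) ≤ contQ a (k + 1) →
      |contQ a k * α - contP a k| ≤ 1 / contQ a i := fun k hk => by
    rw [le_div_iff₀ hr]
    exact (mul_le_mul_of_nonneg_left hk (abs_nonneg _)).trans (abs_error_mul_le ha hα hirr k)
  have h1 := hε i hle1
  have h2 := hε (i + 1) hle2
  rw [hpal] at h2 ⊢
  have h3 : 1 / (contQ a i : ℝ) ≤ (α + 1) / contQ a i := by gcongr; linarith
  refine ⟨h1.trans h3, ?_⟩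
  calc |contQ a i * α ^ 2 - contP a (i + 1)|
      = |α * (contQ a i * α - contP a i) + (contP a i * α - contP a (i + 1))| := by ring_nf
    _ ≤ |α| * |contQ a i * α - contP a i| + |contP a i * α - contP a (i + 1)| := by
      rw [← abs_mul]
      exact abs_add_le _ _
    _ ≤ α * (1 / contQ a i) + 1 / contQ a i := by
      rw [abs_of_pos (by linarith : 0 < α)]
      gcongr
    _ = _ := by ring

lemma isCoprime_contQ (a : ℕ → ℕ) (k : ℕ) : IsCoprime (contQ a (k + 1)) (contQ a k) := by
  have h1 := contP_mul_contQ_sub a k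
  have h2 : ((-1 : ℤ) ^ (k + 1)) * (-1) ^ (k + 1) = 1 := by rw [← mul_pow]; simp
  exact ⟨-(-1) ^ (k + 1) * contP a k, (-1) ^ (k + 1) * contP a (k + 1), by
    linear_combination (-1) ^ (k + 1) * h1 + h2⟩

lemma exists_isMPal_one_lt_contQ (ha : ∀ k, 0 < a k)
    (hpal : {i : ℕ | IsMPal 1 (cfPrefix a i)}.Infinite) (B : ℝ) :
    ∃ i, 0 < i ∧ IsMPal 1 (cfPrefix a i) ∧ B < contQ a i := by
  obtain ⟨i, hi, hB⟩ := hpal.exists_gt (⌈|B|⌉₊ + 2)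
  refine ⟨i, by lia, hi, ?_⟩
  obtain ⟨j, rfl⟩ := Nat.exists_eq_succ_of_ne_zero (show i ≠ 0 by lia)
  have h1 : (j : ℝ) ≤ contQ a (j + 1) := by exact_mod_cast le_contQ_succ ha j
  have h2 := (le_abs_self B).trans (Nat.le_ceil |B|)
  have h3 : (⌈|B|⌉₊ : ℝ) < j := by exact_mod_cast (by lia : ⌈|B|⌉₊ < j)
  exact (h2.trans_lt h3).trans_le h1

/-- The matrix of a long palindromic prefix maps a quadratic `α` to its conjugate. -/
lemma exists_isMPal_one_conjugate (ha : ∀ k, 0 < a k)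
    (hα : Tendsto (fun i => cfVal (cfPrefix a i)) atTop (𝓝 α)) (hirr : Irrational α)
    (hpal : {i : ℕ | IsMPal 1 (cfPrefix a i)}.Infinite) {A B C : ℤ} (hA : A ≠ 0)
    (h : (A : ℝ) * α ^ 2 + B * α + C = 0) {α' : ℝ} (hne : α' ≠ α)
    (h' : (A : ℝ) * α' ^ 2 + B * α' + C = 0) :
    ∃ i, contQ a (i + 1) = contP a i ∧
      α' * (contQ a i * α - contP a i) = contQ a (i + 1) * α - contP a (i + 1) := by
  have hα1 := one_lt_of_tendsto_cfVal ha hα hirr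
  obtain ⟨i, hi, hi1, hiB⟩ := exists_isMPal_one_lt_contQ ha hpal ((|(A : ℝ)| + |(B : ℝ)|) * (α + 1))
  have hr : (0 : ℝ) < contQ a i := lt_of_le_of_lt (by positivity) hiB
  have hp := contQ_eq_contP_of_isMPal_one ha hi1
  obtain ⟨h1, h2⟩ := approximation_of_isMPal_one ha hα hirr hi hi1
  have hn : A * contP a (i + 1) + B * contQ a (i + 1) + C * contQ a i = 0 := by
    rw [← Int.abs_lt_one_iff]
    have h3 : ((A * contP a (i + 1) + B * contQ a (i + 1) + C * contQ a i : ℤ) : ℝ) =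
        -(A * (contQ a i * α ^ 2 - contP a (i + 1)) + B * (contQ a i * α - contQ a (i + 1))) := by
      push_cast
      linear_combination contQ a i * h
    have h4 : |((A * contP a (i + 1) + B * contQ a (i + 1) + C * contQ a i : ℤ) : ℝ)| < 1 := by
      rw [h3, abs_neg]
      calc _ ≤ |(A : ℝ)| * |contQ a i * α ^ 2 - contP a (i + 1)| +
            |(B : ℝ)| * |contQ a i * α - contQ a (i + 1)| := by
            rw [← abs_mul, ← abs_mul]
            exact abs_add_le _ _
        _ ≤ |(A : ℝ)| * ((α + 1) / contQ a i) + |(B : ℝ)| * ((α + 1) / contQ a i) := by gcongr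
        _ = (|(A : ℝ)| + |(B : ℝ)|) * (α + 1) / contQ a i := by ring
        _ < 1 := (div_lt_one hr).2 hiB
    exact_mod_cast h4
  refine ⟨i, hp, ?_⟩
  have hn' : (A : ℝ) * contP a (i + 1) + B * contQ a (i + 1) + C * contQ a i = 0 := by
    exact_mod_cast hn
  have hv : (A : ℝ) * (α' + α) + B = 0 := by
    refine (mul_eq_zero.1 ?_).resolve_left (sub_ne_zero.2 hne)
    linear_combination h' - h
  have hA' : (A : ℝ) ≠ 0 := by exact_mod_cast hA
  rw [← hp]
  refine mul_left_cancel₀ hA' ?_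
  linear_combination (contQ a i * α - contQ a (i + 1)) * hv - contQ a i * h + hn'

lemma neg_one_lt_and_neg_of_mul_error (ha : ∀ k, 0 < a k)
    (hα : Tendsto (fun i => cfVal (cfPrefix a i)) atTop (𝓝 α)) (hirr : Irrational α) {x : ℝ}
    {i : ℕ} (h : x * (contQ a i * α - contP a i) = contQ a (i + 1) * α - contP a (i + 1)) :
    -1 < x ∧ x < 0 := by
  obtain ⟨β, hβ, hε⟩ := exists_completeQuotient ha hα hirr i
  have h0 : (contQ a (i + 1) : ℝ) * α - contP a (i + 1) ≠ 0 := by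
    refine sub_ne_zero.2 fun h0 => ?_
    exact (hirr.intCast_mul (contQ_succ_pos ha i).ne').ne_int _ h0
  have h1 : x * β = -1 := by
    refine mul_right_cancel₀ h0 ?_
    rw [hε] at h
    linear_combination -h
  constructor <;> nlinarith

end Palindromes

theorem algebraic_one_palindromic_reduced_and_equivalent_to_conjugate
    (a : ℕ → ℕ) (ha : ∀ k, 0 < a k) (α : ℝ)
    (hα : Filter.Tendsto (fun i => cfVal (cfPrefix a i)) Filter.atTop (nhds α))
    (hirr : Irrational α) (halg : IsAlgebraic ℚ α)
    (hpal : {i : ℕ | IsMPal 1 (cfPrefix a i)}.Infinite) :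
    IsReducedQuadIrr α ∧
      ∀ (A B C : ℤ) (α' : ℝ), A ≠ 0 →
        (A : ℝ) * α ^ 2 + (B : ℝ) * α + (C : ℝ) = 0 → α' ≠ α →
        (A : ℝ) * α' ^ 2 + (B : ℝ) * α' + (C : ℝ) = 0 → RealEquiv α α' := by
  refine ⟨⟨hirr, one_lt_of_tendsto_cfVal ha hα hirr, ?_⟩, fun A B C α' hA h hne h' => ?_⟩
  · obtain ⟨y, hy0, hy⟩ := exists_quadratic_relation halg (c := α + 1) fun B => by
      obtain ⟨i, hi, hi1, hiB⟩ := exists_isMPal_one_lt_contQ ha hpal B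
      obtain ⟨h1, h2⟩ := approximation_of_isMPal_one ha hα hirr hi hi1
      exact ⟨![contQ a i, contQ a (i + 1), contP a (i + 1)], hiB.le, isCoprime_contQ a i, h1, h2⟩
    have hy2 : y 2 ≠ 0 := fun h2 => by
      have hy1 : y 1 = 0 := by
        by_contra h1
        refine (hirr.mul_intCast h1).ne_int (-y 0) ?_
        push_cast
        rw [h2] at hy
        push_cast at hy
        linear_combination hy
      have h0 : y 0 = 0 := by
        rw [h2, hy1] at hy
        simpa using hy
      exact hy0 (funext fun e => by fin_cases e <;> assumption)
    have hyα : (y 2 : ℝ) * α ^ 2 + y 1 * α + y 0 = 0 := by linear_combination hy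
    refine ⟨y 2, y 1, y 0, hy2, hyα, fun x hx hxy => ?_⟩
    obtain ⟨i, -, h⟩ := exists_isMPal_one_conjugate ha hα hirr hpal hy2 hyα hx hxy
    exact neg_one_lt_and_neg_of_mul_error ha hα hirr h
  · obtain ⟨i, hp, h⟩ := exists_isMPal_one_conjugate ha hα hirr hpal hA h hne h'
    have hneg := (neg_one_lt_and_neg_of_mul_error ha hα hirr h).2
    have hden : ((-contQ a (i + 1) : ℤ) : ℝ) + (contQ a i : ℤ) * α' < 0 := by
      have h1 : (0 : ℝ) < contQ a (i + 1) := by exact_mod_cast contQ_succ_pos ha i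
      have h2 : (0 : ℝ) ≤ contQ a i := by exact_mod_cast contQ_nonneg ha i
      push_cast
      nlinarith
    refine ⟨-contP a (i + 1), contQ a (i + 1), -contQ a (i + 1), contQ a i, ?_, hden.ne, ?_⟩
    · have h1 := contP_mul_contQ_sub a i
      rw [← hp] at h1
      rcases neg_one_pow_eq_or ℤ (i + 1) with h2 | h2 <;> rw [h2] at h1
      · right; linear_combination -h1
      · left; linear_combination -h1
    · rw [eq_div_iff hden.ne]
      rw [← hp] at h
      push_cast
      linear_combination h
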